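/- Quantitative lower bound from density of large values: Let Y = (y,s) ∈ ℝ^{n+1}, r > 0, and let v ∈ C^{2,1} on the closure of Q_r(Y) satisfy v ≥ 0 and −v_t + Lv ≤ 0 at every point of Q_r(Y). Let Q⁰ := Q_{r/2}(y, s − (3/4)r²), and suppose |{X ∈ Q⁰ : v(X) ≥ 1}| > (1−μ)·|Q⁰| for some constant μ < 1. Then v ≥ 1 − β > 0 everywhere on Q_{r/2}(Y), where β < 1 is a positive constant depending only on n, ν, μ and S. -/

import Mathlib

open MeasureTheory ENNReal Metric Set RealInnerProductSpace

noncomputable section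

/-- `n`-dimensional Euclidean space. -/
abbrev En (n : ℕ) : Type := EuclideanSpace ℝ (Fin n)

variable {n : ℕ}

/-- Time derivative `u_t`. -/
def Dt (u : En n × ℝ → ℝ) (X : En n × ℝ) : ℝ :=
  deriv (fun t => u (X.1, t)) X.2

/-- First spatial derivative `D_i u`. -/
def Dx (u : En n × ℝ → ℝ) (i : Fin n) (X : En n × ℝ) : ℝ :=
  fderiv ℝ (fun x => u (x, X.2)) X.1 (EuclideanSpace.single i 1)

/-- Second spatial derivative `D_{ij} u`. -/
def Dxx (u : En n × ℝ → ℝ) (i j : Fin n) (X : En n × ℝ) : ℝ :=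
  Dx (Dx u j) i X

/-- `u` is of class `C^{2,1}` on `Q`: `u`, `D_i u`, `D_{ij} u`, `u_t` exist and are
continuous on `Q`. -/
structure IsC21 (u : En n × ℝ → ℝ) (Q : Set (En n × ℝ)) : Prop where
  cont : ContinuousOn u Q
  diff_t : ∀ X ∈ Q, DifferentiableAt ℝ (fun t => u (X.1, t)) X.2
  diff_x : ∀ X ∈ Q, DifferentiableAt ℝ (fun x => u (x, X.2)) X.1
  diff_xx : ∀ j : Fin n, ∀ X ∈ Q, DifferentiableAt ℝ (fun x => Dx u j (x, X.2)) X.1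
  cont_t : ContinuousOn (Dt u) Q
  cont_x : ∀ i, ContinuousOn (Dx u i) Q
  cont_xx : ∀ i j, ContinuousOn (Dxx u i j) Q

/-- Uniform parabolicity with constant `ν` on `Q`:
`ν⁻¹|ξ|² ≤ Σ a_ij ξ_i ξ_j` and `Σ a_ij² ≤ ν²`. -/
def UnifParabolic (ν : ℝ) (a : En n × ℝ → Matrix (Fin n) (Fin n) ℝ)
    (Q : Set (En n × ℝ)) : Prop :=
  ∀ X ∈ Q, (∀ ξ : Fin n → ℝ, ν⁻¹ * (∑ i, ξ i ^ 2) ≤ ∑ i, ∑ j, a X i j * ξ i * ξ j) ∧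
    (∑ i, ∑ j, (a X i j) ^ 2) ≤ ν ^ 2

/-- `Lu = Σ_{ij} a_ij D_ij u + Σ_i b_i D_i u`. -/
def Lop (a : En n × ℝ → Matrix (Fin n) (Fin n) ℝ) (b : En n × ℝ → En n)
    (u : En n × ℝ → ℝ) (X : En n × ℝ) : ℝ :=
  (∑ i, ∑ j, a X i j * Dxx u i j X) + ∑ i, b X i * Dx u i X

/-- `∫ (ess sup_t |f(x,t)|)ⁿ dx`, the `n`-th power of the `L^n_x L^∞_t` norm of `f`
over the set `Q ⊆ ℝⁿ × ℝ`. -/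
def LxnLtinfPow {E : Type*} [NNNorm E] (f : En n × ℝ → E) (Q : Set (En n × ℝ)) : ℝ≥0∞ :=
  ∫⁻ x, (essSup (fun t => (‖f (x, t)‖₊ : ℝ≥0∞)) (volume.restrict {t | (x, t) ∈ Q})) ^ n

/-- The `L^n_x L^∞_t` norm of `f` over `Q`. -/
def LxnLtinf {E : Type*} [NNNorm E] (f : En n × ℝ → E) (Q : Set (En n × ℝ)) : ℝ≥0∞ :=
  (LxnLtinfPow f Q) ^ (1 / (n : ℝ))

/-- The box `B_ρ(y) × (t₁, t₂)`. -/
def box (y : En n) (ρ t₁ t₂ : ℝ) : Set (En n × ℝ) := ball y ρ ×ˢ Ioo t₁ t₂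

/-- The standard parabolic cylinder `Q_r(Y) = B_r(y) × (s - r², s)`. -/
def pcyl (Y : En n × ℝ) (r : ℝ) : Set (En n × ℝ) := box Y.1 r (Y.2 - r ^ 2) Y.2

/-- The slanted cylinder `V_r(Y) = {(x,t) : |x - (t/s)y| < r, 0 < t < s}`. -/
def slantCyl (Y : En n × ℝ) (r : ℝ) : Set (En n × ℝ) :=
  {X | ‖X.1 - (X.2 / Y.2) • Y.1‖ < r ∧ 0 < X.2 ∧ X.2 < Y.2}

/-- Supremum of the positive part `u₊` over a set `A`. -/
def supPos (u : En n × ℝ → ℝ) (A : Set (En n × ℝ)) : ℝ :=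
  sSup ((fun X => max (u X) 0) '' A)

/-- `Ω` is a Lipschitz domain with character `(rΩ, mΩ)`: at every boundary point `y`
there is a coordinate frame, encoded by the unit "vertical" direction `e`, in which
`Ω ∩ B_{rΩ}(y)` is the region above the graph of an `mΩ`-Lipschitz function `φ`
of the tangential variables. -/
def IsLipschitzDomain (Ω : Set (En n)) (rΩ mΩ : ℝ) : Prop :=
  0 < rΩ ∧ 0 ≤ mΩ ∧
  ∀ y ∈ frontier Ω, ∃ (e : En n) (φ : En n → ℝ),
    ‖e‖ = 1 ∧ LipschitzWith (Real.toNNReal mΩ) φ ∧ φ 0 = 0 ∧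
    (∀ x, x ∈ Ω ∩ ball y rΩ ↔
      dist x y < rΩ ∧ φ ((x - y) - ⟪x - y, e⟫ • e) < ⟪x - y, e⟫) ∧
    (∀ ρ : ℝ, 0 < ρ → ρ ≤ rΩ → y + ρ • e ∈ Ω)


theorem vol_eq_smul_hausdorff (n : ℕ) : ∃ c : ℝ≥0∞, (volume : Measure (En n)) = c • Measure.hausdorffMeasure (n : ℝ) := by
  refine ⟨Measure.addHaarScalarFactor (volume : Measure (En n)) (Measure.hausdorffMeasure (n : ℝ)), ?_⟩
  exact Measure.isAddLeftInvariant_eq_smul (volume : Measure (En n)) (Measure.hausdorffMeasure (n : ℝ))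

theorem lip_vol {P A : Set (En n)} {X : En n → En n} {K : NNReal} (hA : ∀ p ∈ P, X p ∈ A)
    (h : ∀ p ∈ P, ∀ q ∈ P, dist p q ≤ K * dist (X p) (X q)) :
    volume P ≤ (K : ℝ≥0∞) ^ n * volume A := by
  have hinj : InjOn X P := by
    intro p hp q hq hpq
    have := h p hp q hq
    rw [hpq, dist_self, mul_zero] at this
    exact dist_le_zero.1 this
  set f := Function.invFunOn X P with hf
  have hfX : ∀ p ∈ P, f (X p) = p := fun p hp => hinj.leftInvOn_invFunOn hp
  have hP : f '' (X '' P) = P := hinj.leftInvOn_invFunOn.image_image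
  have hlip : LipschitzOnWith K f (X '' P) := by
    refine LipschitzOnWith.of_dist_le_mul ?_
    rintro _ ⟨p, hp, rfl⟩ _ ⟨q, hq, rfl⟩
    rw [hfX p hp, hfX q hq]
    exact h p hp q hq
  obtain ⟨c, hc⟩ := vol_eq_smul_hausdorff n
  have h1 := hlip.hausdorffMeasure_image_le (d := (n : ℝ)) (by positivity)
  rw [hP, ENNReal.rpow_natCast] at h1
  calc volume P = c * Measure.hausdorffMeasure (n : ℝ) P := by rw [hc]; rfl
    _ ≤ c * ((K : ℝ≥0∞) ^ n * Measure.hausdorffMeasure (n : ℝ) A) := by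
        gcongr
        refine h1.trans ?_
        gcongr
        rintro _ ⟨p, hp, rfl⟩
        exact hA p hp
    _ = (K : ℝ≥0∞) ^ n * volume A := by rw [hc, Measure.smul_apply, smul_eq_mul]; ring

theorem SL_piece (hn : 0 < n) {P A : Set (En n)} {X : En n → En n} {ℓ : En n → ℝ≥0∞} {Λ : En n → NNReal}
    {η : NNReal} (hη : 0 < η) (hηℓ : ∀ x, (η : ℝ≥0∞) ≤ ℓ x) (k : ℕ) (hA : MeasurableSet A)
    (hk : ∀ x ∈ A, ⌊(ℓ x / η).toNNReal⌋₊ = k) (hXA : ∀ p ∈ P, X p ∈ A)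
    (hΛ : ∀ p ∈ P, (Λ p : ℝ≥0∞) ≤ ℓ (X p))
    (h : ∀ p ∈ P, ∀ q ∈ P, dist p q ≤ Λ q * dist (X p) (X q)) :
    volume P ≤ ∫⁻ x in A, (2 * ℓ x) ^ n := by
  have hη' : (η : ℝ≥0∞) ≠ 0 := by exact_mod_cast hη.ne'
  have key : ∀ x ∈ A, ℓ x ≠ ∞ → (1 ≤ k ∧ ℓ x ≤ (k + 1) * η ∧ k * η ≤ ℓ x) := by
    intro x hx hxt
    lift ℓ x to NNReal using hxt with l hl
    have h1 : (η : ℝ≥0∞) ≤ l := hl ▸ hηℓ x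
    have h1' : η ≤ l := by exact_mod_cast h1
    have hkx := hk x hx
    rw [← hl, ← ENNReal.coe_div hη.ne', ENNReal.toNNReal_coe] at hkx
    have h2 : k ≤ l / η := by rw [← hkx]; exact Nat.floor_le (by positivity)
    have h3 : l / η < k + 1 := by rw [← hkx]; exact Nat.lt_floor_add_one _
    have h4 : 1 ≤ k := by
      rw [← hkx]; apply Nat.le_floor
      rw [Nat.cast_one, one_le_div hη]; exact h1'
    rw [le_div_iff₀ hη] at h2
    rw [div_lt_iff₀ hη] at h3
    exact ⟨h4, by exact_mod_cast h3.le, by exact_mod_cast h2⟩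
  by_cases hz : volume A = 0
  · have : P ⊆ ⋃ m : ℕ, {p ∈ P | Λ p ≤ m} := by
      intro p hp
      obtain ⟨m, hm⟩ := exists_nat_ge (Λ p)
      exact mem_iUnion.2 ⟨m, hp, hm⟩
    have h0 : volume P = 0 := by
      refine measure_mono_null this (measure_iUnion_null fun m => ?_)
      have := lip_vol (P := {p ∈ P | Λ p ≤ m}) (A := A) (X := X) (K := m) (fun p hp => hXA p hp.1)
        (fun p hp q hq => (h p hp.1 q hq.1).trans (by gcongr; exact hq.2))
      rw [hz, mul_zero] at this
      exact le_antisymm this zero_le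
    rw [h0]; exact zero_le
  rcases Nat.eq_zero_or_pos k with hk0 | hk0
  · have : ∀ x ∈ A, ℓ x = ∞ := by
      intro x hx
      by_contra hc
      have := (key x hx hc).1
      omega
    have h2 : ∫⁻ x in A, (2 * ℓ x) ^ n = ∞ := by
      rw [setLIntegral_congr_fun (g := fun _ => ∞) hA]
      · simp [hz]
      · intro x hx
        simp [this x hx, hn.ne']
    rw [h2]; exact le_top
  · have hfin : ∀ x ∈ A, ℓ x ≠ ∞ := by
      intro x hx hc
      have := hk x hx
      rw [hc, ENNReal.top_div_of_ne_top ENNReal.coe_ne_top] at this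
      simp at this
      omega
    have h3 := lip_vol (P := P) (A := A) (X := X) (K := (k+1) * η) hXA (fun p hp q hq => (h p hp q hq).trans (by
      gcongr
      have h5 := (hΛ q hq).trans (key (X q) (hXA q hq) (hfin _ (hXA q hq))).2.1
      exact_mod_cast h5))
    refine h3.trans ?_
    rw [← setLIntegral_const]
    refine setLIntegral_mono' hA ?_
    intro x hx
    obtain ⟨h4, h5, h6⟩ := key x hx (hfin x hx)
    gcongr
    calc (((k + 1) * η : NNReal) : ℝ≥0∞) ≤ ((2 * (k * η) : NNReal) : ℝ≥0∞) := by
          norm_cast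
          have : (1 : NNReal) ≤ k := by exact_mod_cast h4
          calc ((k + 1 : ℕ) : NNReal) * η ≤ (2 * k : NNReal) * η := by
                push_cast
                gcongr; rw [two_mul]; gcongr
            _ = _ := by ring
      _ ≤ 2 * ℓ x := by push_cast; gcongr

theorem SL (hn : 0 < n) {P E : Set (En n)} {X : En n → En n} {ℓ : En n → ℝ≥0∞}
    {η : NNReal} (hη : 0 < η) (hηℓ : ∀ x, (η : ℝ≥0∞) ≤ ℓ x) (hℓ : Measurable ℓ) (hE : MeasurableSet E)
    (hXE : ∀ p ∈ P, X p ∈ E)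
    (h : ∀ q ∈ P, ∃ ρ > 0, ∃ Λ : NNReal, (Λ : ℝ≥0∞) ≤ ℓ (X q) ∧ ∀ p ∈ P, dist (X p) (X q) < ρ →
      dist p q ≤ Λ * dist (X p) (X q)) :
    volume P ≤ ∫⁻ x in E, (2 * ℓ x) ^ n := by
  choose! ρ hρ Λ hΛ h using h
  have hPi : P = ⋃ i : ℕ, {p ∈ P | 1 / ((i : ℝ) + 1) < ρ p} := by
    ext p
    simp only [mem_iUnion, mem_ofPred_eq]
    constructor
    · intro hp
      obtain ⟨i, hi⟩ := exists_nat_one_div_lt (hρ p hp)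
      exact ⟨i, hp, hi⟩
    · rintro ⟨i, hp, _⟩; exact hp
  rw [hPi, Monotone.measure_iUnion]
  swap
  · intro i j hij p hp
    refine ⟨hp.1, lt_of_le_of_lt ?_ hp.2⟩
    have : (i : ℝ) ≤ j := by exact_mod_cast hij
    gcongr
  refine iSup_le fun i => ?_
  set r : ℝ := 1 / ((i : ℝ) + 1) with hr
  have hr0 : 0 < r := by positivity
  set B : ℕ → Set (En n) := disjointed (fun k => ball (TopologicalSpace.denseSeq (En n) k) (r / 2)) with hB
  have hBm : ∀ k, MeasurableSet (B k) := MeasurableSet.disjointed fun k => measurableSet_ball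
  have hBd : ∀ k, ∀ x ∈ B k, ∀ y ∈ B k, dist x y < r := by
    intro k x hx y hy
    have hx' := (Set.le_iff_subset.1 (disjointed_le (fun k => ball (TopologicalSpace.denseSeq (En n) k) (r / 2)) k)) hx
    have hy' := (Set.le_iff_subset.1 (disjointed_le (fun k => ball (TopologicalSpace.denseSeq (En n) k) (r / 2)) k)) hy
    simp only [mem_ball] at hx' hy'
    have := dist_triangle_right x y (TopologicalSpace.denseSeq (En n) k)
    linarith
  have hBU : ⋃ k, B k = univ := by
    rw [hB, iUnion_disjointed]
    refine eq_univ_of_forall fun x => ?_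
    obtain ⟨k, hk⟩ := (TopologicalSpace.denseRange_denseSeq (En n)).exists_dist_lt x (half_pos hr0)
    exact mem_iUnion.2 ⟨k, hk⟩
  set lev : En n → ℕ := fun x => ⌊(ℓ x / η).toNNReal⌋₊ with hlev
  have hlevm : Measurable lev := Nat.measurable_floor.comp (hℓ.div_const _).ennreal_toNNReal
  set A : ℕ × ℕ → Set (En n) := fun j => E ∩ (B j.1 ∩ lev ⁻¹' {j.2}) with hA
  have hAm : ∀ j, MeasurableSet (A j) := fun j => hE.inter ((hBm _).inter (hlevm (measurableSet_singleton _)))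
  have hAd : Pairwise (Function.onFun Disjoint A) := by
    intro j j' hjj
    rw [Function.onFun, Set.disjoint_left]
    rintro x ⟨_, hx1, hx2⟩ ⟨_, hy1, hy2⟩
    apply hjj
    refine Prod.ext ?_ (hx2.symm.trans hy2)
    by_contra hc
    exact Set.disjoint_left.1 (disjoint_disjointed _ hc) hx1 hy1
  have hAU : ⋃ j, A j = E := by
    ext x
    simp only [mem_iUnion]
    constructor
    · rintro ⟨j, hx, _⟩; exact hx
    · intro hx
      obtain ⟨k, hk⟩ := mem_iUnion.1 (hBU ▸ mem_univ x : x ∈ ⋃ k, B k)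
      exact ⟨(k, lev x), hx, hk, rfl⟩
  rw [← hAU, lintegral_iUnion hAm hAd]
  have hsub : {p ∈ P | r < ρ p} ⊆ ⋃ j, {p ∈ P | r < ρ p ∧ X p ∈ A j} := by
    intro p hp
    obtain ⟨j, hj⟩ := mem_iUnion.1 (hAU ▸ hXE p hp.1 : X p ∈ ⋃ j, A j)
    exact mem_iUnion.2 ⟨j, hp.1, hp.2, hj⟩
  refine (measure_mono hsub).trans ((measure_iUnion_le _).trans (ENNReal.tsum_le_tsum fun j => ?_))
  refine SL_piece (Λ := Λ) hn hη hηℓ j.2 (hAm j) (fun x hx => hx.2.2) (fun p hp => hp.2.2) (fun p hp => hΛ p hp.1) ?_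
  intro p hp q hq
  exact h q hq.1 p hp.1 ((hBd j.1 _ hp.2.2.2.1 _ hq.2.2.2.1).trans hq.2.1)

/-- slope comparison -/
theorem lip_slope {F : En n → ℝ} {x x0 p p0 : En n} {c ρ Λ : ℝ} (hΛ : 0 ≤ Λ)
    (hlow : ∀ z ∈ ball x0 ρ, c + ⟪p, z - x⟫ ≤ F z)
    (hup : ∀ z ∈ ball x0 ρ, F z ≤ F x0 + ⟪p0, z - x0⟫ + Λ * ‖z - x0‖ ^ 2)
    (hc : F x0 + ⟪p0, x - x0⟫ ≤ c) (hx : 2 * dist x x0 < ρ) :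
    dist p p0 ≤ 4 * Λ * dist x x0 := by
  by_cases hp : p = p0
  · subst hp; simp; positivity
  set d := dist x x0 with hd
  have hpp : 0 < ‖p - p0‖ := norm_pos_iff.2 (sub_ne_zero.2 hp)
  set e : En n := ‖p - p0‖⁻¹ • (p - p0) with he
  have hen : ‖e‖ = 1 := by rw [he, norm_smul, norm_inv, norm_norm, inv_mul_cancel₀ hpp.ne']
  have hie : ⟪p - p0, e⟫ = ‖p - p0‖ := by
    rw [he, inner_smul_right, real_inner_self_eq_norm_sq]; field_simp
  have hd0 : 0 ≤ d := dist_nonneg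
  have main : ∀ s : ℝ, 0 ≤ s → d + s < ρ → s * ‖p - p0‖ ≤ Λ * (d + s) ^ 2 := by
    intro s hs hds
    set z := x + s • e with hz
    have hzn : ‖z - x0‖ ≤ d + s := by
      have : z - x0 = (x - x0) + s • e := by rw [hz]; abel
      rw [this]
      refine (norm_add_le _ _).trans ?_
      rw [norm_smul, hen, Real.norm_eq_abs, abs_of_nonneg hs, mul_one, hd, dist_eq_norm]
    have hzb : z ∈ ball x0 ρ := by rw [mem_ball, dist_eq_norm]; linarith
    have h1 := hlow z hzb
    have h2 := hup z hzb
    have e1 : z - x = s • e := by rw [hz]; abel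
    have e2 : z - x0 = (x - x0) + s • e := by rw [hz]; abel
    rw [e1, inner_smul_right] at h1
    have h3 : ⟪p0, z - x0⟫ = ⟪p0, x - x0⟫ + s * ⟪p0, e⟫ := by rw [e2, inner_add_right, inner_smul_right]
    rw [h3] at h2
    rw [inner_sub_left] at hie
    have h4 : Λ * ‖z - x0‖ ^ 2 ≤ Λ * (d + s) ^ 2 := by gcongr
    have h5 : s * ‖p - p0‖ = s * ⟪p, e⟫ - s * ⟪p0, e⟫ := by rw [← hie]; ring
    linarith
  rw [dist_eq_norm]
  rcases hd0.eq_or_lt with h0 | h0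
  · -- d = 0
    rw [← h0] at main ⊢
    by_contra hcon
    have hρ : 0 < ρ := by rw [← h0] at hx; linarith
    have hs : ∀ s : ℝ, 0 < s → s < ρ → ‖p - p0‖ ≤ Λ * s := by
      intro s hs hsρ
      have := main s hs.le (by linarith)
      rw [zero_add] at this
      have h6 : s * ‖p - p0‖ ≤ s * (Λ * s) := by nlinarith
      exact le_of_mul_le_mul_left h6 hs
    set s := min (ρ / 2) (‖p - p0‖ / (2 * (Λ + 1))) with hsdef
    have hs0 : 0 < s := by positivity
    have h7 := hs s hs0 ((min_le_left _ _).trans_lt (by linarith))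
    have h8 : s * (2 * (Λ + 1)) ≤ ‖p - p0‖ := by
      rw [← le_div_iff₀ (by positivity)]; exact min_le_right _ _
    nlinarith
  · have := main d hd0 (by linarith)
    have h6 : d * ‖p - p0‖ ≤ d * (4 * Λ * d) := by nlinarith
    exact le_of_mul_le_mul_left h6 h0

theorem SABP (hn : 0 < n) {C : Set (En n × ℝ)} {u : En n × ℝ → ℝ} {P E : Set (En n)} {ℓ : En n → ℝ≥0∞}
    {η : NNReal} (hη : 0 < η) (hηℓ : ∀ x, (η : ℝ≥0∞) ≤ ℓ x) (hℓ : Measurable ℓ) (hE : MeasurableSet E)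
    (h : ∀ p ∈ P, ∃ X ∈ C, X.1 ∈ E ∧ (∀ Z ∈ C, u X - ⟪p, X.1⟫ ≤ u Z - ⟪p, Z.1⟫) ∧
      ∃ ρ > 0, ∃ Λ : NNReal, ((4 * Λ : NNReal) : ℝ≥0∞) ≤ ℓ X.1 ∧ ∀ z ∈ ball X.1 ρ, (z, X.2) ∈ C ∧
        u (z, X.2) ≤ u X + ⟪p, z - X.1⟫ + Λ * ‖z - X.1‖ ^ 2) :
    volume P ≤ ∫⁻ x in E, (2 * ℓ x) ^ n := by
  choose! X hXC hXE hmin ρ hρ Λ hΛ hup using h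
  refine SL hn (X := fun p => (X p).1) hη hηℓ hℓ hE hXE ?_
  intro q hq
  refine ⟨ρ q / 2, half_pos (hρ q hq), 4 * Λ q, hΛ q hq, ?_⟩
  intro p hp hpq
  have := lip_slope (F := fun z => u (z, (X q).2)) (x := (X p).1) (x0 := (X q).1) (p := p) (p0 := q)
    (c := u (X p)) (ρ := ρ q) (Λ := Λ q) (by positivity) ?_ (fun z hz => (hup q hq z hz).2) ?_ (by linarith)
  · exact_mod_cast this
  · intro z hz
    have := hmin p hp _ (hup q hq z hz).1
    simp only at this
    rw [inner_sub_right]; linarith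
  · have := hmin q hq _ (hXC p hp)
    rw [inner_sub_right]; simp only [Prod.mk.eta]; linarith

/-- the linear map of a matrix -/
def mcl (M : Matrix (Fin n) (Fin n) ℝ) : En n →L[ℝ] En n := Matrix.toEuclideanCLM (𝕜 := ℝ) M

theorem mcl_apply (M : Matrix (Fin n) (Fin n) ℝ) (x : En n) (i : Fin n) : mcl M x i = ∑ j, M i j * x j := by
  simp [mcl, Matrix.mulVec, dotProduct]

theorem inner_mcl (M : Matrix (Fin n) (Fin n) ℝ) (x : En n) :
    ⟪mcl M x, x⟫ = ∑ i, ∑ j, M i j * x i * x j := by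
  rw [PiLp.inner_apply]
  refine Finset.sum_congr rfl fun i _ => ?_
  rw [mcl_apply]
  simp only [RCLike.inner_apply, conj_trivial, Finset.mul_sum]
  refine Finset.sum_congr rfl fun j _ => by ring

theorem mcl_sub (M N : Matrix (Fin n) (Fin n) ℝ) : mcl (M - N) = mcl M - mcl N := by
  simp [mcl]

/-- admissible matrices -/
def Ell (n : ℕ) (ν : ℝ) : Set (Matrix (Fin n) (Fin n) ℝ) :=
  {a | (∀ ξ : Fin n → ℝ, ν⁻¹ * (∑ i, ξ i ^ 2) ≤ ∑ i, ∑ j, a i j * ξ i * ξ j) ∧ (∑ i, ∑ j, (a i j) ^ 2) ≤ ν ^ 2}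

def tr2 (a H : Matrix (Fin n) (Fin n) ℝ) : ℝ := ∑ i, ∑ j, a i j * H i j

theorem tr2_sub (a H N : Matrix (Fin n) (Fin n) ℝ) : tr2 a (H - N) = tr2 a H - tr2 a N := by
  simp [tr2, mul_sub, Finset.sum_sub_distrib]

theorem psd_tr {M : Matrix (Fin n) (Fin n) ℝ} (hM : M.PosSemidef) {ν : ℝ} {a : Matrix (Fin n) (Fin n) ℝ}
    (ha : a ∈ Ell n ν) : ν⁻¹ * M.trace ≤ tr2 a M := by
  obtain ⟨m, A, rfl⟩ := Matrix.posSemidef_iff_eq_sum_vecMulVec.1 hM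
  have h1 : tr2 a (∑ k, Matrix.vecMulVec (A k) (star (A k))) = ∑ k, ∑ i, ∑ j, a i j * A k i * A k j := by
    simp only [tr2, Matrix.sum_apply, Matrix.vecMulVec_apply, Finset.mul_sum, star_trivial]
    rw [Finset.sum_congr rfl (fun i _ => Finset.sum_comm), Finset.sum_comm]
    refine Finset.sum_congr rfl fun k _ => ?_
    refine Finset.sum_congr rfl fun i _ => Finset.sum_congr rfl fun j _ => by ring
  have h2 : (∑ k, Matrix.vecMulVec (A k) (star (A k))).trace = ∑ k, ∑ i, A k i ^ 2 := by
    simp only [Matrix.trace, Matrix.diag, Matrix.sum_apply, Matrix.vecMulVec_apply, star_trivial]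
    rw [Finset.sum_comm]
    refine Finset.sum_congr rfl fun k _ => Finset.sum_congr rfl fun j _ => by ring
  rw [h1, h2, Finset.mul_sum]
  exact Finset.sum_le_sum fun k _ => ha.1 (A k)

theorem psd_norm {M : Matrix (Fin n) (Fin n) ℝ} (hM : M.PosSemidef) (x : En n) : ‖mcl M x‖ ≤ M.trace * ‖x‖ := by
  obtain ⟨m, A, rfl⟩ := Matrix.posSemidef_iff_eq_sum_vecMulVec.1 hM
  set B : Fin m → En n := fun k => WithLp.toLp 2 (A k) with hB
  have h2 : (∑ k, Matrix.vecMulVec (A k) (star (A k))).trace = ∑ k, ‖B k‖ ^ 2 := by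
    simp only [Matrix.trace, Matrix.diag, Matrix.sum_apply, Matrix.vecMulVec_apply, star_trivial]
    rw [Finset.sum_comm]
    refine Finset.sum_congr rfl fun k _ => ?_
    rw [EuclideanSpace.real_norm_sq_eq]
    refine Finset.sum_congr rfl fun j _ => by simp [hB]; ring
  have h3 : mcl (∑ k, Matrix.vecMulVec (A k) (star (A k))) x = ∑ k, ⟪B k, x⟫ • B k := by
    ext i
    rw [mcl_apply]
    simp only [Matrix.sum_apply, Matrix.vecMulVec_apply, star_trivial, Finset.sum_mul, WithLp.ofLp_sum, Finset.sum_apply,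
      PiLp.smul_apply, smul_eq_mul, PiLp.inner_apply, RCLike.inner_apply, conj_trivial]
    rw [Finset.sum_comm]
    refine Finset.sum_congr rfl fun k _ => Finset.sum_congr rfl fun j _ => by simp [hB]; ring
  rw [h2, h3, Finset.sum_mul]
  refine (norm_sum_le _ _).trans (Finset.sum_le_sum fun k _ => ?_)
  rw [norm_smul]
  calc ‖⟪B k, x⟫‖ * ‖B k‖ ≤ (‖B k‖ * ‖x‖) * ‖B k‖ := by gcongr; exact norm_inner_le_norm _ _
    _ = _ := by ring

theorem mvt_line {F : En n → ℝ} {G : En n → En n} {x z : En n}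
    (hF : ∀ y ∈ segment ℝ x z, HasFDerivAt F (innerSL ℝ (G y)) y) :
    ∃ s ∈ Ioo (0 : ℝ) 1, F z - F x = ⟪G (x + s • (z - x)), z - x⟫ := by
  have hseg : ∀ s ∈ Icc (0 : ℝ) 1, x + s • (z - x) ∈ segment ℝ x z := by
    intro s hs
    rw [segment_eq_image']
    exact ⟨s, hs, rfl⟩
  have hd : ∀ s ∈ Icc (0 : ℝ) 1, HasDerivAt (fun s : ℝ => F (x + s • (z - x))) (⟪G (x + s • (z - x)), z - x⟫) s := by
    intro s hs
    have h1 : HasDerivAt (fun s : ℝ => x + s • (z - x)) (z - x) s := by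
      simpa using ((hasDerivAt_id s).smul_const (z - x)).const_add x
    have := (hF _ (hseg s hs)).comp_hasDerivAt s h1
    exact this
  obtain ⟨s, hs, h⟩ := exists_hasDerivAt_eq_slope (fun s : ℝ => F (x + s • (z - x))) _ one_pos
    (fun s hs => (hd s hs).continuousAt.continuousWithinAt) (fun s hs => hd s (Ioo_subset_Icc_self hs))
  refine ⟨s, hs, ?_⟩
  rw [h]; simp

set_option maxHeartbeats 400000 in
theorem min2 {F : En n → ℝ} {G : En n → En n} {M : Matrix (Fin n) (Fin n) ℝ} {x : En n} {r : ℝ} (hr : 0 < r)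
    (hF : ∀ z ∈ ball x r, HasFDerivAt F (innerSL ℝ (G z)) z) (hG : HasFDerivAt G (mcl M) x)
    (hM : M.IsSymm) (hmin : IsLocalMin F x) :
    G x = 0 ∧ M.PosSemidef ∧ ∀ η > 0, ∃ ρ > 0, ∀ z ∈ ball x ρ, F z ≤ F x + (M.trace + η) * ‖z - x‖ ^ 2 := by
  have h0 : G x = 0 := by
    have := hmin.hasFDerivAt_eq_zero (hF x (mem_ball_self hr))
    have h2 : innerSL ℝ (G x) (G x) = 0 := by rw [this]; rfl
    simpa using h2
  have hsmall : ∀ η > 0, ∃ ρ > 0, ρ ≤ r ∧ ∀ z ∈ ball x ρ, ‖G z - mcl M (z - x)‖ ≤ η * ‖z - x‖ := by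
    intro η hη
    have := hG.isLittleO.def hη
    rw [Metric.eventually_nhds_iff_ball] at this
    obtain ⟨ρ, hρ, h⟩ := this
    refine ⟨min ρ r, by positivity, min_le_right _ _, fun z hz => ?_⟩
    have := h z (ball_subset_ball (min_le_left _ _) hz)
    rwa [h0, sub_zero] at this
  have hpsd : M.PosSemidef := by
    rw [Matrix.posSemidef_iff_dotProduct_mulVec]
    refine ⟨by rw [Matrix.IsHermitian, Matrix.conjTranspose_eq_transpose_of_trivial]; exact hM, fun ξ' => ?_⟩
    set ξ : En n := WithLp.toLp 2 ξ' with hξ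
    have e1 : star ξ' ⬝ᵥ M.mulVec ξ' = ⟪mcl M ξ, ξ⟫ := by
      rw [inner_mcl]
      simp [dotProduct, Matrix.mulVec, Finset.mul_sum, hξ]
      refine Finset.sum_congr rfl fun i _ => Finset.sum_congr rfl fun j _ => by ring
    rw [e1]
    by_contra hneg
    push Not at hneg
    set q := ⟪mcl M ξ, ξ⟫ with hq
    have hξ0 : 0 < ‖ξ‖ := by
      rw [norm_pos_iff]; intro h; rw [hq, h] at hneg; simp at hneg
    obtain ⟨ρ, hρ, hρr, hs⟩ := hsmall (-q / (2 * ‖ξ‖ ^ 2)) (by apply div_pos (by linarith); positivity)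
    obtain ⟨ρ', hρ', hmin'⟩ := Metric.eventually_nhds_iff_ball.1 hmin
    set δ := min ρ ρ' / (2 * ‖ξ‖) with hδ
    have hδ0 : 0 < δ := by positivity
    have hδξ : δ * ‖ξ‖ < min ρ ρ' := by
      rw [hδ]; field_simp; have : 0 < min ρ ρ' := by positivity
      linarith
    have hnorm : ∀ s : ℝ, 0 ≤ s → s ≤ 1 → x + s • (δ • ξ) ∈ ball x (min ρ ρ') := by
      intro s hs hs1
      rw [mem_ball, dist_eq_norm, add_sub_cancel_left, norm_smul, norm_smul, Real.norm_eq_abs, Real.norm_eq_abs,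
        abs_of_nonneg hs, abs_of_pos hδ0]
      have : 0 < δ * ‖ξ‖ := by positivity
      nlinarith
    have hsub : x + δ • ξ - x = δ • ξ := by abel
    obtain ⟨s, hs1, h2⟩ := mvt_line (F := F) (G := G) (x := x) (z := x + δ • ξ) (fun y hy => by
      rw [segment_eq_image'] at hy
      obtain ⟨s, hs, rfl⟩ := hy
      apply hF
      simp only [hsub]
      exact ball_subset_ball ((min_le_left _ _).trans hρr) (hnorm s hs.1 hs.2))
    rw [hsub] at h2
    have hb := hnorm s hs1.1.le hs1.2.le
    have h3 := hs _ (ball_subset_ball (min_le_left _ _) hb)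
    have hb1 : x + δ • ξ ∈ ball x (min ρ ρ') := by
      have := hnorm 1 zero_le_one le_rfl
      rwa [one_smul] at this
    have h4 : F x ≤ F (x + δ • ξ) := hmin' _ (ball_subset_ball (min_le_right ρ ρ') hb1)
    set y := x + s • (δ • ξ) with hy
    have e2 : y - x = (s * δ) • ξ := by rw [hy, smul_smul]; abel
    rw [e2, map_smul] at h3
    have hsδ : 0 < s * δ := mul_pos hs1.1 hδ0
    have h5 : ⟪G y - (s * δ) • mcl M ξ, ξ⟫ ≤ -q / (2 * ‖ξ‖ ^ 2) * ‖(s * δ) • ξ‖ * ‖ξ‖ :=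
      (real_inner_le_norm _ _).trans (mul_le_mul_of_nonneg_right h3 (norm_nonneg _))
    rw [norm_smul, Real.norm_eq_abs, abs_of_pos hsδ, inner_sub_left, inner_smul_left] at h5
    have e3 : -q / (2 * ‖ξ‖ ^ 2) * (s * δ * ‖ξ‖) * ‖ξ‖ = (s * δ) * (-q / 2) := by field_simp
    rw [e3] at h5
    simp only [conj_trivial] at h5
    have h6 : ⟪G y, ξ⟫ < 0 := by
      have : (s * δ) * q < 0 := mul_neg_of_pos_of_neg hsδ hneg
      rw [← hq] at h5
      linarith
    have h7 : ⟪G y, δ • ξ⟫ < 0 := by rw [inner_smul_right]; exact mul_neg_of_pos_of_neg hδ0 h6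
    linarith
  refine ⟨h0, hpsd, fun η hη => ?_⟩
  obtain ⟨ρ, hρ, hρr, hs⟩ := hsmall η hη
  refine ⟨ρ, hρ, fun z hz => ?_⟩
  obtain ⟨s, hs1, h2⟩ := mvt_line (F := F) (G := G) (x := x) (z := z) (fun y hy =>
    hF y (ball_subset_ball hρr ((convex_ball x ρ).segment_subset (mem_ball_self hρ) hz hy)))
  have hyb : x + s • (z - x) ∈ ball x ρ := (convex_ball x ρ).segment_subset (mem_ball_self hρ) hz (by
    rw [segment_eq_image']; exact ⟨s, Ioo_subset_Icc_self hs1, rfl⟩)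
  have h3 := hs _ hyb
  rw [add_sub_cancel_left] at h3
  have h4 := psd_norm hpsd (s • (z - x))
  have h5 : ‖G (x + s • (z - x))‖ ≤ (M.trace + η) * ‖s • (z - x)‖ := by
    calc ‖G (x + s • (z - x))‖ = ‖(G (x + s • (z - x)) - mcl M (s • (z - x))) + mcl M (s • (z - x))‖ := by
          rw [sub_add_cancel]
      _ ≤ _ := norm_add_le _ _
      _ ≤ _ := by linarith
  have htr : 0 ≤ M.trace := hpsd.trace_nonneg
  have h6 : ‖s • (z - x)‖ ≤ ‖z - x‖ := by
    rw [norm_smul, Real.norm_eq_abs, abs_of_pos hs1.1]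
    exact mul_le_of_le_one_left (norm_nonneg _) hs1.2.le
  have h7 := real_inner_le_norm (G (x + s • (z - x))) (z - x)
  have h8 : ‖G (x + s • (z - x))‖ * ‖z - x‖ ≤ (M.trace + η) * ‖z - x‖ ^ 2 := by
    calc _ ≤ ((M.trace + η) * ‖z - x‖) * ‖z - x‖ := by
          gcongr; exact h5.trans (by gcongr)
      _ = _ := by ring
  linarith

/-- supersolution structure with explicit derivatives -/
structure SS (ν : ℝ) (h : En n → ℝ≥0∞) (v vt : En n × ℝ → ℝ) (g : En n × ℝ → En n)
    (H : En n × ℝ → Matrix (Fin n) (Fin n) ℝ) (D : Set (En n × ℝ)) : Prop where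
  op : IsOpen D
  cv : ContinuousOn v D
  ct : ContinuousOn vt D
  cg : ContinuousOn g D
  dt : ∀ X ∈ D, HasDerivAt (fun t => v (X.1, t)) (vt X) X.2
  dx : ∀ X ∈ D, HasFDerivAt (fun x => v (x, X.2)) (innerSL ℝ (g X)) X.1
  dxx : ∀ X ∈ D, HasFDerivAt (fun x => g (x, X.2)) (mcl (H X)) X.1
  sym : ∀ X ∈ D, (H X).IsSymm
  ineq : ∀ X ∈ D, ∀ c : ℝ, 0 ≤ c → h X.1 ≤ ENNReal.ofReal c → ∀ k : ℝ, (∀ a ∈ Ell n ν, k ≤ tr2 a (H X)) →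
    k ≤ vt X + c * ‖g X‖

theorem SS.mono {ν : ℝ} {h : En n → ℝ≥0∞} {v vt : En n × ℝ → ℝ} {g : En n × ℝ → En n}
    {H : En n × ℝ → Matrix (Fin n) (Fin n) ℝ} {D D' : Set (En n × ℝ)} (hS : SS ν h v vt g H D)
    (hD : IsOpen D') (hDD : D' ⊆ D) : SS ν h v vt g H D' where
  op := hD
  cv := hS.cv.mono hDD
  ct := hS.ct.mono hDD
  cg := hS.cg.mono hDD
  dt X hX := hS.dt X (hDD hX)
  dx X hX := hS.dx X (hDD hX)
  dxx X hX := hS.dxx X (hDD hX)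
  sym X hX := hS.sym X (hDD hX)
  ineq X hX := hS.ineq X (hDD hX)

theorem slice_ball {D : Set (En n × ℝ)} (hD : IsOpen D) {X : En n × ℝ} (hX : X ∈ D) :
    ∃ r > 0, ∀ z ∈ ball X.1 r, (z, X.2) ∈ D := by
  have hc : Continuous (fun z : En n => (z, X.2)) := by fun_prop
  obtain ⟨r, hr, h⟩ := Metric.isOpen_iff.1 (hD.preimage hc) X.1 hX
  exact ⟨r, hr, fun z hz => h hz⟩

theorem contact {ν : ℝ} (hν : 0 < ν) {h : En n → ℝ≥0∞} {v vt : En n × ℝ → ℝ} {g : En n × ℝ → En n}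
    {H : En n × ℝ → Matrix (Fin n) (Fin n) ℝ} {D : Set (En n × ℝ)} (hS : SS ν h v vt g H D)
    {X : En n × ℝ} (hX : X ∈ D) {φ : En n → ℝ} {gφ : En n → En n} {N : Matrix (Fin n) (Fin n) ℝ} {p : En n}
    {r : ℝ} (hr : 0 < r) (hφ : ∀ z ∈ ball X.1 r, HasFDerivAt φ (innerSL ℝ (gφ z)) z)
    (hN : HasFDerivAt gφ (mcl N) X.1) (hNs : N.IsSymm)
    (hmin : IsLocalMin (fun z => v (z, X.2) - φ z - ⟪p, z⟫) X.1) :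
    g X = gφ X.1 + p ∧ ∀ B K G0 η : ℝ, 0 < G0 → 0 < η → vt X ≤ B → (∀ a ∈ Ell n ν, -K ≤ tr2 a N) →
      ‖g X‖ ≤ G0 → ENNReal.ofReal (-(vt X) - K) ≤ ENNReal.ofReal G0 * h X.1 ∧ ∃ ρ > 0, ∃ Λ : NNReal,
      ((4 * Λ : NNReal) : ℝ≥0∞) ≤ 4 * (ENNReal.ofReal (ν * (B + K) + η) + ENNReal.ofReal (ν * G0) * h X.1) ∧
      ∀ z ∈ ball X.1 ρ, v (z, X.2) - φ z ≤ v X - φ X.1 + ⟪p, z - X.1⟫ + Λ * ‖z - X.1‖ ^ 2 := by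
  obtain ⟨r', hr', hD'⟩ := slice_ball hS.op hX
  set F : En n → ℝ := fun z => v (z, X.2) - φ z - ⟪p, z⟫ with hF
  set G : En n → En n := fun z => g (z, X.2) - gφ z - p with hG
  have h1 := min2 (F := F) (G := G) (M := H X - N) (x := X.1) (r := min r r') (by positivity) ?_ ?_ ?_ hmin
  · obtain ⟨h0, hpsd, hq⟩ := h1
    have hgX : g X = gφ X.1 + p := by
      have h0' : g (X.1, X.2) - gφ X.1 - p = 0 := h0
      rw [sub_sub, sub_eq_zero] at h0'
      exact h0'
    refine ⟨hgX, ?_⟩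
    intro B K G0 η hG0 hη hB hK hg
    set τ := (H X - N).trace with hτ
    have hτ0 : 0 ≤ τ := hpsd.trace_nonneg
    have hineq : ∀ c : ℝ, 0 ≤ c → h X.1 ≤ ENNReal.ofReal c → -K + ν⁻¹ * τ ≤ vt X + c * G0 := by
      intro c hc hhc
      refine (hS.ineq X hX c hc hhc _ ?_).trans (by gcongr)
      intro a ha
      have e1 := psd_tr hpsd ha
      rw [tr2_sub] at e1
      have := hK a ha
      linarith
    have hν' : 0 ≤ ν⁻¹ * τ := by positivity
    by_cases hh : h X.1 = ∞
    · obtain ⟨ρ, hρ, hz⟩ := hq η hη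
      constructor
      · rw [hh, ENNReal.mul_top]; · exact le_top
        · simpa using hG0
      refine ⟨ρ, hρ, (τ + η).toNNReal, ?_, ?_⟩
      · rw [hh, ENNReal.mul_top, add_top, ENNReal.mul_top]; · exact le_top
        · norm_num
        · have : 0 < ν * G0 := by positivity
          simpa using this
      · intro z hzb
        have := hz z hzb
        simp only [hF, Prod.mk.eta] at this
        rw [inner_sub_right]
        rw [Real.coe_toNNReal _ (by positivity)]
        linarith
    · set c := (h X.1).toReal with hc
      have hc0 : 0 ≤ c := ENNReal.toReal_nonneg
      have hhc : h X.1 = ENNReal.ofReal c := (ENNReal.ofReal_toReal hh).symm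
      have e1 := hineq c hc0 hhc.le
      obtain ⟨ρ, hρ, hz⟩ := hq η hη
      constructor
      · rw [hhc, ← ENNReal.ofReal_mul hG0.le]
        apply ENNReal.ofReal_le_ofReal
        linarith
      refine ⟨ρ, hρ, (τ + η).toNNReal, ?_, ?_⟩
      · rw [ENNReal.coe_mul]
        refine mul_le_mul' (by norm_num) ?_
        rw [hhc, ← ENNReal.ofReal_mul (by positivity)]
        refine le_trans ?_ ENNReal.ofReal_add_le
        have e3 : τ ≤ ν * (B + K) + ν * G0 * c := by
          have : ν * (ν⁻¹ * τ) ≤ ν * (B + K + c * G0) := by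
            gcongr; linarith
          rw [mul_inv_cancel_left₀ hν.ne'] at this
          nlinarith
        exact ENNReal.ofReal_le_ofReal (by linarith)
      · intro z hzb
        have := hz z hzb
        simp only [hF, Prod.mk.eta] at this
        rw [inner_sub_right]
        rw [Real.coe_toNNReal _ (by positivity)]
        linarith
  · intro z hz
    have hz1 := hφ z (ball_subset_ball (min_le_left _ _) hz)
    have hz2 := hS.dx (z, X.2) (hD' z (ball_subset_ball (min_le_right _ _) hz))
    have hz3 : HasFDerivAt (fun z : En n => ⟪p, z⟫) (innerSL ℝ p) z := (innerSL ℝ p).hasFDerivAt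
    have := (hz2.sub hz1).sub hz3
    rw [hG]
    simp only [map_sub]
    exact this
  · have := ((hS.dxx X hX).sub hN).sub_const p
    rw [mcl_sub]
    exact this
  · exact (hS.sym X hX).sub hNs

/-- existence form of `SS` -/
def SSE (ν : ℝ) (h : En n → ℝ≥0∞) (v : En n × ℝ → ℝ) (D : Set (En n × ℝ)) : Prop :=
  ∃ vt g H, SS ν h v vt g H D

theorem SSE.mono {ν : ℝ} {h : En n → ℝ≥0∞} {v : En n × ℝ → ℝ} {D D' : Set (En n × ℝ)} (hS : SSE ν h v D)
    (hD : IsOpen D') (hDD : D' ⊆ D) : SSE ν h v D' := by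
  obtain ⟨vt, g, H, hS⟩ := hS
  exact ⟨vt, g, H, hS.mono hD hDD⟩

/-- parabolic similarity -/
def Tm (z : En n) (s r : ℝ) (X : En n × ℝ) : En n × ℝ := (z + r • X.1, s + r ^ 2 * X.2)

theorem Tm_cont (z : En n) (s r : ℝ) : Continuous (Tm z s r) := by
  unfold Tm; fun_prop

/-- rescaled drift -/
def hsc (z : En n) (r : ℝ) (h : En n → ℝ≥0∞) (x : En n) : ℝ≥0∞ := ENNReal.ofReal r * h (z + r • x)

theorem hsc_meas {z : En n} {r : ℝ} {h : En n → ℝ≥0∞} (hh : Measurable h) : Measurable (hsc z r h) := by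
  unfold hsc
  have : Measurable fun x : En n => z + r • x := by fun_prop
  exact (hh.comp this).const_mul _

theorem SSE.scale {ν : ℝ} {h : En n → ℝ≥0∞} {v : En n × ℝ → ℝ} {D : Set (En n × ℝ)} (hS : SSE ν h v D)
    (z : En n) (s : ℝ) {r κ : ℝ} (hr : 0 < r) (hκ : 0 < κ) :
    SSE ν (hsc z r h) (fun X => κ * v (Tm z s r X)) (Tm z s r ⁻¹' D) := by
  obtain ⟨vt, g, H, hS⟩ := hS
  have hTc := (Tm_cont z s r)
  have hmaps : MapsTo (Tm z s r) (Tm z s r ⁻¹' D) D := fun _ h => h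
  refine ⟨fun X => κ * (r ^ 2 * vt (Tm z s r X)), fun X => (κ * r) • g (Tm z s r X),
    fun X => (κ * r ^ 2) • H (Tm z s r X), hS.op.preimage hTc, ?_, ?_, ?_, ?_, ?_, ?_, ?_, ?_⟩
  · exact (hS.cv.comp hTc.continuousOn hmaps).const_smul κ
  · have := (hS.ct.comp hTc.continuousOn hmaps)
    exact continuousOn_const.mul (continuousOn_const.mul this)
  · exact (hS.cg.comp hTc.continuousOn hmaps).const_smul (κ * r)
  · intro X hX
    have h1 := hS.dt _ hX
    have h2 : HasDerivAt (fun t : ℝ => s + r ^ 2 * t) (r ^ 2) X.2 := by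
      simpa using ((hasDerivAt_id X.2).const_mul (r ^ 2)).const_add s
    have h3 := (h1.comp X.2 h2).const_mul κ
    rw [mul_comm (vt _)] at h3
    exact h3
  · intro X hX
    have h1 := hS.dx _ hX
    have h2 : HasFDerivAt (fun x : En n => z + r • x) (r • ContinuousLinearMap.id ℝ (En n)) X.1 :=
      ((hasFDerivAt_id X.1).const_smul r).const_add z
    have h3 := (h1.comp X.1 h2).const_smul κ
    refine h3.congr_fderiv ?_
    ext y
    simp [inner_smul_left]
    ring
  · intro X hX
    have h1 := hS.dxx _ hX
    have h2 : HasFDerivAt (fun x : En n => z + r • x) (r • ContinuousLinearMap.id ℝ (En n)) X.1 :=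
      ((hasFDerivAt_id X.1).const_smul r).const_add z
    have h3 := (h1.comp X.1 h2).const_smul (κ * r)
    refine h3.congr_fderiv ?_
    ext y i
    simp [mcl, smul_smul]
    left; ring
  · intro X hX
    exact (hS.sym _ hX).smul _
  · intro X hX c hc hhc k hk
    have hκr : 0 < κ * r ^ 2 := by positivity
    have h1 := hS.ineq _ hX (c / r) (by positivity) ?_ (k / (κ * r ^ 2)) ?_
    · rw [div_le_iff₀ hκr] at h1
      rw [norm_smul, Real.norm_eq_abs, abs_of_pos (by positivity)]
      calc k ≤ _ := h1
        _ = _ := by field_simp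
    · rw [ENNReal.ofReal_div_of_pos hr, ENNReal.le_div_iff_mul_le]
      · rw [mul_comm]; exact hhc
      · left; simpa using hr
      · left; simp
    · intro a ha
      have := hk a ha
      rw [div_le_iff₀ hκr]
      refine this.trans (le_of_eq ?_)
      simp only [tr2, Finset.sum_mul]
      refine Finset.sum_congr rfl fun i _ => Finset.sum_congr rfl fun j _ => by
        simp only [Matrix.smul_apply, smul_eq_mul]; ring

theorem map_aff (z : En n) {r : ℝ} (hr : 0 < r) :
    Measure.map (fun x : En n => z + r • x) volume = ENNReal.ofReal ((r ^ n)⁻¹) • volume := by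
  have h1 : (fun x : En n => z + r • x) = (fun x => z + x) ∘ (fun x => r • x) := rfl
  rw [h1, ← Measure.map_map (measurable_const_add z) (measurable_const_smul r), Measure.map_addHaar_smul _ hr.ne',
    Measure.map_smul, map_add_left_eq_self]
  simp only [finrank_euclideanSpace_fin]
  rw [abs_of_pos (by positivity)]

theorem map_affR (z : ℝ) {r : ℝ} (hr : 0 < r) :
    Measure.map (fun x : ℝ => z + r * x) volume = ENNReal.ofReal (r⁻¹) • volume := by
  have h1 : (fun x : ℝ => z + r * x) = (fun x => z + x) ∘ (fun x => r • x) := rfl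
  rw [h1, ← Measure.map_map (measurable_const_add z) (measurable_const_smul r), Measure.map_addHaar_smul _ hr.ne',
    Measure.map_smul, map_add_left_eq_self]
  simp only [Module.finrank_self, pow_one]
  rw [abs_of_pos (by positivity)]

/-- the mass of the drift -/
def hmass (h : En n → ℝ≥0∞) (A : Set (En n)) : ℝ≥0∞ := ∫⁻ x in A, h x ^ n

theorem hmass_mono {h : En n → ℝ≥0∞} {A B : Set (En n)} (hAB : A ⊆ B) : hmass h A ≤ hmass h B :=
  lintegral_mono_set hAB

theorem hmass_scale {h : En n → ℝ≥0∞} (hh : Measurable h) (z : En n) {r : ℝ} (hr : 0 < r) {A : Set (En n)}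
    (hA : MeasurableSet A) : hmass (hsc z r h) ((fun x => z + r • x) ⁻¹' A) = hmass h A := by
  have hm : Measurable fun x : En n => z + r • x := by fun_prop
  have h1 := setLIntegral_map (μ := (volume : Measure (En n))) hA (hh.pow_const n) hm
  rw [map_aff z hr, setLIntegral_smul_measure] at h1
  unfold hmass hsc
  simp only [mul_pow]
  rw [lintegral_const_mul _ (show Measurable (fun x => h (z + r • x) ^ n) from (hh.comp hm).pow_const n)]
  rw [← h1, ← ENNReal.ofReal_pow hr.le, smul_eq_mul, ← mul_assoc, ← ENNReal.ofReal_mul (by positivity),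
    mul_inv_cancel₀ (by positivity), ENNReal.ofReal_one, one_mul]

theorem Tm_vol (z : En n) (s : ℝ) {r : ℝ} (hr : 0 < r) {A : Set (En n × ℝ)} (hA : MeasurableSet A) :
    volume (Tm z s r ⁻¹' A) = ENNReal.ofReal ((r ^ (n + 2))⁻¹) * volume A := by
  have hm : Measurable fun x : En n => z + r • x := by fun_prop
  have hm2 : Measurable fun x : ℝ => s + r ^ 2 * x := by fun_prop
  rw [← Measure.map_apply (Tm_cont z s r).measurable hA]
  have h1 : (Tm z s r : En n × ℝ → _) = Prod.map (fun x : En n => z + r • x) (fun x : ℝ => s + r ^ 2 * x) := rfl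
  rw [h1, Measure.volume_eq_prod, ← Measure.map_prod_map _ _ hm hm2, map_aff z hr, map_affR s (by positivity),
    Measure.prod_smul_left, Measure.prod_smul_right, smul_smul, ← ENNReal.ofReal_mul (by positivity), Measure.smul_apply, smul_eq_mul]
  congr 2
  rw [← mul_inv, pow_add]

theorem add_pow_le_two (n : ℕ) (x y : ℝ≥0∞) : (x + y) ^ n ≤ (2 * x) ^ n + (2 * y) ^ n := by
  rcases le_total x y with h | h
  · calc (x + y) ^ n ≤ (2 * y) ^ n := by rw [two_mul]; gcongr
      _ ≤ _ := le_add_self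
  · calc (x + y) ^ n ≤ (2 * x) ^ n := by rw [two_mul]; gcongr
      _ ≤ _ := le_self_add

theorem int_split {h : En n → ℝ≥0∞} (hh : Measurable h) (E : Set (En n)) (a b : ℝ≥0∞) :
    ∫⁻ x in E, (2 * (4 * (a + b * h x))) ^ n ≤ (16 * a) ^ n * volume E + (16 * b) ^ n * hmass h E := by
  calc ∫⁻ x in E, (2 * (4 * (a + b * h x))) ^ n ≤ ∫⁻ x in E, ((16 * a) ^ n + (16 * b) ^ n * h x ^ n) := by
        refine lintegral_mono fun x => ?_
        calc (2 * (4 * (a + b * h x))) ^ n = (8 * a + 8 * (b * h x)) ^ n := by congr 1; ring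
          _ ≤ _ := add_pow_le_two _ _ _
          _ = _ := by rw [← mul_pow]; congr 2 <;> ring
    _ = _ := by
        rw [lintegral_add_left measurable_const, setLIntegral_const, lintegral_const_mul _ (hh.pow_const n)]; rfl

theorem deriv_nonpos_of_left_min {u : ℝ → ℝ} {u' t δ : ℝ} (hδ : 0 < δ) (hu : HasDerivAt u u' t)
    (hmin : ∀ t' ∈ Ioo (t - δ) t, u t ≤ u t') : u' ≤ 0 := by
  rw [hasDerivAt_iff_tendsto_slope] at hu
  have h2 : Filter.Tendsto (slope u t) (nhdsWithin t (Iio t)) (nhds u') :=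
    hu.mono_left (nhdsWithin_mono _ (fun x (hx : x < t) => ne_of_lt hx))
  refine le_of_tendsto h2 ?_
  filter_upwards [Ioo_mem_nhdsLT (sub_lt_self t hδ)] with x hx
  rw [slope_def_field]
  apply div_nonpos_of_nonneg_of_nonpos
  · linarith [hmin x hx]
  · linarith [hx.2]

/-- Hessian of a radial function -/
def radN (o : En n) (f1 f2 : ℝ) (z : En n) : Matrix (Fin n) (Fin n) ℝ :=
  (4 * f2) • Matrix.vecMulVec (z - o) (z - o) + (2 * f1) • (1 : Matrix (Fin n) (Fin n) ℝ)

theorem radN_symm (o : En n) (f1 f2 : ℝ) (z : En n) : (radN o f1 f2 z).IsSymm := by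
  unfold radN
  refine Matrix.IsSymm.add (Matrix.IsSymm.smul ?_ _) (Matrix.IsSymm.smul Matrix.isSymm_one _)
  ext i j
  simp [Matrix.vecMulVec_apply, mul_comm]

theorem radN_tr (o : En n) (f1 f2 : ℝ) (z : En n) (a : Matrix (Fin n) (Fin n) ℝ) :
    tr2 a (radN o f1 f2 z) = 4 * f2 * (∑ i, ∑ j, a i j * (z - o) i * (z - o) j) + 2 * f1 * ∑ i, a i i := by
  simp only [tr2, radN, Matrix.add_apply, Matrix.smul_apply, Matrix.vecMulVec_apply, smul_eq_mul, mul_add,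
    Finset.sum_add_distrib, Finset.mul_sum]
  congr 1
  · refine Finset.sum_congr rfl fun i _ => Finset.sum_congr rfl fun j _ => by ring
  · refine Finset.sum_congr rfl fun i _ => ?_
    rw [Finset.sum_eq_single i]
    · simp; ring
    · intro j _ hj; rw [Matrix.one_apply_ne hj.symm]; ring
    · simp

theorem rad_nsq (o z : En n) : HasFDerivAt (fun z : En n => ‖z - o‖ ^ 2) (innerSL ℝ ((2 : ℝ) • (z - o))) z := by
  have := ((hasFDerivAt_id z).sub_const o).norm_sq
  refine this.congr_fderiv ?_
  ext y
  simp

theorem rad_d1 (o : En n) {f : ℝ → ℝ} {f1 : ℝ} {z : En n} (hf : HasDerivAt f f1 (‖z - o‖ ^ 2)) :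
    HasFDerivAt (fun z : En n => f (‖z - o‖ ^ 2)) (innerSL ℝ ((2 * f1) • (z - o))) z := by
  have := hf.comp_hasFDerivAt z (rad_nsq o z)
  refine this.congr_fderiv ?_
  rw [map_smul, map_smul, smul_smul, mul_comm]

theorem rad_d2 (o : En n) {f1 : ℝ → ℝ} {f2 : ℝ} {z : En n} (hf : HasDerivAt f1 f2 (‖z - o‖ ^ 2)) :
    HasFDerivAt (fun z : En n => (2 * f1 (‖z - o‖ ^ 2)) • (z - o)) (mcl (radN o (f1 (‖z - o‖ ^ 2)) f2 z)) z := by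
  have h1 := (rad_d1 o hf).const_mul 2
  have h2 := h1.smul ((hasFDerivAt_id z).sub_const o)
  refine h2.congr_fderiv ?_
  ext y i
  rw [mcl_apply]
  simp [radN, Matrix.vecMulVec_apply, Matrix.one_apply, add_mul, Finset.sum_add_distrib]
  rw [add_comm]
  congr 1
  simp only [PiLp.inner_apply, RCLike.inner_apply, conj_trivial]
  rw [← Finset.sum_sub_distrib, Finset.mul_sum, Finset.mul_sum, Finset.sum_mul]
  refine Finset.sum_congr rfl fun j _ => by ring

theorem ell_trace {ν : ℝ} (hν : 0 ≤ ν) {a : Matrix (Fin n) (Fin n) ℝ} (ha : a ∈ Ell n ν) : |∑ i, a i i| ≤ n * ν := by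
  have h1 : ∀ i, |a i i| ≤ ν := by
    intro i
    have h2 : a i i ^ 2 ≤ ν ^ 2 := by
      refine le_trans ?_ ha.2
      refine le_trans (Finset.single_le_sum (f := fun j => a i j ^ 2) (fun j _ => sq_nonneg _) (Finset.mem_univ i)) ?_
      exact Finset.single_le_sum (f := fun i => ∑ j, a i j ^ 2) (fun j _ => Finset.sum_nonneg fun _ _ => sq_nonneg _) (Finset.mem_univ i)
    exact abs_le_of_sq_le_sq h2 hν
  calc |∑ i, a i i| ≤ ∑ i, |a i i| := Finset.abs_sum_le_sum_abs _ _
    _ ≤ ∑ i : Fin n, ν := Finset.sum_le_sum fun i _ => h1 i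
    _ = _ := by simp

theorem ell_low {ν : ℝ} {a : Matrix (Fin n) (Fin n) ℝ} (ha : a ∈ Ell n ν) (x : En n) :
    ν⁻¹ * ‖x‖ ^ 2 ≤ ∑ i, ∑ j, a i j * x i * x j := by
  rw [EuclideanSpace.real_norm_sq_eq]; exact ha.1 x

theorem ex_min {C : Set (En n × ℝ)} (hC : IsCompact C) (hne : C.Nonempty) {u : En n × ℝ → ℝ}
    (hu : ContinuousOn u C) (p : En n) : ∃ X ∈ C, ∀ Z ∈ C, u X - ⟪p, X.1⟫ ≤ u Z - ⟪p, Z.1⟫ := by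
  have h1 : ContinuousOn (fun X : En n × ℝ => u X - ⟪p, X.1⟫) C := by
    refine hu.sub (Continuous.continuousOn ?_)
    fun_prop
  exact hC.exists_isMinOn hne h1

theorem vol_ball_scale (n : ℕ) {r : ℝ} (hr : 0 < r) (s : ℝ) :
    volume (ball (0 : En n) (r * s)) = ENNReal.ofReal (r ^ n) * volume (ball (0 : En n) s) := by
  have := Measure.addHaar_ball_mul_of_pos (volume : Measure (En n)) 0 hr s
  simpa using this

/-- barrier parameter -/
def lamB (n : ℕ) (ν : ℝ) : ℝ := ν * (9 + 4 * n * ν) ^ 2 / 8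

def mB (n : ℕ) (ν : ℝ) : ℝ := 9 / 16 * Real.exp (-lamB n ν)

def fB (lam t y : ℝ) : ℝ := 16 * Real.exp (-lam * t) * (1 / 4 + t / 2 - y) ^ 2

theorem fB_dt (lam t y : ℝ) : HasDerivAt (fun t => fB lam t y)
    (16 * Real.exp (-lam * t) * (-lam * (1 / 4 + t / 2 - y) ^ 2 + (1 / 4 + t / 2 - y))) t := by
  unfold fB
  have h1 : HasDerivAt (fun t => Real.exp (-lam * t)) (Real.exp (-lam * t) * (-lam)) t := by
    simpa using ((hasDerivAt_id t).const_mul (-lam)).exp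
  have h2 : HasDerivAt (fun t : ℝ => 1 / 4 + t / 2 - y) (1 / 2) t := by
    simpa using (((hasDerivAt_id t).div_const 2).const_add (1 / 4)).sub_const y
  exact ((h1.const_mul 16).mul (h2.pow 2)).congr_deriv (by simp; ring)

theorem fB_dy (lam t y : ℝ) : HasDerivAt (fun y => fB lam t y)
    (-32 * Real.exp (-lam * t) * (1 / 4 + t / 2 - y)) y := by
  unfold fB
  have h2 : HasDerivAt (fun y : ℝ => 1 / 4 + t / 2 - y) (-1) y := by
    simpa using (hasDerivAt_id y).const_sub (1 / 4 + t / 2)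
  exact ((h2.pow 2).const_mul (16 * Real.exp (-lam * t))).congr_deriv (by simp; ring)

theorem fB_dyy (lam t y : ℝ) : HasDerivAt (fun y => -32 * Real.exp (-lam * t) * (1 / 4 + t / 2 - y))
    (32 * Real.exp (-lam * t)) y := by
  have h2 : HasDerivAt (fun y : ℝ => 1 / 4 + t / 2 - y) (-1) y := by
    simpa using (hasDerivAt_id y).const_sub (1 / 4 + t / 2)
  exact (h2.const_mul (-32 * Real.exp (-lam * t))).congr_deriv (by ring)

theorem barrier_ineq {ν : ℝ} (hν : 1 ≤ ν) {a : Matrix (Fin n) (Fin n) ℝ} (ha : a ∈ Ell n ν) (x : En n) {t : ℝ}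
    (ht : 0 ≤ t) (hη : 0 ≤ 1 / 4 + t / 2 - ‖x‖ ^ 2) :
    16 * Real.exp (-lamB n ν * t) * (-lamB n ν * (1 / 4 + t / 2 - ‖x‖ ^ 2) ^ 2 + (1 / 4 + t / 2 - ‖x‖ ^ 2)) ≤
    tr2 a (radN 0 (-32 * Real.exp (-lamB n ν * t) * (1 / 4 + t / 2 - ‖x‖ ^ 2)) (32 * Real.exp (-lamB n ν * t)) x) := by
  rw [radN_tr, sub_zero]
  have h1 := ell_low ha x
  have h2 := (abs_le.1 (ell_trace (by linarith) ha)).2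
  set A := ∑ i, ∑ j, a i j * x i * x j
  set T := ∑ i, a i i
  set η := 1 / 4 + t / 2 - ‖x‖ ^ 2 with hηdef
  have hx : 1 / 4 - η ≤ ‖x‖ ^ 2 := by rw [hηdef]; linarith
  have hE := Real.exp_pos (-lamB n ν * t)
  set e := Real.exp (-lamB n ν * t)
  have hν0 : 0 < ν := by linarith
  have hq : -lamB n ν * η ^ 2 + η ≤ 8 * A - 4 * η * T := by
    have e1 : ν⁻¹ * (1 / 4 - η) ≤ ν⁻¹ * ‖x‖ ^ 2 := by gcongr
    have e2 : η * T ≤ η * (n * ν) := by gcongr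
    have e3 : ν⁻¹ * η ≤ η := by
      have : ν⁻¹ ≤ 1 := inv_le_one_of_one_le₀ hν
      nlinarith
    have e4 : 0 ≤ (lamB n ν) * η ^ 2 + 2 * ν⁻¹ - η * (9 + 4 * n * ν) := by
      have : (lamB n ν) * η ^ 2 + 2 * ν⁻¹ - η * (9 + 4 * n * ν) = (1 / (8 * ν)) * (ν * (9 + 4 * n * ν) * η - 4) ^ 2 := by
        unfold lamB; field_simp; ring
      rw [this]; positivity
    nlinarith
  nlinarith [mul_le_mul_of_nonneg_left hq hE.le]

def cylB (n : ℕ) (θ : ℝ) : Set (En n × ℝ) := {X | ‖X.1‖ ^ 2 ≤ 1 / 4 + X.2 / 2 ∧ 0 ≤ X.2 ∧ X.2 ≤ θ}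

theorem cylB_compact (n : ℕ) (θ : ℝ) : IsCompact (cylB n θ) := by
  have hcl : IsClosed (cylB n θ) := by
    have e : cylB n θ = {X : En n × ℝ | ‖X.1‖ ^ 2 ≤ 1 / 4 + X.2 / 2} ∩ ({X | 0 ≤ X.2} ∩ {X | X.2 ≤ θ}) := rfl
    rw [e]
    exact (isClosed_le (by fun_prop) (by fun_prop)).inter ((isClosed_le (by fun_prop) (by fun_prop)).inter
      (isClosed_le (by fun_prop) (by fun_prop)))
  have hsub : cylB n θ ⊆ closedBall (0 : En n) (1 + |θ|) ×ˢ Icc 0 θ := by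
    rintro X ⟨h1, h2, h3⟩
    refine ⟨?_, h2, h3⟩
    rw [mem_closedBall_zero_iff]
    have : θ ≤ |θ| := le_abs_self θ
    have h4 : 0 ≤ |θ| := abs_nonneg θ
    by_contra hc
    push Not at hc
    nlinarith [norm_nonneg X.1]
  exact ((isCompact_closedBall _ _).prod isCompact_Icc).of_isClosed_subset hcl hsub

set_option maxHeartbeats 1000000 in
theorem spread_aux (hn : 0 < n) {ν : ℝ} (hν : 1 ≤ ν) {h : En n → ℝ≥0∞} (hh : Measurable h) {v : En n × ℝ → ℝ}
    {D : Set (En n × ℝ)} (hS : SSE ν h v D) {θ : ℝ} (hθ1 : θ ≤ 1)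
    (hD : closedBall 0 1 ×ˢ Icc 0 θ ⊆ D) (hv : ∀ X ∈ closedBall (0 : En n) 1 ×ˢ Icc 0 θ, 0 ≤ v X)
    (hv1 : ∀ x ∈ closedBall (0 : En n) (1 / 2), 1 ≤ v (x, 0)) {X0 : En n × ℝ}
    (hX0 : 3 / 16 ≤ 1 / 4 + X0.2 / 2 - ‖X0.1‖ ^ 2) (ht0 : 0 ≤ X0.2) (ht1 : X0.2 ≤ θ)
    (hcon : v X0 < mB n ν / 2) :
    volume (ball (0 : En n) (mB n ν / 8)) ≤ (ENNReal.ofReal (mB n ν / 32)) ^ n * volume (ball (0 : En n) 1) +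
      (ENNReal.ofReal (16 * 49 * ν)) ^ n * hmass h (closedBall 0 1) := by
  obtain ⟨vt, g, H, hS⟩ := hS
  set lam := lamB n ν with hlam
  have hlam0 : 0 ≤ lam := by rw [hlam]; unfold lamB; have : (0:ℝ) ≤ ν := by linarith
                             positivity
  set m := mB n ν with hm
  have hm0 : 0 < m := by rw [hm]; unfold mB; positivity
  have hm1 : m ≤ 1 := by
    rw [hm]; unfold mB
    have : Real.exp (-lamB n ν) ≤ 1 := Real.exp_le_one_iff.2 (by linarith)
    linarith
  set u : En n × ℝ → ℝ := fun X => v X - fB lam X.2 (‖X.1 - 0‖ ^ 2) with hu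
  have hCsub : cylB n θ ⊆ closedBall (0 : En n) 1 ×ˢ Icc 0 θ := by
    rintro X ⟨h1, h2, h3⟩
    refine ⟨?_, h2, h3⟩
    rw [mem_closedBall_zero_iff]
    have : ‖X.1‖ ^ 2 ≤ 1 ^ 2 := by linarith
    exact (abs_le_of_sq_le_sq' this zero_le_one).2
  have huc : ContinuousOn u (cylB n θ) := by
    refine (hS.cv.mono (hCsub.trans hD)).sub (Continuous.continuousOn ?_)
    unfold fB; fun_prop
  have hX0C : X0 ∈ cylB n θ := ⟨by linarith, ht0, ht1⟩
  have hX0n : ‖X0.1‖ ≤ 1 := by simpa using (hCsub hX0C).1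
  have hfX0 : m ≤ fB lam X0.2 (‖X0.1 - 0‖ ^ 2) := by
    rw [sub_zero]; unfold fB; rw [hm]; unfold mB
    have e1 : Real.exp (-lamB n ν) ≤ Real.exp (-lam * X0.2) := by
      apply Real.exp_le_exp.2; rw [← hlam]; nlinarith
    have e2 : (3 / 16 : ℝ) ^ 2 ≤ (1 / 4 + X0.2 / 2 - ‖X0.1‖ ^ 2) ^ 2 := by gcongr
    calc 9 / 16 * Real.exp (-lamB n ν) = 16 * Real.exp (-lamB n ν) * (3 / 16) ^ 2 := by ring
      _ ≤ _ := by gcongr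
  -- the measure estimate
  set η0 : ℝ := m / 512 with hη0
  have hη0p : 0 < η0 := by positivity
  set ℓ : En n → ℝ≥0∞ := fun x => 4 * (ENNReal.ofReal η0 + ENNReal.ofReal (ν * 49) * h x) with hℓ
  have hmain : volume (ball (0 : En n) (m / 8)) ≤ ∫⁻ x in ball (0 : En n) 1, (2 * ℓ x) ^ n := by
    refine SABP hn (C := cylB n θ) (u := u) (η := η0.toNNReal) (by simpa using hη0p) ?_ ?_ measurableSet_ball ?_
    · intro x
      rw [hℓ]
      calc ((η0.toNNReal : NNReal) : ℝ≥0∞) ≤ 1 * ENNReal.ofReal η0 := by rw [one_mul]; rfl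
        _ ≤ 4 * (ENNReal.ofReal η0 + ENNReal.ofReal (ν * 49) * h x) := by
          gcongr
          · norm_num
          · exact le_self_add
    · rw [hℓ]; exact ((hh.const_mul _).const_add _).const_mul _
    intro p hp
    rw [mem_ball_zero_iff] at hp
    obtain ⟨X, hXC, hmin⟩ := ex_min (cylB_compact n θ) ⟨X0, hX0C⟩ huc p
    have hXD := hD (hCsub hXC)
    have hXn : ‖X.1‖ ≤ 1 := by simpa using (hCsub hXC).1
    have hval : u X < -m / 4 := by
      have h1 := hmin X0 hX0C
      have h2 : u X0 < -m / 2 := by simp only [hu]; linarith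
      have h3 := abs_le.1 (abs_real_inner_le_norm p X.1)
      have h4 := abs_le.1 (abs_real_inner_le_norm p X0.1)
      have h5 : ‖p‖ * ‖X.1‖ ≤ ‖p‖ * 1 := by gcongr
      have h6 : ‖p‖ * ‖X0.1‖ ≤ ‖p‖ * 1 := by gcongr
      linarith [h3.2, h4.1]
    have hvX : 0 ≤ v X := hv X (hCsub hXC)
    obtain ⟨hX1, hX2, hX3⟩ := hXC
    set η := 1 / 4 + X.2 / 2 - ‖X.1‖ ^ 2 with hη
    have hηp : 0 < η := by
      rcases lt_or_eq_of_le (show 0 ≤ η by rw [hη]; linarith) with h1 | h1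
      · exact h1
      · exfalso
        simp only [hu, fB, sub_zero] at hval
        rw [← hη, ← h1] at hval
        simp at hval; linarith
    have htp : 0 < X.2 := by
      rcases lt_or_eq_of_le hX2 with h1 | h1
      · exact h1
      · exfalso
        have e1 : X.1 ∈ closedBall (0 : En n) (1 / 2) := by
          rw [mem_closedBall_zero_iff]
          have : ‖X.1‖ ^ 2 ≤ (1 / 2) ^ 2 := by rw [← h1] at hX1; linarith
          exact (abs_le_of_sq_le_sq' this (by norm_num)).2
        have e2 := hv1 X.1 e1
        rw [h1] at e2
        simp only [hu, fB, sub_zero] at hval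
        rw [← hη, ← h1] at hval
        have e3 : η ^ 2 ≤ (1 / 4) ^ 2 := by
          have : η ≤ 1 / 4 := by rw [hη, ← h1]; nlinarith [sq_nonneg ‖X.1‖]
          gcongr
        simp only [mul_zero, Real.exp_zero, Prod.mk.eta] at hval e2
        linarith
    have hEle : Real.exp (-lam * X.2) ≤ 1 := Real.exp_le_one_iff.2 (by nlinarith)
    have hEp := Real.exp_pos (-lam * X.2)
    refine ⟨X, ⟨hX1, hX2, hX3⟩, ?_, hmin, ?_⟩
    · rw [mem_ball_zero_iff]
      have : ‖X.1‖ ^ 2 < 1 ^ 2 := by rw [hη] at hηp; linarith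
      exact (abs_lt_of_sq_lt_sq' this zero_le_one).2
    -- slice neighbourhood
    obtain ⟨r, hr, hrD⟩ : ∃ r > 0, ∀ z ∈ ball X.1 r, (z, X.2) ∈ cylB n θ := by
      have hop : IsOpen {z : En n | ‖z‖ ^ 2 < 1 / 4 + X.2 / 2} := isOpen_lt (by fun_prop) (by fun_prop)
      obtain ⟨r, hr, h1⟩ := Metric.isOpen_iff.1 hop X.1 (show ‖X.1‖ ^ 2 < 1 / 4 + X.2 / 2 by rw [hη] at hηp; linarith)
      exact ⟨r, hr, fun z hz => ⟨le_of_lt (h1 hz), hX2, hX3⟩⟩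
    set φ : En n → ℝ := fun z => fB lam X.2 (‖z - 0‖ ^ 2) with hφ
    have hloc : IsLocalMin (fun z => v (z, X.2) - φ z - ⟪p, z⟫) X.1 := by
      filter_upwards [Metric.ball_mem_nhds X.1 hr] with z hz
      exact hmin (z, X.2) (hrD z hz)
    obtain ⟨hg, hc⟩ := contact (by linarith : (0 : ℝ) < ν) hS hXD (φ := φ) (p := p) (r := 1) one_pos
      (fun z _ => rad_d1 0 (fB_dy lam X.2 _)) (rad_d2 0 (fB_dyy lam X.2 _)) (radN_symm _ _ _ _) hloc
    -- time derivative
    have hvt : vt X ≤ 16 * Real.exp (-lam * X.2) * (-lam * η ^ 2 + η) := by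
      have hd := (hS.dt X hXD).sub (fB_dt lam X.2 (‖X.1 - 0‖ ^ 2))
      have hopt : IsOpen {t : ℝ | ‖X.1‖ ^ 2 < 1 / 4 + t / 2 ∧ 0 < t} :=
        IsOpen.inter (s := {t : ℝ | ‖X.1‖ ^ 2 < 1 / 4 + t / 2}) (t := {t : ℝ | 0 < t})
          (isOpen_lt (by fun_prop) (by fun_prop)) (isOpen_lt (by fun_prop) (by fun_prop))
      obtain ⟨δ, hδ, hδs⟩ := Metric.isOpen_iff.1 hopt X.2 ⟨by rw [hη] at hηp; linarith, htp⟩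
      have := deriv_nonpos_of_left_min hδ hd (by
        intro t' ht'
        have h1 := hδs (show t' ∈ ball X.2 δ by
          rw [mem_ball, Real.dist_eq, abs_lt]; constructor <;> linarith [ht'.1, ht'.2])
        have h2 := hmin (X.1, t') ⟨h1.1.le, h1.2.le, by linarith [ht'.2]⟩
        simp only [hu] at h2
        simp only [Pi.sub_apply, Prod.mk.eta]
        linarith)
      rw [sub_zero, ← hη] at this
      linarith
    have hgn : ‖g X‖ ≤ 49 := by
      rw [hg]
      refine (norm_add_le _ _).trans ?_
      rw [sub_zero, norm_smul]
      have e1 : ‖(2 * (-32 * Real.exp (-lam * X.2) * (1 / 4 + X.2 / 2 - ‖X.1‖ ^ 2)))‖ ≤ 48 := by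
        rw [← hη, Real.norm_eq_abs, abs_le]
        have e2 : η ≤ 3 / 4 := by rw [hη]; nlinarith [sq_nonneg ‖X.1‖]
        have e3 : Real.exp (-lam * X.2) * η ≤ 1 * (3 / 4) := by gcongr
        have e4 : 0 ≤ Real.exp (-lam * X.2) * η := by positivity
        constructor <;> linarith
      have e5 : ‖(2 * (-32 * Real.exp (-lam * X.2) * (1 / 4 + X.2 / 2 - ‖X.1‖ ^ 2)))‖ * ‖X.1‖ ≤ 48 * 1 := by gcongr
      linarith
    obtain ⟨_, ρ, hρ, Λ, hΛ, hq⟩ := hc _ (-(16 * Real.exp (-lam * X.2) * (-lam * η ^ 2 + η))) 49 η0 (by norm_num) hη0p hvt (by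
      intro a ha
      rw [neg_neg]
      have := barrier_ineq hν ha X.1 hX2 (by rw [← hη]; exact hηp.le)
      rw [sub_zero]
      exact this) hgn
    refine ⟨min ρ r, by positivity, Λ, ?_, ?_⟩
    · refine hΛ.trans (le_of_eq ?_)
      rw [hℓ]
      simp
    · intro z hz
      exact ⟨hrD z (ball_subset_ball (min_le_right _ _) hz), hq z (ball_subset_ball (min_le_left _ _) hz)⟩
  refine hmain.trans ((int_split hh _ _ _).trans ?_)
  have e1 : (16 : ℝ≥0∞) * ENNReal.ofReal η0 = ENNReal.ofReal (m / 32) := by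
    rw [show m / 32 = 16 * η0 by rw [hη0]; ring, ENNReal.ofReal_mul (by norm_num)]; norm_num
  have e2 : (16 : ℝ≥0∞) * ENNReal.ofReal (ν * 49) = ENNReal.ofReal (16 * 49 * ν) := by
    rw [show 16 * 49 * ν = 16 * (ν * 49) by ring, ENNReal.ofReal_mul (p := 16) (by norm_num)]
    congr 1; norm_num
  rw [e1, e2]
  gcongr
  exact hmass_mono ball_subset_closedBall

theorem spread (hn : 0 < n) {ν : ℝ} (hν : 1 ≤ ν) : ∃ ε : ℝ≥0∞, 0 < ε ∧ ∃ c : ℝ, 0 < c ∧ c ≤ 1 ∧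
    ∀ (h : En n → ℝ≥0∞) (v : En n × ℝ → ℝ) (D : Set (En n × ℝ)) (θ : ℝ), Measurable h → SSE ν h v D → θ ≤ 1 →
    closedBall 0 1 ×ˢ Icc 0 θ ⊆ D → (∀ X ∈ closedBall (0 : En n) 1 ×ˢ Icc 0 θ, 0 ≤ v X) →
    (∀ x ∈ closedBall (0 : En n) (1 / 2), 1 ≤ v (x, 0)) → hmass h (closedBall 0 1) ≤ ε →
    ∀ X0 : En n × ℝ, 3 / 16 ≤ 1 / 4 + X0.2 / 2 - ‖X0.1‖ ^ 2 → 0 ≤ X0.2 → X0.2 ≤ θ → c ≤ v X0 := by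
  have hm0 : 0 < mB n ν := by unfold mB; positivity
  have hm1 : mB n ν ≤ 1 := by
    unfold mB
    have : 0 ≤ lamB n ν := by
      unfold lamB; have : (0:ℝ) ≤ ν := by linarith
      positivity
    have : Real.exp (-lamB n ν) ≤ 1 := Real.exp_le_one_iff.2 (by linarith)
    linarith
  set m := mB n ν with hm
  set V := volume (ball (0 : En n) (m / 8)) with hV
  have hV0 : 0 < V := measure_ball_pos _ _ (by positivity)
  have hVt : V ≠ ⊤ := measure_ball_lt_top.ne
  set Cc := (ENNReal.ofReal (16 * 49 * ν)) ^ n with hCc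
  have hC0 : Cc ≠ 0 := by
    rw [hCc]; exact pow_ne_zero _ (by simp; linarith)
  have hCt : Cc ≠ ⊤ := by rw [hCc]; exact ENNReal.pow_ne_top ENNReal.ofReal_ne_top
  refine ⟨V / (4 * Cc), ?_, m / 2, by positivity, by linarith, ?_⟩
  · exact ENNReal.div_pos hV0.ne' (ENNReal.mul_ne_top (by norm_num) hCt)
  intro h v D θ hh hS hθ hD hv hv1 hmas X0 hX0 ht0 ht1
  by_contra hcon
  push Not at hcon
  have key := spread_aux hn hν hh hS hθ hD hv hv1 hX0 ht0 ht1 hcon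
  rw [← hm, ← hV, ← hCc] at key
  have h1 : (ENNReal.ofReal (m / 32)) ^ n * volume (ball (0 : En n) 1) ≤ V / 4 := by
    have e1 := vol_ball_scale n (r := m / 8) (by positivity) 1
    rw [mul_one, ← hV, ENNReal.ofReal_pow (by positivity)] at e1
    rw [e1, show m / 32 = (1 / 4) * (m / 8) by ring, ENNReal.ofReal_mul (by norm_num), mul_pow, mul_assoc, mul_comm,
      ENNReal.div_eq_inv_mul, mul_comm]
    gcongr
    have e2 : ENNReal.ofReal (1 / 4) = 4⁻¹ := by
      rw [one_div, ENNReal.ofReal_inv_of_pos (by norm_num)]; norm_num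
    rw [e2]
    exact pow_le_of_le_one (by simp) (by norm_num) hn.ne'
  have h2 : Cc * hmass h (closedBall 0 1) ≤ V / 4 := by
    calc Cc * hmass h (closedBall 0 1) ≤ Cc * (V / (4 * Cc)) := by gcongr
      _ = V / 4 := by
        rw [ENNReal.div_eq_inv_mul, ENNReal.div_eq_inv_mul, ENNReal.mul_inv (by simp) (by simp),
          mul_comm (4⁻¹) Cc⁻¹, ← mul_assoc, ← mul_assoc, ENNReal.mul_inv_cancel hC0 hCt, one_mul]
  have h3 : V ≤ V / 2 := by
    calc V ≤ V / 4 + V / 4 := key.trans (add_le_add h1 h2)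
      _ = V / 2 := by
        rw [← two_mul, ENNReal.div_eq_inv_mul, ENNReal.div_eq_inv_mul, ← mul_assoc]
        congr 1
        rw [show (4 : ℝ≥0∞) = 2 * 2 by norm_num, ENNReal.mul_inv (by simp) (by simp), ← mul_assoc,
          ENNReal.mul_inv_cancel (by simp) (by simp), one_mul]
  exact absurd h3 (not_le.2 (ENNReal.half_lt_self hV0.ne' hVt))

theorem persist (hn : 0 < n) {ν : ℝ} (hν : 1 ≤ ν) : ∃ ε : ℝ≥0∞, 0 < ε ∧ ∃ c : ℝ, 0 < c ∧ c ≤ 1 ∧ ∀ k : ℕ,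
    ∀ (h : En n → ℝ≥0∞) (v : En n × ℝ → ℝ) (D : Set (En n × ℝ)) (T : ℝ), Measurable h → SSE ν h v D → T ≤ k →
    closedBall 0 1 ×ˢ Icc 0 T ⊆ D → (∀ X ∈ closedBall (0 : En n) 1 ×ˢ Icc 0 T, 0 ≤ v X) →
    (∀ x ∈ closedBall (0 : En n) (1 / 2), 1 ≤ v (x, 0)) → hmass h (closedBall 0 1) ≤ ε →
    ∀ X ∈ closedBall (0 : En n) (1 / 4) ×ˢ Icc 0 T, c ^ k ≤ v X := by
  obtain ⟨ε, hε, c, hc, hc1, H⟩ := spread hn hν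
  refine ⟨ε, hε, c, hc, hc1, ?_⟩
  intro k
  induction k with
  | zero =>
    rintro h v D T hh hS hT hD hv hv1 hm ⟨x, t⟩ ⟨hx, ht0, ht1⟩
    simp only at hx ht0 ht1
    have : t = 0 := by push_cast at hT; linarith
    subst this
    simpa using hv1 x (closedBall_subset_closedBall (by norm_num) hx)
  | succ k ih =>
    rintro h v D T hh hS hT hD hv hv1 hm ⟨x, t⟩ ⟨hx, ht0, ht1⟩
    simp only at hx ht0 ht1
    have hsub : closedBall (0 : En n) 1 ×ˢ Icc 0 (min T 1) ⊆ closedBall 0 1 ×ˢ Icc 0 T := by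
      gcongr; exact min_le_left _ _
    have H1 := H h v D (min T 1) hh hS (min_le_right _ _) (hsub.trans hD) (fun X hX => hv X (hsub hX)) hv1 hm
    rcases le_or_gt t 1 with h1 | h1
    · have hx' : ‖x‖ ≤ 1 / 4 := by simpa using hx
      have := H1 (x, t) (by simp only; nlinarith [norm_nonneg x]) ht0 (le_min ht1 h1)
      refine le_trans ?_ this
      rw [pow_succ]
      exact mul_le_of_le_one_left hc.le (pow_le_one₀ hc.le hc1)
    · have hS' := hS.scale 0 1 one_pos (inv_pos.2 hc)
      have hTm : ∀ X : En n × ℝ, Tm 0 1 1 X = (X.1, 1 + X.2) := by intro X; simp [Tm]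
      have hh' : hsc (0 : En n) 1 h = h := by funext y; simp [hsc]
      rw [hh'] at hS'
      have := ih h _ _ (T - 1) hh hS' (by push_cast at hT; linarith) ?_ ?_ ?_ hm (x, t - 1) ⟨hx, by simp; linarith, by simp; linarith⟩
      · rw [hTm] at this
        simp only [add_sub_cancel] at this
        rw [pow_succ]
        have h2 : c ^ k * c ≤ c⁻¹ * v (x, t) * c := by gcongr
        rwa [mul_comm c⁻¹, mul_assoc, inv_mul_cancel₀ hc.ne', mul_one] at h2
      · rintro X ⟨hX1, hX2, hX3⟩
        rw [mem_preimage, hTm]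
        exact hD ⟨hX1, by simp only; linarith, by simp only; linarith⟩
      · rintro X ⟨hX1, hX2, hX3⟩
        rw [hTm]
        exact mul_nonneg (inv_pos.2 hc).le (hv _ ⟨hX1, by simp only; linarith, by simp only; linarith⟩)
      · intro z hz
        rw [hTm]
        simp only [add_zero]
        have hz' : ‖z‖ ≤ 1 / 2 := by simpa using hz
        have := H1 (z, 1) (by simp only; nlinarith [norm_nonneg z]) (by norm_num) (le_min (by linarith) le_rfl)
        rw [← div_eq_inv_mul, le_div_iff₀ hc, one_mul]
        exact this


theorem contact_compact {C : Set (En n × ℝ)} {P : Set (En n)} (hC : IsCompact C) (hP : IsCompact P)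
    {u : En n × ℝ → ℝ} (hu : ContinuousOn u C) :
    IsCompact {q : (En n × ℝ) × En n | q ∈ C ×ˢ P ∧ ∀ Z ∈ C, u q.1 - ⟪q.2, q.1.1⟫ ≤ u Z - ⟪q.2, Z.1⟫} := by
  have hCP := hC.prod hP
  have e : {q : (En n × ℝ) × En n | q ∈ C ×ˢ P ∧ ∀ Z ∈ C, u q.1 - ⟪q.2, q.1.1⟫ ≤ u Z - ⟪q.2, Z.1⟫} =
      C ×ˢ P ∩ ⋂ Z ∈ C, ((C ×ˢ P) ∩ (fun q : (En n × ℝ) × En n => u q.1 - ⟪q.2, q.1.1⟫ - (u Z - ⟪q.2, Z.1⟫)) ⁻¹' Iic 0) := by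
    ext q
    constructor
    · rintro ⟨h1, h2⟩
      refine ⟨h1, mem_iInter₂.2 fun Z hZ => ⟨h1, ?_⟩⟩
      have := h2 Z hZ
      simp only [mem_preimage, mem_Iic]; linarith
    · rintro ⟨h1, h2⟩
      refine ⟨h1, fun Z hZ => ?_⟩
      have := (mem_iInter₂.1 h2 Z hZ).2
      simp only [mem_preimage, mem_Iic] at this; linarith
  rw [e]
  refine hCP.inter_right (isClosed_biInter fun Z hZ => ?_)
  refine ContinuousOn.preimage_isClosed_of_isClosed ?_ hCP.isClosed isClosed_Iic
  refine ContinuousOn.sub (ContinuousOn.sub ?_ (Continuous.continuousOn (by fun_prop))) (Continuous.continuousOn (by fun_prop))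
  exact hu.comp continuous_fst.continuousOn (fun q hq => hq.1)

def psiB (α y : ℝ) : ℝ := Real.exp (-α * y) - Real.exp (-α * 9)

theorem psiB_d (A α y : ℝ) : HasDerivAt (fun y => A * psiB α y) (-(A * α) * Real.exp (-α * y)) y := by
  unfold psiB
  have h1 : HasDerivAt (fun t => Real.exp (-α * t)) (Real.exp (-α * y) * (-α)) y := by
    simpa using ((hasDerivAt_id y).const_mul (-α)).exp
  exact ((h1.sub_const _).const_mul A).congr_deriv (by ring)

theorem psiB_dd (A α y : ℝ) : HasDerivAt (fun y => -(A * α) * Real.exp (-α * y)) (A * α ^ 2 * Real.exp (-α * y)) y := by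
  have h1 : HasDerivAt (fun t => Real.exp (-α * t)) (Real.exp (-α * y) * (-α)) y := by
    simpa using ((hasDerivAt_id y).const_mul (-α)).exp
  exact (h1.const_mul _).congr_deriv (by ring)

theorem psi_ineq {ν A : ℝ} (hν : 1 ≤ ν) (hA : 0 ≤ A) {a : Matrix (Fin n) (Fin n) ℝ} (ha : a ∈ Ell n ν) (x : En n)
    (hx : 1 ≤ ‖x‖) :
    0 ≤ tr2 a (radN 0 (-(A * (n * ν ^ 2)) * Real.exp (-(n * ν ^ 2) * ‖x‖ ^ 2))
      (A * (n * ν ^ 2) ^ 2 * Real.exp (-(n * ν ^ 2) * ‖x‖ ^ 2)) x) := by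
  rw [radN_tr, sub_zero]
  have h1 := ell_low ha x
  have h2 := (abs_le.1 (ell_trace (by linarith) ha)).2
  set Q := ∑ i, ∑ j, a i j * x i * x j
  set T := ∑ i, a i i
  have hE := Real.exp_pos (-(n * ν ^ 2) * ‖x‖ ^ 2)
  set e := Real.exp (-(n * ν ^ 2) * ‖x‖ ^ 2)
  have hν0 : 0 < ν := by linarith
  have h3 : ν⁻¹ ≤ Q := by
    refine le_trans ?_ h1
    have : ν⁻¹ * 1 ≤ ν⁻¹ * ‖x‖ ^ 2 := by
      gcongr; nlinarith
    linarith
  have h4 : (n * ν ^ 2) * ν⁻¹ ≤ (n * ν ^ 2) * Q := by gcongr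
  have h5 : (n * ν ^ 2) * ν⁻¹ = n * ν := by field_simp
  rw [h5] at h4
  have h6 : 0 ≤ (n : ℝ) * ν := by positivity
  have h7 : 0 ≤ (A * (n * ν ^ 2) * e) * (4 * (n * ν ^ 2 * Q) - 2 * T) := by
    apply mul_nonneg (by positivity)
    linarith
  nlinarith

theorem shell_facts (hn : 0 < n) {ν : ℝ} (hν : 1 ≤ ν) {h : En n → ℝ≥0∞}
    {v vt : En n × ℝ → ℝ} {g : En n × ℝ → En n} {H : En n × ℝ → Matrix (Fin n) (Fin n) ℝ} {D : Set (En n × ℝ)}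
    (hS : SS ν h v vt g H D) {α κ A T : ℝ} (hα : α = n * ν ^ 2) (hκ0 : 0 < κ) (hκ1 : κ ≤ 1)
    (hκ : κ ≤ (Real.exp (-α * 4) - Real.exp (-α * 9)) / 16) (hA0 : 0 < A) (hA1 : A ≤ 1)
    (hD : closedBall 0 3 ×ˢ Icc 0 T ⊆ D) (hv : ∀ X ∈ closedBall (0 : En n) 3 ×ˢ Icc 0 T, 0 ≤ v X)
    (hv1 : ∀ X ∈ closedBall (0 : En n) 1 ×ˢ Icc 0 T, 1 ≤ v X) {x0 : En n} (hx0 : ‖x0‖ ≤ 2) (hT : 0 ≤ T)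
    (hcon : v (x0, T) + Real.exp (-T) ≤ A * ((Real.exp (-α * 4) - Real.exp (-α * 9)) / 8))
    {p : En n} (hp : ‖p‖ ≤ κ * A) {X : En n × ℝ} (hXC : X ∈ closedBall (0 : En n) 3 ×ˢ Icc 0 T)
    (hmin : ∀ Z ∈ closedBall (0 : En n) 3 ×ˢ Icc 0 T,
      (v X + Real.exp (-X.2) - A * psiB α (‖X.1 - 0‖ ^ 2)) - ⟪p, X.1⟫ ≤
      (v Z + Real.exp (-Z.2) - A * psiB α (‖Z.1 - 0‖ ^ 2)) - ⟪p, Z.1⟫) :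
    1 < ‖X.1‖ ∧ ‖X.1‖ < 3 ∧ 0 < X.2 ∧ g X = (2 * (-(A * α) * Real.exp (-α * ‖X.1 - 0‖ ^ 2))) • (X.1 - 0) + p ∧
    ∃ ρ > 0, ∃ Λ : NNReal,
      ((4 * Λ : NNReal) : ℝ≥0∞) ≤ 4 * (ENNReal.ofReal (A * (ν + 1)) + ENNReal.ofReal (A * (ν * (6 * α + 1))) * h X.1) ∧
      ∀ z ∈ ball X.1 ρ, (z, X.2) ∈ closedBall (0 : En n) 3 ×ˢ Icc 0 T ∧
       v (z, X.2) - A * psiB α (‖z - 0‖ ^ 2) ≤ v X - A * psiB α (‖X.1 - 0‖ ^ 2) + ⟪p, z - X.1⟫ + Λ * ‖z - X.1‖ ^ 2 := by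
  have hn' : (1 : ℝ) ≤ n := by exact_mod_cast hn
  have hα0 : 0 < α := by rw [hα]; positivity
  have hXn : ‖X.1‖ ≤ 3 := by simpa using hXC.1
  have hX2 := hXC.2.1
  set c3 := Real.exp (-α * 4) - Real.exp (-α * 9) with hc3
  have hval : v X + Real.exp (-X.2) < A * psiB α (‖X.1 - 0‖ ^ 2) := by
    have h1 := hmin (x0, T) ⟨by simpa using hx0.trans (by norm_num), hT, le_rfl⟩
    have h3 := abs_le.1 (abs_real_inner_le_norm p X.1)
    have h4 := abs_le.1 (abs_real_inner_le_norm p x0)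
    have h5 : ‖p‖ * ‖X.1‖ ≤ κ * A * 3 := by gcongr
    have h6 : ‖p‖ * ‖x0‖ ≤ κ * A * 2 := by gcongr
    have h7 : A * c3 ≤ A * psiB α (‖x0 - 0‖ ^ 2) := by
      gcongr
      rw [hc3, sub_zero]; unfold psiB
      have : Real.exp (-α * 4) ≤ Real.exp (-α * ‖x0‖ ^ 2) := by
        apply Real.exp_le_exp.2
        have : ‖x0‖ ^ 2 ≤ 2 ^ 2 := by gcongr
        nlinarith
      linarith
    have h8 : κ * A ≤ c3 / 16 * A := by gcongr
    have h9 : 0 < c3 * A := by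
      have : 0 < κ * A := by positivity
      linarith
    simp only at h1
    nlinarith [h3.2, h4.1]
  have hvX := hv X hXC
  have hE0 := Real.exp_pos (-X.2)
  have hE9 := Real.exp_pos (-α * 9)
  have hψ1 : psiB α (‖X.1 - 0‖ ^ 2) < 1 := by
    unfold psiB
    have : Real.exp (-α * ‖X.1 - 0‖ ^ 2) ≤ 1 := Real.exp_le_one_iff.2 (by nlinarith [sq_nonneg ‖X.1 - 0‖])
    linarith
  have hval2 : v X + Real.exp (-X.2) < A := by nlinarith
  have hx1 : 1 < ‖X.1‖ := by
    by_contra hc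
    push Not at hc
    have := hv1 X ⟨by simpa using hc, hXC.2⟩
    linarith
  have hx3 : ‖X.1‖ < 3 := by
    rcases lt_or_eq_of_le hXn with h1 | h1
    · exact h1
    · exfalso
      rw [sub_zero, h1] at hval
      unfold psiB at hval
      norm_num at hval
      linarith
  have ht : 0 < X.2 := by
    rcases lt_or_eq_of_le hX2 with h1 | h1
    · exact h1
    · exfalso
      rw [← h1] at hval2
      simp at hval2
      linarith
  obtain ⟨r, hr, hrD⟩ : ∃ r > 0, ∀ z ∈ ball X.1 r, (z, X.2) ∈ closedBall (0 : En n) 3 ×ˢ Icc 0 T := by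
    obtain ⟨r, hr, h1⟩ := Metric.isOpen_iff.1 (isOpen_ball (x := (0 : En n)) (ε := 3)) X.1 (by simpa using hx3)
    exact ⟨r, hr, fun z hz => ⟨ball_subset_closedBall (h1 hz), hXC.2⟩⟩
  set φ : En n → ℝ := fun z => A * psiB α (‖z - 0‖ ^ 2) with hφ
  have hloc : IsLocalMin (fun z => v (z, X.2) - φ z - ⟪p, z⟫) X.1 := by
    filter_upwards [Metric.ball_mem_nhds X.1 hr] with z hz
    have := hmin (z, X.2) (hrD z hz)
    simp only [hφ] at this ⊢
    linarith
  obtain ⟨hg, hc⟩ := contact (by linarith : (0 : ℝ) < ν) hS (hD hXC) (φ := φ) (p := p) (r := 1) one_pos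
    (fun z _ => rad_d1 0 (psiB_d A α _)) (rad_d2 0 (psiB_dd A α _)) (radN_symm _ _ _ _) hloc
  have hvt : vt X ≤ A := by
    have hexp : HasDerivAt (fun t => Real.exp (-t)) (-Real.exp (-X.2)) X.2 := by
      simpa using (hasDerivAt_id X.2).neg.exp
    have hd := (hS.dt X (hD hXC)).add hexp
    have := deriv_nonpos_of_left_min ht hd (by
      intro t' ht'
      have h2 := hmin (X.1, t') ⟨hXC.1, by linarith [ht'.1], by linarith [ht'.2, hXC.2.2]⟩
      simp only [Pi.add_apply, Prod.mk.eta] at h2 ⊢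
      linarith)
    linarith
  refine ⟨hx1, hx3, ht, hg, ?_⟩
  have hgn : ‖g X‖ ≤ A * (6 * α + 1) := by
    rw [hg]
    refine (norm_add_le _ _).trans ?_
    rw [sub_zero, norm_smul]
    have e1 : ‖(2 * (-(A * α) * Real.exp (-α * ‖X.1‖ ^ 2)))‖ ≤ 2 * (A * α * 1) := by
      rw [norm_mul, norm_mul, norm_neg, Real.norm_of_nonneg (by positivity : 0 ≤ A * α),
        Real.norm_of_nonneg (by positivity : (0:ℝ) ≤ 2), Real.norm_of_nonneg (Real.exp_pos _).le]
      gcongr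
      exact Real.exp_le_one_iff.2 (by nlinarith [sq_nonneg ‖X.1‖])
    have e5 : ‖(2 * (-(A * α) * Real.exp (-α * ‖X.1‖ ^ 2)))‖ * ‖X.1‖ ≤ 2 * (A * α * 1) * 3 := by gcongr
    nlinarith
  obtain ⟨_, ρ, hρ, Λ, hΛ, hq⟩ := hc A 0 (A * (6 * α + 1)) A (by positivity) hA0 hvt (by
    intro a ha
    rw [neg_zero]
    have := psi_ineq hν hA0.le ha X.1 hx1.le
    rw [sub_zero, hα]
    exact this) hgn
  refine ⟨min ρ r, by positivity, Λ, ?_, ?_⟩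
  · refine hΛ.trans (le_of_eq ?_)
    rw [show ν * (A + 0) + A = A * (ν + 1) by ring, show ν * (A * (6 * α + 1)) = A * (ν * (6 * α + 1)) by ring]
  · intro z hz
    exact ⟨hrD z (ball_subset_ball (min_le_right _ _) hz), hq z (ball_subset_ball (min_le_left _ _) hz)⟩

set_option maxHeartbeats 1000000 in
theorem twoB (hn : 0 < n) {ν : ℝ} (hν : 1 ≤ ν) (S : ℝ≥0∞) (hSt : S ≠ ⊤) : ∃ T : ℝ, 0 < T ∧ ∃ c : ℝ, 0 < c ∧ c ≤ 1 ∧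
    ∀ (h : En n → ℝ≥0∞) (v : En n × ℝ → ℝ) (D : Set (En n × ℝ)), Measurable h → SSE ν h v D →
    closedBall 0 3 ×ˢ Icc 0 T ⊆ D → (∀ X ∈ closedBall (0 : En n) 3 ×ˢ Icc 0 T, 0 ≤ v X) →
    (∀ X ∈ closedBall (0 : En n) 1 ×ˢ Icc 0 T, 1 ≤ v X) → hmass h (closedBall 0 3) ≤ S →
    ∀ x0 : En n, ‖x0‖ ≤ 2 → c ≤ v (x0, T) := by
  have hn' : (1 : ℝ) ≤ n := by exact_mod_cast hn
  set α : ℝ := n * ν ^ 2 with hα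
  have hα0 : 0 < α := by rw [hα]; positivity
  set c3 := Real.exp (-α * 4) - Real.exp (-α * 9) with hc3
  have hc30 : 0 < c3 := by
    rw [hc3, sub_pos]; apply Real.exp_lt_exp.2; linarith
  have hc31 : c3 ≤ 1 := by
    have h1 : Real.exp (-α * 4) ≤ 1 := Real.exp_le_one_iff.2 (by linarith)
    have h2 := Real.exp_pos (-α * 9)
    linarith
  set d := 2 * α * Real.exp (-α * 9) with hd
  have hd0 : 0 < d := by positivity
  set κ := min (c3 / 16) (d / 4) with hκ
  have hκ0 : 0 < κ := by positivity
  have hκ1 : κ ≤ 1 := (min_le_left _ _).trans (by linarith)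
  set V := volume (closedBall (0 : En n) κ) with hV
  have hV0 : V ≠ 0 := (measure_closedBall_pos _ _ hκ0).ne'
  set M := (16 * ENNReal.ofReal (ν + 1)) ^ n * volume (closedBall (0 : En n) 3) +
    (16 * ENNReal.ofReal (ν * (6 * α + 1))) ^ n * S with hM
  have hMt : M ≠ ⊤ := by
    rw [hM]
    refine ENNReal.add_ne_top.2 ⟨ENNReal.mul_ne_top (ENNReal.pow_ne_top (ENNReal.mul_ne_top (by simp) (by simp))) measure_closedBall_lt_top.ne,
      ENNReal.mul_ne_top (ENNReal.pow_ne_top (ENNReal.mul_ne_top (by simp) (by simp))) hSt⟩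
  obtain ⟨N, hN⟩ := ENNReal.exists_nat_mul_gt hV0 hMt
  set c := (1 / 2 : ℝ) ^ N * c3 / 16 with hc
  have hc0 : 0 < c := by positivity
  have hcle : c ≤ 1 / 16 := by
    have : (1 / 2 : ℝ) ^ N ≤ 1 := pow_le_one₀ (by norm_num) (by norm_num)
    rw [hc]
    nlinarith
  set T := -Real.log c with hT
  have hT0 : 0 < T := by
    rw [hT, neg_pos]; exact Real.log_neg hc0 (by linarith)
  have hexpT : Real.exp (-T) = c := by rw [hT, neg_neg, Real.exp_log hc0]
  refine ⟨T, hT0, c, hc0, by linarith, ?_⟩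
  rintro h v D hh ⟨vt, g, H, hS⟩ hD hv hv1 hmas x0 hx0
  by_contra hcon
  push Not at hcon
  set C := closedBall (0 : En n) 3 ×ˢ Icc 0 T with hC
  have hCc : IsCompact C := (isCompact_closedBall _ _).prod isCompact_Icc
  set A : ℕ → ℝ := fun j => (1 / 2) ^ (j + 1) with hA
  have hA0 : ∀ j, 0 < A j := fun j => by simp only [hA]; positivity
  have hA1 : ∀ j, A j ≤ 1 := fun j => pow_le_one₀ (by norm_num) (by norm_num)
  set u : ℕ → En n × ℝ → ℝ := fun j X => v X + Real.exp (-X.2) - A j * psiB α (‖X.1 - 0‖ ^ 2) with hu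
  have huc : ∀ j, ContinuousOn (u j) C := by
    intro j
    refine ((hS.cv.mono hD).add (Continuous.continuousOn (by fun_prop))).sub (Continuous.continuousOn ?_)
    unfold psiB; fun_prop
  set Kc : ℕ → Set ((En n × ℝ) × En n) := fun j => {q | q ∈ C ×ˢ closedBall 0 (κ * A j) ∧
    ∀ Z ∈ C, u j q.1 - ⟪q.2, q.1.1⟫ ≤ u j Z - ⟪q.2, Z.1⟫} with hKc
  have hKcc : ∀ j, IsCompact (Kc j) := fun j => contact_compact hCc (isCompact_closedBall _ _) (huc j)
  set E : ℕ → Set (En n) := fun j => (fun q : (En n × ℝ) × En n => q.1.1) '' Kc j with hE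
  have hEm : ∀ j, MeasurableSet (E j) := fun j =>
    ((hKcc j).image (by fun_prop)).isClosed.measurableSet
  have facts := fun j (hj : j < N) (q : (En n × ℝ) × En n) (hq : q ∈ Kc j) =>
    shell_facts hn hν hS hα hκ0 hκ1 (min_le_left _ _) (hA0 j) (hA1 j) hD hv hv1 hx0 hT0.le (by
      rw [hexpT]
      have h1 : (1 / 2 : ℝ) ^ N ≤ A j := by
        simp only [hA]
        exact pow_le_pow_of_le_one (by norm_num) (by norm_num) hj
      rw [← hc3]
      have h2 : (1 / 2 : ℝ) ^ N * c3 ≤ A j * c3 := by gcongr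
      rw [hc] at hcon ⊢
      linarith) (by simpa using hq.1.2) hq.1.1 hq.2
  have hdisj : Pairwise (fun i j => i < N → j < N → Disjoint (E i) (E j)) := by
    have hlt : ∀ i j, i < j → i < N → j < N → Disjoint (E i) (E j) := by
      intro i j hij hi hj
      rw [Set.disjoint_left]
      rintro x ⟨q, hq, rfl⟩ ⟨q', hq', hqq⟩
      simp only at hqq
      -- q.1 is also a contact point for j
      have h1 := hq.2 q'.1 hq'.1.1
      have h2 := hq'.2 q.1 hq.1.1
      simp only [hu, hqq] at h1 h2
      have hq2 : (q.1, q'.2) ∈ Kc j := by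
        refine ⟨⟨hq.1.1, hq'.1.2⟩, fun Z hZ => ?_⟩
        have h3 := hq'.2 Z hZ
        simp only [hu, hqq] at h3 ⊢
        linarith
      have f1 := facts i hi q hq
      have f2 := facts j hj _ hq2
      simp only at f2
      obtain ⟨hx1, hx3, _, hg1, _⟩ := f1
      obtain ⟨_, _, _, hg2, _⟩ := f2
      have hp1 : ‖q.2‖ ≤ κ * A i := by simpa using hq.1.2
      have hp2 : ‖q'.2‖ ≤ κ * A j := by simpa using hq'.1.2
      rw [hg1, sub_zero] at hg2
      set e := Real.exp (-α * ‖q.1.1‖ ^ 2) with he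
      have hee : Real.exp (-α * 9) ≤ e := by
        apply Real.exp_le_exp.2
        have : ‖q.1.1‖ ^ 2 ≤ 3 ^ 2 := by gcongr
        nlinarith
      have hAj : A j ≤ A i / 2 := by
        simp only [hA]
        have : (1 / 2 : ℝ) ^ (j + 1) ≤ (1 / 2) ^ (i + 1 + 1) :=
          pow_le_pow_of_le_one (by norm_num) (by norm_num) (by omega)
        rw [pow_succ _ (i + 1)] at this
        linarith
      have key : (2 * α * e * (A i - A j)) • q.1.1 = q.2 - q'.2 := by
        have : (2 * α * e * (A i - A j)) • q.1.1 = (2 * (-(A j * α) * e)) • q.1.1 - (2 * (-(A i * α) * e)) • q.1.1 := by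
          rw [← sub_smul]; congr 1; ring
        rw [this, sub_eq_sub_iff_add_eq_add, ← hg2, add_comm]
      have hA0i := hA0 i
      have hnorm : d * (A i / 2) ≤ κ * A i + κ * A j := by
        calc d * (A i / 2) ≤ 2 * α * e * (A i - A j) * 1 := by
              rw [mul_one, hd]; gcongr; linarith
          _ ≤ 2 * α * e * (A i - A j) * ‖q.1.1‖ := by
              have : 0 ≤ A i - A j := by linarith
              gcongr
          _ = ‖(2 * α * e * (A i - A j)) • q.1.1‖ := by
              have : 0 ≤ A i - A j := by linarith
              rw [norm_smul, Real.norm_of_nonneg (by positivity)]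
          _ ≤ ‖q.2‖ + ‖q'.2‖ := by rw [key]; exact norm_sub_le _ _
          _ ≤ _ := add_le_add hp1 hp2
      have h5 : κ * A j ≤ κ * (A i / 2) := by gcongr
      have h6 : κ * A i ≤ d / 4 * A i := by gcongr; exact min_le_right _ _
      have h7 : 0 < d * A i := by positivity
      linarith
    intro i j hij hi hj
    rcases lt_or_gt_of_ne hij with h1 | h1
    · exact hlt i j h1 hi hj
    · exact (hlt j i h1 hj hi).symm
  set F : En n → ℝ≥0∞ := fun x => (2 * (4 * (ENNReal.ofReal (ν + 1) + ENNReal.ofReal (ν * (6 * α + 1)) * h x))) ^ n with hF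
  have hmain : ∀ j < N, V ≤ ∫⁻ x in E j, F x := by
    intro j hj
    set ℓ : En n → ℝ≥0∞ := fun x => 4 * (ENNReal.ofReal (A j * (ν + 1)) + ENNReal.ofReal (A j * (ν * (6 * α + 1))) * h x) with hℓ
    have h1 : volume (closedBall (0 : En n) (κ * A j)) ≤ ∫⁻ x in E j, (2 * ℓ x) ^ n := by
      have hηp : 0 < A j * (ν + 1) := mul_pos (hA0 j) (by linarith)
      refine SABP hn (C := C) (u := u j) (η := (A j * (ν + 1)).toNNReal) (by simpa using hηp) ?_ ?_ (hEm j) ?_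
      · intro x
        rw [hℓ]
        calc (((A j * (ν + 1)).toNNReal : NNReal) : ℝ≥0∞) ≤ 1 * ENNReal.ofReal (A j * (ν + 1)) := by rw [one_mul]; rfl
          _ ≤ 4 * (ENNReal.ofReal (A j * (ν + 1)) + ENNReal.ofReal (A j * (ν * (6 * α + 1))) * h x) := by
            gcongr
            · norm_num
            · exact le_self_add
      · rw [hℓ]; exact ((hh.const_mul _).const_add _).const_mul _
      intro p hp
      obtain ⟨X, hXC, hmin⟩ := ex_min hCc ⟨(x0, T), by simpa using hx0.trans (by norm_num), hT0.le, le_rfl⟩ (huc j) p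
      have hq : (X, p) ∈ Kc j := ⟨⟨hXC, hp⟩, hmin⟩
      obtain ⟨_, _, _, _, ρ, hρ, Λ, hΛ, hz⟩ := facts j hj _ hq
      refine ⟨X, hXC, ⟨_, hq, rfl⟩, hmin, ρ, hρ, Λ, hΛ, fun z hzb => ⟨(hz z hzb).1, ?_⟩⟩
      have := (hz z hzb).2
      simp only [hu] at this ⊢
      linarith
    have h2 : volume (closedBall (0 : En n) (κ * A j)) = ENNReal.ofReal (A j) ^ n * V := by
      have := Measure.addHaar_closedBall_mul_of_pos (volume : Measure (En n)) 0 (hA0 j) κ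
      rw [mul_comm κ, this, hV, ENNReal.ofReal_pow (hA0 j).le]
      simp
    have h3 : ∫⁻ x in E j, (2 * ℓ x) ^ n = ENNReal.ofReal (A j) ^ n * ∫⁻ x in E j, F x := by
      rw [← lintegral_const_mul' _ _ (by simp)]
      refine lintegral_congr fun x => ?_
      simp only [hℓ, hF]
      rw [← mul_pow, ENNReal.ofReal_mul (hA0 j).le, ENNReal.ofReal_mul (hA0 j).le]
      congr 1; ring
    rw [h2, h3] at h1
    exact (ENNReal.mul_le_mul_iff_right (pow_ne_zero _ (by simpa using hA0 j)) (by simp)).1 h1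
  have hsum : (N : ℝ≥0∞) * V ≤ M := by
    calc (N : ℝ≥0∞) * V = ∑ j ∈ Finset.range N, V := by simp
      _ ≤ ∑ j ∈ Finset.range N, ∫⁻ x in E j, F x := Finset.sum_le_sum fun j hj => hmain j (Finset.mem_range.1 hj)
      _ = ∫⁻ x in ⋃ j ∈ Finset.range N, E j, F x := by
        rw [lintegral_biUnion_finset _ (fun j _ => hEm j)]
        intro i hi j hj hij
        exact hdisj hij (Finset.mem_range.1 hi) (Finset.mem_range.1 hj)
      _ ≤ ∫⁻ x in closedBall (0 : En n) 3, F x := by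
        refine lintegral_mono_set (iUnion₂_subset fun j hj => ?_)
        rintro x ⟨q, hq, rfl⟩
        exact hq.1.1.1
      _ ≤ _ := int_split hh _ _ _
      _ ≤ M := by rw [hM]; gcongr
  exact absurd hsum (not_le.2 hN)


/-- unit closed cylinder -/
def Cy (n : ℕ) : Set (En n × ℝ) := closedBall 0 1 ×ˢ Icc 0 1

theorem Cy_compact (n : ℕ) : IsCompact (Cy n) := (isCompact_closedBall _ _).prod isCompact_Icc

structure KS (w wt : En n × ℝ → ℝ) (gw : En n × ℝ → En n) (x1 : En n) : Prop where
  cw : ContinuousOn w (Cy n)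
  cwt : ContinuousOn wt (Cy n)
  cg : ContinuousOn gw (Cy n)
  dt : ∀ X ∈ Cy n, HasDerivAt (fun t => w (X.1, t)) (wt X) X.2
  dx : ∀ X ∈ Cy n, HasFDerivAt (fun x => w (x, X.2)) (innerSL ℝ (gw X)) X.1
  hx1 : ‖x1‖ ≤ 1 / 2
  h1 : w (x1, 1) < 1 / 2
  lat : ∀ X ∈ Cy n, ‖X.1‖ = 1 → 1 ≤ w X
  h0 : ∀ X ∈ Cy n, X.2 = 0 → 1 ≤ w X
  pos : ∀ X ∈ Cy n, 0 ≤ w X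

def cl01 (t : ℝ) : ℝ := max 0 (min t 1)

theorem cl01_mem (t : ℝ) : cl01 t ∈ Icc (0 : ℝ) 1 :=
  ⟨le_max_left _ _, max_le zero_le_one (min_le_right _ _)⟩

theorem cl01_of_mem {t : ℝ} (ht : t ∈ Icc (0 : ℝ) 1) : cl01 t = t := by
  unfold cl01; rw [min_eq_left ht.2, max_eq_right ht.1]

theorem cl01_lip (s t : ℝ) : |cl01 s - cl01 t| ≤ |s - t| := by
  unfold cl01
  grind

def qf (w : En n × ℝ → ℝ) (x1 p : En n) (t : ℝ) (k : En n × ℝ) : ℝ :=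
  min (w (k.1, k.2 * cl01 t) - ⟪p, k.1 - x1⟫) (3 / 4)

def Mf (w : En n × ℝ → ℝ) (x1 p : En n) (t : ℝ) : ℝ := sInf (qf w x1 p t '' Cy n)

theorem scal_mem {x : En n} {σ t : ℝ} (h : (x, σ) ∈ Cy n) (ht : t ∈ Icc (0 : ℝ) 1) : (x, σ * t) ∈ Cy n :=
  ⟨h.1, mul_nonneg h.2.1 ht.1, mul_le_one₀ h.2.2 ht.1 ht.2⟩

section
variable {w wt : En n × ℝ → ℝ} {gw : En n × ℝ → En n} {x1 : En n}

theorem qf_cont (hK : KS w wt gw x1) (p : En n) (t : ℝ) : ContinuousOn (qf w x1 p t) (Cy n) := by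
  unfold qf
  refine (continuous_id.min (continuous_const (y := (3 / 4 : ℝ)))).comp_continuousOn
    (ContinuousOn.sub ?_ (Continuous.continuousOn (by fun_prop)))
  refine hK.cw.comp (Continuous.continuousOn (by fun_prop)) ?_
  intro k hk
  exact scal_mem hk (cl01_mem t)

theorem Cy_ne (n : ℕ) : (Cy n).Nonempty := ⟨(0, 0), by simp [Cy]⟩

theorem Mf_att (hK : KS w wt gw x1) (p : En n) (t : ℝ) : ∃ k ∈ Cy n, Mf w x1 p t = qf w x1 p t k ∧
    ∀ k' ∈ Cy n, qf w x1 p t k ≤ qf w x1 p t k' := by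
  obtain ⟨k, hk, hk1, hk2⟩ := (Cy_compact n).exists_sInf_image_eq_and_le (Cy_ne n) (qf_cont hK p t)
  exact ⟨k, hk, hk1, hk2⟩

theorem Mf_le (hK : KS w wt gw x1) (p : En n) (t : ℝ) {k : En n × ℝ} (hk : k ∈ Cy n) :
    Mf w x1 p t ≤ qf w x1 p t k := by
  obtain ⟨k0, _, h1, h2⟩ := Mf_att hK p t
  rw [h1]; exact h2 k hk

theorem w_lip (hK : KS w wt gw x1) : ∃ B : ℝ, 0 ≤ B ∧ ∀ x ∈ closedBall (0 : En n) 1, ∀ s ∈ Icc (0 : ℝ) 1, ∀ t ∈ Icc (0 : ℝ) 1,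
    |w (x, s) - w (x, t)| ≤ B * |s - t| := by
  obtain ⟨B, hB⟩ := (Cy_compact n).exists_bound_of_continuousOn hK.cwt
  refine ⟨B, (norm_nonneg _).trans (hB (0, 0) (by simp [Cy])), ?_⟩
  intro x hx s hs t ht
  have := (convex_Icc (0 : ℝ) 1).norm_image_sub_le_of_norm_hasDerivWithin_le (f := fun t => w (x, t)) (f' := fun t => wt (x, t))
    (fun t ht => (hK.dt (x, t) ⟨hx, ht⟩).hasDerivWithinAt) (fun t ht => hB (x, t) ⟨hx, ht⟩) ht hs
  simpa using this

theorem Mf_lip (hK : KS w wt gw x1) : ∃ B : ℝ, 0 ≤ B ∧ ∀ p p' t t', Mf w x1 p t - Mf w x1 p' t' ≤ B * |t - t'| + 2 * ‖p - p'‖ := by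
  obtain ⟨B, hB0, hB⟩ := w_lip hK
  refine ⟨B, hB0, fun p p' t t' => ?_⟩
  obtain ⟨k, hk, h1, _⟩ := Mf_att hK p' t'
  have h2 := Mf_le hK p t hk
  rw [h1]
  have h3 := hB k.1 hk.1 _ (scal_mem hk (cl01_mem t)).2 _ (scal_mem hk (cl01_mem t')).2
  have h4 : |k.2 * cl01 t - k.2 * cl01 t'| ≤ |t - t'| := by
    rw [← mul_sub, abs_mul, abs_of_nonneg hk.2.1]
    have := cl01_lip t t'
    have := mul_le_mul hk.2.2 this (abs_nonneg _) zero_le_one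
    linarith
  have h5 : |⟪p - p', k.1 - x1⟫| ≤ ‖p - p'‖ * 2 := by
    refine (abs_real_inner_le_norm _ _).trans ?_
    gcongr
    refine (norm_sub_le _ _).trans ?_
    have : ‖k.1‖ ≤ 1 := by simpa using hk.1
    have := hK.hx1
    linarith
  rw [inner_sub_left] at h5
  have h6 : B * |k.2 * cl01 t - k.2 * cl01 t'| ≤ B * |t - t'| := by gcongr
  have h7 := (abs_le.1 h3).2
  have h8 := (abs_le.1 h5).1
  have h9 : 0 ≤ B * |t - t'| := by positivity
  have h10 := norm_nonneg (p - p')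
  unfold qf at h2 ⊢
  rcases le_total (w (k.1, k.2 * cl01 t') - ⟪p', k.1 - x1⟫) (3 / 4) with h | h
  · rw [min_eq_left h]
    have := h2.trans (min_le_left _ _)
    linarith
  · rw [min_eq_right h]
    have := h2.trans (min_le_right _ _)
    linarith

theorem Mf_cont (hK : KS w wt gw x1) : Continuous (Function.uncurry (Mf w x1)) := by
  obtain ⟨B, hB0, hB⟩ := Mf_lip hK
  have : LipschitzWith (Real.toNNReal (B + 2)) (Function.uncurry (Mf w x1)) := by
    refine LipschitzWith.of_le_add_mul _ ?_
    rintro ⟨p, t⟩ ⟨p', t'⟩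
    rw [Real.coe_toNNReal _ (by linarith)]
    have h1 := hB p p' t t'
    have h2 : |t - t'| ≤ dist (p, t) (p', t') := by
      rw [Prod.dist_eq, ← Real.dist_eq]; exact le_max_right _ _
    have h3 : ‖p - p'‖ ≤ dist (p, t) (p', t') := by
      rw [Prod.dist_eq, ← dist_eq_norm]; exact le_max_left _ _
    have h4 : B * |t - t'| ≤ B * dist (p, t) (p', t') := by gcongr
    simp only [Function.uncurry]
    linarith
  exact this.continuous

theorem inner_small (hK : KS w wt gw x1) {p x : En n} (hp : ‖p‖ ≤ 1 / 16) (hx : x ∈ closedBall (0 : En n) 1) :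
    |⟪p, x - x1⟫| ≤ 3 / 32 := by
  refine (abs_real_inner_le_norm _ _).trans ?_
  have h1 : ‖x - x1‖ ≤ 3 / 2 := by
    refine (norm_sub_le _ _).trans ?_
    have : ‖x‖ ≤ 1 := by simpa using hx
    have := hK.hx1
    linarith
  calc ‖p‖ * ‖x - x1‖ ≤ (1 / 16) * (3 / 2) := by gcongr
    _ = 3 / 32 := by norm_num

theorem Mf_zero (hK : KS w wt gw x1) {p : En n} (hp : ‖p‖ ≤ 1 / 16) : Mf w x1 p 0 = 3 / 4 := by
  obtain ⟨k, hk, h1, _⟩ := Mf_att hK p 0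
  rw [h1]; unfold qf
  rw [min_eq_right]
  have h2 := (abs_le.1 (inner_small hK hp hk.1)).2
  have h3 := hK.h0 (k.1, k.2 * cl01 0) (scal_mem hk (cl01_mem 0)) (by simp [cl01])
  linarith

theorem Mf_one (hK : KS w wt gw x1) {p : En n} : Mf w x1 p 1 < 1 / 2 := by
  have hm : (x1, (1:ℝ)) ∈ Cy n := ⟨by have := hK.hx1; simp; linarith, by simp⟩
  refine (Mf_le hK p 1 hm).trans_lt ?_
  unfold qf
  refine (min_le_left _ _).trans_lt ?_
  rw [cl01_of_mem (by simp)]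
  simpa using hK.h1

/-- contact set -/
def KK (w : En n × ℝ → ℝ) (gw : En n × ℝ → En n) (x1 : En n) : Set (En n × ℝ) :=
  {X | X ∈ Cy n ∧ ‖gw X‖ ≤ 1 / 16 ∧ w X - ⟪gw X, X.1 - x1⟫ ≤ 3 / 4 ∧
    ∀ k ∈ Cy n, w X + ⟪gw X, k.1 - X.1⟫ ≤ w (k.1, k.2 * X.2)}

theorem KK_closed (hK : KS w wt gw x1) : IsClosed (KK w gw x1) := by
  have e : KK w gw x1 = (Cy n ∩ gw ⁻¹' closedBall 0 (1 / 16)) ∩ ((Cy n ∩ (fun X => w X - ⟪gw X, X.1 - x1⟫) ⁻¹' Iic (3 / 4)) ∩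
      ⋂ k ∈ Cy n, (Cy n ∩ (fun X => w X + ⟪gw X, k.1 - X.1⟫ - w (k.1, k.2 * X.2)) ⁻¹' Iic 0)) := by
    ext X
    constructor
    · rintro ⟨h1, h2, h3, h4⟩
      refine ⟨⟨h1, by simpa using h2⟩, ⟨h1, h3⟩, mem_iInter₂.2 fun k hk => ⟨h1, ?_⟩⟩
      have := h4 k hk
      simp only [mem_preimage, mem_Iic]; linarith
    · rintro ⟨⟨h1, h2⟩, ⟨_, h3⟩, h4⟩
      refine ⟨h1, by simpa using h2, h3, fun k hk => ?_⟩
      have := (mem_iInter₂.1 h4 k hk).2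
      simp only [mem_preimage, mem_Iic] at this; linarith
  have hc := (Cy_compact n).isClosed
  rw [e]
  refine (hK.cg.preimage_isClosed_of_isClosed hc isClosed_closedBall).inter (IsClosed.inter ?_ (isClosed_biInter fun k hk => ?_))
  · refine ContinuousOn.preimage_isClosed_of_isClosed ?_ hc isClosed_Iic
    exact hK.cw.sub (hK.cg.inner (𝕜 := ℝ) (Continuous.continuousOn (by fun_prop)))
  · refine ContinuousOn.preimage_isClosed_of_isClosed ?_ hc isClosed_Iic
    refine (hK.cw.add (hK.cg.inner (𝕜 := ℝ) (Continuous.continuousOn (by fun_prop)))).sub ?_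
    refine hK.cw.comp (Continuous.continuousOn (by fun_prop)) ?_
    intro X hX
    exact scal_mem (x := k.1) (σ := k.2) hk hX.2

theorem KK_val (hK : KS w wt gw x1) {X : En n × ℝ} (hX : X ∈ KK w gw x1) : w X < 1 := by
  obtain ⟨h1, h2, h3, h4⟩ := hX
  have := (abs_le.1 (inner_small hK h2 h1.1)).2
  linarith

theorem Mf_deriv (hK : KS w wt gw x1) {p : En n} (hp : ‖p‖ ≤ 1 / 16) {t m : ℝ} (ht : t ∈ Ioo (0 : ℝ) 1)
    (hm : HasDerivAt (Mf w x1 p) m t) (hm0 : m < 0) : ∃ x, (x, t) ∈ KK w gw x1 ∧ gw (x, t) = p ∧ wt (x, t) = m := by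
  have htI : t ∈ Icc (0:ℝ) 1 := ⟨ht.1.le, ht.2.le⟩
  obtain ⟨k, hk, h1, h2⟩ := Mf_att hK p t
  have hle : ∀ s, Mf w x1 p s ≤ 3 / 4 := fun s => (Mf_le hK p s hk).trans (min_le_right _ _)
  -- value below 3/4
  have hlt : Mf w x1 p t < 3 / 4 := by
    rcases lt_or_eq_of_le (hle t) with h | h
    · exact h
    · exfalso
      have : IsLocalMax (Mf w x1 p) t := Filter.Eventually.of_forall fun s => by rw [h]; exact hle s
      have := this.hasDerivAt_eq_zero hm
      linarith
  have hq : qf w x1 p t k = w (k.1, k.2 * t) - ⟪p, k.1 - x1⟫ := by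
    rw [h1] at hlt
    unfold qf at hlt ⊢
    rw [cl01_of_mem htI] at hlt ⊢
    rcases min_lt_iff.1 hlt with h | h
    · exact min_eq_left h.le
    · exact absurd h (lt_irrefl _)
  -- k.2 * t = t
  have hs : k.2 * t = t := by
    by_contra hne
    have hlt2 : k.2 * t < t := by
      have h5 : k.2 * t ≤ 1 * t := mul_le_mul_of_nonneg_right hk.2.2 ht.1.le
      exact lt_of_le_of_ne (by linarith) hne
    have h6 : 0 ≤ k.2 * t := mul_nonneg hk.2.1 ht.1.le
    -- for s in (k.2 t, t): Mf s ≤ Mf t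
    have h7 : 0 ≤ m := by
      have := deriv_nonpos_of_left_min (u := fun s => - Mf w x1 p s) (sub_pos.2 hlt2) hm.neg (by
        intro s hs
        have hs0 : 0 < s := by linarith [hs.1]
        have hsI : s ∈ Icc (0:ℝ) 1 := ⟨hs0.le, by linarith [hs.2, ht.2]⟩
        have hmem : (k.1, k.2 * t / s) ∈ Cy n := ⟨hk.1, by positivity, by rw [div_le_one hs0]; linarith [hs.1]⟩
        have h8 := Mf_le hK p s hmem
        unfold qf at h8
        rw [cl01_of_mem hsI] at h8
        simp only [div_mul_cancel₀ _ hs0.ne'] at h8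
        have := h8.trans (min_le_left _ _)
        rw [h1, hq]
        linarith)
      linarith
    linarith
  rw [hs] at hq
  have hxt : (k.1, t) ∈ Cy n := ⟨hk.1, htI⟩
  have hqle : ∀ k' ∈ Cy n, w (k.1, t) - ⟪p, k.1 - x1⟫ ≤ w (k'.1, k'.2 * t) - ⟪p, k'.1 - x1⟫ := by
    intro k' hk'
    have := h2 k' hk'
    rw [hq] at this
    unfold qf at this
    rw [cl01_of_mem htI] at this
    exact this.trans (min_le_left _ _)
  have hv34 : w (k.1, t) - ⟪p, k.1 - x1⟫ < 3 / 4 := by rw [← hq, ← h1]; exact hlt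
  have hval : w (k.1, t) < 1 := by
    have := (abs_le.1 (inner_small hK hp hk.1)).2
    linarith
  have hk1 : ‖k.1‖ < 1 := by
    have h5 : ‖k.1‖ ≤ 1 := by simpa using hk.1
    rcases lt_or_eq_of_le h5 with h | h
    · exact h
    · have := hK.lat _ hxt h
      linarith
  have hgp : gw (k.1, t) = p := by
    have hd : HasFDerivAt (fun x => w (x, t) - ⟪p, x - x1⟫) (innerSL ℝ (gw (k.1, t)) - innerSL ℝ p) k.1 := by
      have h6 : HasFDerivAt (fun x : En n => ⟪p, x - x1⟫) (innerSL ℝ p) k.1 := by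
        have := ((innerSL ℝ p).hasFDerivAt (x := k.1)).sub_const (⟪p, x1⟫)
        refine this.congr_of_eventuallyEq (Filter.Eventually.of_forall fun x => ?_)
        simp [inner_sub_right]
      exact (hK.dx _ hxt).sub h6
    have hmin : IsLocalMin (fun x => w (x, t) - ⟪p, x - x1⟫) k.1 := by
      filter_upwards [isOpen_ball.mem_nhds (show k.1 ∈ ball (0 : En n) 1 by simpa using hk1)] with z hz
      have := hqle (z, 1) ⟨ball_subset_closedBall hz, by simp⟩
      simpa using this
    have h7 := hmin.hasFDerivAt_eq_zero hd
    rw [← map_sub] at h7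
    have h8 : innerSL ℝ (gw (k.1, t) - p) (gw (k.1, t) - p) = 0 := by rw [h7]; simp
    rw [innerSL_apply_apply, inner_self_eq_zero] at h8
    exact sub_eq_zero.1 h8
  refine ⟨k.1, ⟨hxt, by rw [hgp]; exact hp, by rw [hgp]; exact hv34.le, ?_⟩, hgp, ?_⟩
  · intro k' hk'
    rw [hgp]
    have := hqle k' hk'
    have e1 : ⟪p, k'.1 - k.1⟫ = ⟪p, k'.1 - x1⟫ - ⟪p, k.1 - x1⟫ := by rw [← inner_sub_right]; congr 1; abel
    simp only
    rw [e1]; linarith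
  · have hd := (hK.dt _ hxt).sub hm
    have hmin : IsLocalMin ((fun s => w (k.1, s)) - Mf w x1 p) t := by
      filter_upwards [isOpen_Ioo.mem_nhds ht] with s hs
      have hsI : s ∈ Icc (0:ℝ) 1 := ⟨hs.1.le, hs.2.le⟩
      have h8 := (Mf_le hK p s (k := (k.1, 1)) ⟨hk.1, by simp⟩).trans (min_le_left _ _)
      rw [cl01_of_mem hsI] at h8
      simp only [one_mul] at h8
      simp only [Pi.sub_apply]
      rw [h1, hq]
      linarith
    have := hmin.hasDerivAt_eq_zero hd
    linarith

end


theorem ofReal_integral_le' {α : Type*} [MeasurableSpace α] {μ : Measure α} {f : α → ℝ} (hf : Integrable f μ) :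
    ENNReal.ofReal (∫ x, f x ∂μ) ≤ ∫⁻ x, ENNReal.ofReal (f x) ∂μ := by
  have h1 : ∫ x, f x ∂μ ≤ ∫ x, max (f x) 0 ∂μ := integral_mono hf hf.pos_part (fun x => le_max_left _ _)
  refine (ENNReal.ofReal_le_ofReal h1).trans ?_
  rw [ofReal_integral_eq_lintegral_ofReal hf.pos_part (Filter.Eventually.of_forall fun x => le_max_right _ _)]
  refine lintegral_mono fun x => ?_
  rcases le_total (f x) 0 with h | h
  · simp [h]
  · simp [h]

section
variable {w wt : En n × ℝ → ℝ} {gw : En n × ℝ → En n} {x1 : En n}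

theorem kry1 (hK : KS w wt gw x1) {p : En n} (hp : ‖p‖ ≤ 1 / 16) :
    ENNReal.ofReal (1 / 4) ≤ ∫⁻ t in Ioo (0 : ℝ) 1, ENNReal.ofReal (-deriv (Mf w x1 p) t) := by
  obtain ⟨B, hB0, hB⟩ := Mf_lip hK
  have hL : LipschitzOnWith (Real.toNNReal B) (Mf w x1 p) (uIcc 0 1) := by
    refine LipschitzWith.lipschitzOnWith ?_
    refine LipschitzWith.of_le_add_mul _ fun s t => ?_
    rw [Real.coe_toNNReal _ hB0, Real.dist_eq]
    have := hB p p s t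
    simp only [sub_self, norm_zero, mul_zero, add_zero] at this
    linarith
  have hac := hL.absolutelyContinuousOnInterval
  have h1 := hac.integral_deriv_eq_sub
  have h2 := hac.intervalIntegrable_deriv
  rw [intervalIntegrable_iff_integrableOn_Ioo_of_le zero_le_one] at h2
  rw [intervalIntegral.integral_of_le zero_le_one] at h1
  have h3 : (1 : ℝ) / 4 ≤ ∫ t in Ioo (0 : ℝ) 1, -deriv (Mf w x1 p) t := by
    rw [integral_neg, ← integral_Ioc_eq_integral_Ioo, h1, Mf_zero hK hp]
    have := Mf_one hK (p := p)
    linarith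
  exact (ENNReal.ofReal_le_ofReal h3).trans (ofReal_integral_le' h2.neg)

open Classical in
/-- time speed on the contact set -/
def Wf (wt : En n × ℝ → ℝ) (K : Set (En n × ℝ)) : En n × ℝ → ℝ := K.piecewise (fun X => max (-wt X) 0) (fun _ => 0)

theorem Wf_nonneg (K : Set (En n × ℝ)) (X : En n × ℝ) : 0 ≤ Wf wt K X := by
  classical
  unfold Wf
  by_cases h : X ∈ K <;> simp [h]

theorem Wf_meas (hK : KS w wt gw x1) : Measurable (Wf wt (KK w gw x1)) := by
  classical
  refine ContinuousOn.measurable_piecewise ?_ continuousOn_const (KK_closed hK).measurableSet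
  refine (continuous_id.max continuous_const).comp_continuousOn (hK.cwt.neg.mono ?_)
  intro X hX; exact hX.1

theorem kry2a (hn : 0 < n) (hK : KS w wt gw x1) {ℓ : En n → ℝ≥0∞}
    {η : NNReal} (hη : 0 < η) (hηℓ : ∀ x, (η : ℝ≥0∞) ≤ ℓ x) (hℓ : Measurable ℓ)
    (hc : ∀ X ∈ KK w gw x1, ∃ ρ > 0, ∃ Λ : NNReal, ((4 * Λ : NNReal) : ℝ≥0∞) ≤ ℓ X.1 ∧ ∀ z ∈ ball X.1 ρ,
      z ∈ closedBall (0 : En n) 1 ∧ w (z, X.2) ≤ w X + ⟪gw X, z - X.1⟫ + Λ * ‖z - X.1‖ ^ 2)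
    {t : ℝ} (ht : t ∈ Ioo (0 : ℝ) 1) {lam : ℝ} (hlam : 0 < lam)
    (hEm : MeasurableSet {x | lam ≤ Wf wt (KK w gw x1) (x, t)}) :
    volume ({p | lam < max (-deriv (Mf w x1 p) t) 0} ∩ closedBall (0 : En n) (1 / 16)) ≤
      ∫⁻ x in {x | lam ≤ Wf wt (KK w gw x1) (x, t)}, (2 * ℓ x) ^ n := by
  refine SABP hn (C := closedBall (0 : En n) 1 ×ˢ {t}) (u := w) hη hηℓ hℓ hEm ?_
  rintro p ⟨hp1, hp2⟩
  have hp1 : lam < max (-deriv (Mf w x1 p) t) 0 := hp1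
  have hp1' : lam < -deriv (Mf w x1 p) t := by
    rcases lt_max_iff.1 hp1 with h | h
    · exact h
    · linarith
  have hpn : ‖p‖ ≤ 1 / 16 := by simpa using hp2
  have hdiff : DifferentiableAt ℝ (Mf w x1 p) t := by
    by_contra hcon
    rw [deriv_zero_of_not_differentiableAt hcon] at hp1'
    linarith
  obtain ⟨x, hxK, hg, hwt⟩ := Mf_deriv hK hpn ht hdiff.hasDerivAt (by linarith)
  obtain ⟨ρ, hρ, Λ, hΛ, hz⟩ := hc _ hxK
  refine ⟨(x, t), ⟨hxK.1.1, rfl⟩, ?_, ?_, ρ, hρ, Λ, hΛ, ?_⟩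
  · show lam ≤ Wf wt (KK w gw x1) (x, t)
    classical
    unfold Wf
    rw [Set.piecewise_eq_of_mem _ _ _ hxK, hwt]
    exact hp1'.le.trans (le_max_left _ _)
  · rintro ⟨z, s⟩ ⟨hz1, hz2⟩
    simp only [mem_singleton_iff] at hz2
    subst hz2
    have := hxK.2.2.2 (z, 1) ⟨hz1, by simp⟩
    simp only [one_mul, hg, inner_sub_right] at this
    simp only
    linarith
  · intro z hzb
    have := hz z hzb
    rw [hg] at this
    exact ⟨⟨this.1, rfl⟩, this.2⟩

theorem meas_deriv_slice {f : En n → ℝ → ℝ} (hf : Continuous (Function.uncurry f)) (t : ℝ) :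
    Measurable (fun p : En n => deriv (f p) t) := by
  have h0 := measurable_deriv_with_param (𝕜 := ℝ) hf
  have h1 : Measurable (fun p : En n => (p, t)) := measurable_id.prodMk measurable_const
  exact h0.comp h1

theorem kry2 (hn : 0 < n) (hK : KS w wt gw x1) {ℓ : En n → ℝ≥0∞}
    {η : NNReal} (hη : 0 < η) (hηℓ : ∀ x, (η : ℝ≥0∞) ≤ ℓ x) (hℓ : Measurable ℓ)
    (hc : ∀ X ∈ KK w gw x1, ∃ ρ > 0, ∃ Λ : NNReal, ((4 * Λ : NNReal) : ℝ≥0∞) ≤ ℓ X.1 ∧ ∀ z ∈ ball X.1 ρ,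
      z ∈ closedBall (0 : En n) 1 ∧ w (z, X.2) ≤ w X + ⟪gw X, z - X.1⟫ + Λ * ‖z - X.1‖ ^ 2)
    {t : ℝ} (ht : t ∈ Ioo (0 : ℝ) 1) :
    ∫⁻ p in closedBall (0 : En n) (1 / 16), ENNReal.ofReal (-deriv (Mf w x1 p) t) ≤
      ∫⁻ x, (2 * ℓ x) ^ n * ENNReal.ofReal (Wf wt (KK w gw x1) (x, t)) := by
  have hmd : Measurable (fun p : En n => deriv (Mf w x1 p) t) := meas_deriv_slice (Mf_cont hK) t
  have hmx : Measurable (fun p : En n => max (-deriv (Mf w x1 p) t) 0) := hmd.neg.max measurable_const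
  have hW : Measurable (fun x => Wf wt (KK w gw x1) (x, t)) := (Wf_meas hK).comp (measurable_id.prodMk measurable_const)
  have hL : Measurable (fun x => (2 * ℓ x) ^ n) := (hℓ.const_mul 2).pow_const n
  have e1 : ∫⁻ p in closedBall (0 : En n) (1 / 16), ENNReal.ofReal (-deriv (Mf w x1 p) t) =
      ∫⁻ p in closedBall (0 : En n) (1 / 16), ENNReal.ofReal (max (-deriv (Mf w x1 p) t) 0) := by
    refine lintegral_congr fun p => ?_
    rw [ENNReal.ofReal_max]; simp
  have e2 : ∫⁻ x, (2 * ℓ x) ^ n * ENNReal.ofReal (Wf wt (KK w gw x1) (x, t)) =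
      ∫⁻ x, ENNReal.ofReal (Wf wt (KK w gw x1) (x, t)) ∂(volume.withDensity (fun x => (2 * ℓ x) ^ n)) := by
    rw [lintegral_withDensity_eq_lintegral_mul _ hL hW.ennreal_ofReal]; rfl
  rw [e1, e2, lintegral_eq_lintegral_meas_lt (f := fun p : En n => max (-deriv (Mf w x1 p) t) 0) _ (Filter.Eventually.of_forall fun p => le_max_right _ _)
    hmx.aemeasurable,
    lintegral_eq_lintegral_meas_le (f := fun x => Wf wt (KK w gw x1) (x, t)) _ (Filter.Eventually.of_forall fun x => Wf_nonneg (KK w gw x1) _) hW.aemeasurable]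
  refine setLIntegral_mono' measurableSet_Ioi ?_
  intro lam hlam
  rw [mem_Ioi] at hlam
  have hEm : MeasurableSet {x | lam ≤ Wf wt (KK w gw x1) (x, t)} := measurableSet_le measurable_const hW
  rw [withDensity_apply _ hEm, Measure.restrict_apply (measurableSet_lt measurable_const hmx)]
  show volume ({p | lam < max (-deriv (Mf w x1 p) t) 0} ∩ closedBall (0 : En n) (1 / 16)) ≤ _
  exact kry2a hn hK hη hηℓ hℓ hc ht hlam hEm

theorem krylov (hn : 0 < n) (hK : KS w wt gw x1) {ℓ : En n → ℝ≥0∞}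
    {η : NNReal} (hη : 0 < η) (hηℓ : ∀ x, (η : ℝ≥0∞) ≤ ℓ x) (hℓ : Measurable ℓ)
    (hc : ∀ X ∈ KK w gw x1, ∃ ρ > 0, ∃ Λ : NNReal, ((4 * Λ : NNReal) : ℝ≥0∞) ≤ ℓ X.1 ∧ ∀ z ∈ ball X.1 ρ,
      z ∈ closedBall (0 : En n) 1 ∧ w (z, X.2) ≤ w X + ⟪gw X, z - X.1⟫ + Λ * ‖z - X.1‖ ^ 2) :
    ENNReal.ofReal (1 / 4) * volume (closedBall (0 : En n) (1 / 16)) ≤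
      ∫⁻ x, (2 * ℓ x) ^ n * ∫⁻ t, ENNReal.ofReal (Wf wt (KK w gw x1) (x, t)) := by
  have hmd := measurable_deriv_with_param (𝕜 := ℝ) (Mf_cont hK)
  have hW := (Wf_meas hK).ennreal_ofReal
  have hL : Measurable (fun x => (2 * ℓ x) ^ n) := (hℓ.const_mul 2).pow_const n
  calc ENNReal.ofReal (1 / 4) * volume (closedBall (0 : En n) (1 / 16))
      = ∫⁻ p in closedBall (0 : En n) (1 / 16), ENNReal.ofReal (1 / 4) := by rw [setLIntegral_const]
    _ ≤ ∫⁻ p in closedBall (0 : En n) (1 / 16), ∫⁻ t in Ioo (0 : ℝ) 1, ENNReal.ofReal (-deriv (Mf w x1 p) t) := by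
        refine setLIntegral_mono' measurableSet_closedBall fun p hp => ?_
        exact kry1 hK (by simpa using hp)
    _ = ∫⁻ t in Ioo (0 : ℝ) 1, ∫⁻ p in closedBall (0 : En n) (1 / 16), ENNReal.ofReal (-deriv (Mf w x1 p) t) := by
        refine lintegral_lintegral_swap ?_
        exact (hmd.neg.ennreal_ofReal).aemeasurable
    _ ≤ ∫⁻ t in Ioo (0 : ℝ) 1, ∫⁻ x, (2 * ℓ x) ^ n * ENNReal.ofReal (Wf wt (KK w gw x1) (x, t)) := by
        refine setLIntegral_mono' measurableSet_Ioo fun t ht => ?_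
        exact kry2 hn hK hη hηℓ hℓ hc ht
    _ ≤ ∫⁻ t, ∫⁻ x, (2 * ℓ x) ^ n * ENNReal.ofReal (Wf wt (KK w gw x1) (x, t)) := setLIntegral_le_lintegral _ _
    _ = ∫⁻ x, ∫⁻ t, (2 * ℓ x) ^ n * ENNReal.ofReal (Wf wt (KK w gw x1) (x, t)) := by
        refine lintegral_lintegral_swap ?_
        exact ((hL.comp measurable_snd).mul (hW.comp measurable_swap)).aemeasurable
    _ = _ := by
        refine lintegral_congr fun x => ?_
        rw [lintegral_const_mul]
        exact hW.comp (measurable_const.prodMk measurable_id)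

/-- total speed at fixed x is at most one -/
theorem Wf_int (hK : KS w wt gw x1) (x : En n) : ∫⁻ t, ENNReal.ofReal (Wf wt (KK w gw x1) (x, t)) ≤ 1 := by
  classical
  set s := {t : ℝ | (x, t) ∈ KK w gw x1} with hs
  have hsm : MeasurableSet s := ((KK_closed hK).preimage (by fun_prop : Continuous fun t : ℝ => (x, t))).measurableSet
  have e1 : (fun t => ENNReal.ofReal (Wf wt (KK w gw x1) (x, t))) = s.indicator (fun t => ENNReal.ofReal (-wt (x, t))) := by
    funext t
    by_cases h : t ∈ s
    · rw [indicator_of_mem h]; unfold Wf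
      rw [Set.piecewise_eq_of_mem _ _ _ (show (x, t) ∈ KK w gw x1 from h), ENNReal.ofReal_max]; simp
    · rw [indicator_of_notMem h]; unfold Wf
      rw [Set.piecewise_eq_of_notMem _ _ _ (show (x, t) ∉ KK w gw x1 from h)]; simp
  rw [e1, lintegral_indicator hsm, lintegral_deriv_eq_volume_image_of_antitoneOn (f := fun t => w (x, t)) hsm
    (fun t ht => (hK.dt (x, t) ht.1).hasDerivWithinAt)]
  · calc volume ((fun t => w (x, t)) '' s) ≤ volume (Icc (0 : ℝ) 1) := by
          refine measure_mono ?_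
          rintro _ ⟨t, ht, rfl⟩
          exact ⟨hK.pos _ ht.1, (KK_val hK ht).le⟩
      _ = 1 := by simp
  · intro t ht t' ht' htt
    have h0 : 0 ≤ t := ht.1.2.1
    rcases eq_or_lt_of_le htt with h | h
    · rw [h]
    · have ht0 : 0 < t' := by linarith
      have := ht'.2.2.2 (x, t / t') ⟨ht'.1.1, by positivity, by rw [div_le_one ht0]; exact htt⟩
      simp only [sub_self, inner_zero_right, add_zero, div_mul_cancel₀ _ ht0.ne'] at this
      exact this

end


section
variable {ν : ℝ} {h : En n → ℝ≥0∞} {v vt : En n × ℝ → ℝ} {g : En n × ℝ → En n}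
    {H : En n × ℝ → Matrix (Fin n) (Fin n) ℝ} {D : Set (En n × ℝ)} {x1 : En n}

def wA (v : En n × ℝ → ℝ) (x1 : En n) (X : En n × ℝ) : ℝ := v X + 4 * ‖X.1 - x1‖ ^ 2 + 2 * (1 - X.2)
def gA (g : En n × ℝ → En n) (x1 : En n) (X : En n × ℝ) : En n := g X + (8 : ℝ) • (X.1 - x1)
def tA (vt : En n × ℝ → ℝ) (X : En n × ℝ) : ℝ := vt X - 2

theorem KS_A (hS : SS ν h v vt g H D) (hD : Cy n ⊆ D) (hv : ∀ X ∈ Cy n, 0 ≤ v X) (hx1 : ‖x1‖ ≤ 1 / 2)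
    (h1 : v (x1, 1) < 1 / 2) : KS (wA v x1) (tA vt) (gA g x1) x1 where
  cw := by
    unfold wA
    exact ((hS.cv.mono hD).add (by fun_prop)).add (by fun_prop)
  cwt := (hS.ct.mono hD).sub continuousOn_const
  cg := by
    unfold gA
    exact (hS.cg.mono hD).add (by fun_prop)
  dt := by
    intro X hX
    have h2 : HasDerivAt (fun t : ℝ => 2 * (1 - t)) (-2) X.2 :=
      ((((hasDerivAt_id X.2).const_sub 1)).const_mul 2).congr_deriv (by ring)
    have := ((hS.dt X (hD hX)).add_const (4 * ‖X.1 - x1‖ ^ 2)).add h2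
    exact this
  dx := by
    intro X hX
    have h2 := ((hS.dx X (hD hX)).add ((rad_nsq x1 X.1).const_mul 4)).add_const (2 * (1 - X.2))
    refine h2.congr_fderiv ?_
    unfold gA
    rw [map_add, map_smul, map_smul, smul_smul]; norm_num
  hx1 := hx1
  h1 := by simpa [wA] using h1
  lat := by
    intro X hX hn
    have h2 : 1 / 2 ≤ ‖X.1 - x1‖ := by
      have := norm_sub_norm_le X.1 x1
      linarith
    have h3 : (1 / 2 : ℝ) ^ 2 ≤ ‖X.1 - x1‖ ^ 2 := by gcongr
    have := hv X hX
    have := hX.2.2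
    unfold wA; linarith
  h0 := by
    intro X hX h0
    have := hv X hX
    unfold wA; rw [h0]; nlinarith [sq_nonneg ‖X.1 - x1‖]
  pos := by
    intro X hX
    have := hv X hX
    have := hX.2.2
    unfold wA; nlinarith [sq_nonneg ‖X.1 - x1‖]

theorem grow_contact (hν : 1 ≤ ν) (hS : SS ν h v vt g H D) (hD : Cy n ⊆ D) (hv : ∀ X ∈ Cy n, 0 ≤ v X)
    (hx1 : ‖x1‖ ≤ 1 / 2) (h1 : v (x1, 1) < 1 / 2) {X : En n × ℝ} (hX : X ∈ KK (wA v x1) (gA g x1) x1) :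
    v X < 1 ∧ ENNReal.ofReal (-(tA vt X)) ≤ ENNReal.ofReal (2 + 8 * n * ν) + ENNReal.ofReal 13 * h X.1 ∧
    ∃ ρ > 0, ∃ Λ : NNReal, ((4 * Λ : NNReal) : ℝ≥0∞) ≤
        4 * (ENNReal.ofReal (ν * (2 + 8 * n * ν) + 1) + ENNReal.ofReal (ν * 13) * h X.1) ∧ ∀ z ∈ ball X.1 ρ,
      z ∈ closedBall (0 : En n) 1 ∧
        wA v x1 (z, X.2) ≤ wA v x1 X + ⟪gA g x1 X, z - X.1⟫ + Λ * ‖z - X.1‖ ^ 2 := by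
  have hK := KS_A hS hD hv hx1 h1
  have hval := KK_val hK hX
  obtain ⟨hXC, hgn, h3, hmin⟩ := hX
  have ht1 : X.2 ≤ 1 := hXC.2.2
  have hx1' : ‖X.1‖ ≤ 1 := by simpa using hXC.1
  have hv1 : v X < 1 := by
    unfold wA at hval; nlinarith [sq_nonneg ‖X.1 - x1‖]
  have hlt : ‖X.1‖ < 1 := by
    refine lt_of_le_of_ne hx1' fun hh => ?_
    linarith [hK.lat X hXC hh]
  have htp : 0 < X.2 := by
    refine lt_of_le_of_ne hXC.2.1 fun hh => ?_
    linarith [hK.h0 X hXC hh.symm]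
  have hb : ball X.1 (1 - ‖X.1‖) ⊆ closedBall (0 : En n) 1 := by
    intro z hz
    rw [mem_ball, dist_eq_norm] at hz
    rw [mem_closedBall_zero_iff]
    have := norm_add_le (z - X.1) X.1
    rw [sub_add_cancel] at this
    linarith
  have hwt : tA vt X ≤ 0 := by
    refine deriv_nonpos_of_left_min htp (hK.dt X hXC) fun t' ht' => ?_
    have := hmin (X.1, t' / X.2) ⟨hXC.1, by rw [sub_self] at ht'; have := ht'.1; exact div_nonneg this.le htp.le,
      by rw [div_le_one htp]; exact ht'.2.le⟩
    simpa [div_mul_cancel₀ _ htp.ne'] using this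
  have hloc : IsLocalMin (fun z => v (z, X.2) - (fun y : ℝ => -4 * y) (‖z - x1‖ ^ 2) - ⟪gA g x1 X, z⟫) X.1 := by
    filter_upwards [Metric.ball_mem_nhds X.1 (by linarith : 0 < 1 - ‖X.1‖)] with z hz
    have := hmin (z, 1) ⟨hb hz, by simp⟩
    simp only [wA, one_mul, inner_sub_right] at this
    show v X - _ - _ ≤ _
    linarith
  have hd1 : ∀ y : ℝ, HasDerivAt (fun y : ℝ => -4 * y) ((fun _ => -4) y) y := fun y =>
    ((hasDerivAt_id y).const_mul (-4)).congr_deriv (by simp)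
  have hd2 : ∀ y : ℝ, HasDerivAt (fun _ : ℝ => (-4 : ℝ)) 0 y := fun y => hasDerivAt_const _ _
  obtain ⟨hg, hc⟩ := contact (by linarith : (0 : ℝ) < ν) hS (hD hXC) (p := gA g x1 X) (r := 1) one_pos
      (fun z _ => rad_d1 x1 (hd1 _)) (rad_d2 x1 (hd2 _)) (radN_symm _ _ _ _) hloc
  have hxx : ‖X.1 - x1‖ ≤ 3 / 2 := by
    have := norm_sub_le X.1 x1
    linarith
  have hgX : ‖g X‖ ≤ 13 := by
    rw [hg]
    refine (norm_add_le _ _).trans ?_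
    rw [norm_smul]
    norm_num
    linarith
  have hvt : vt X ≤ 2 := by unfold tA at hwt; linarith
  obtain ⟨hc1, ρ, hρ, Λ, hΛ, hz⟩ := hc 2 (8 * n * ν) 13 1 (by norm_num) one_pos hvt (by
    intro a ha
    rw [radN_tr]
    have := abs_le.1 (ell_trace (by linarith : 0 ≤ ν) ha)
    linarith [this.1, this.2]) hgX
  refine ⟨hv1, ?_, min ρ (1 - ‖X.1‖), lt_min hρ (by linarith), Λ, hΛ, ?_⟩
  · have e : -(tA vt X) ≤ (2 + 8 * n * ν) + (-(vt X) - 8 * n * ν) := by unfold tA; linarith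
    calc ENNReal.ofReal (-(tA vt X)) ≤ ENNReal.ofReal ((2 + 8 * n * ν) + (-(vt X) - 8 * n * ν)) :=
          ENNReal.ofReal_le_ofReal e
      _ ≤ _ := ENNReal.ofReal_add_le
      _ ≤ _ := by gcongr
  · intro z hzb
    refine ⟨hb (ball_subset_ball (min_le_right _ _) hzb), ?_⟩
    have := hz z (ball_subset_ball (min_le_left _ _) hzb)
    simp only [wA]
    linarith

theorem ell_bd {A B x C : ℝ≥0∞} (hA : A + B ≤ C) : (x ≤ 1 → (2 * (4 * (A + B * x))) ^ n ≤ (8 * C) ^ n) ∧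
    (1 < x → (2 * (4 * (A + B * x))) ^ n ≤ (8 * C) ^ n * x ^ n) := by
  constructor
  · intro hx
    refine pow_le_pow_left' ?_ n
    calc 2 * (4 * (A + B * x)) ≤ 2 * (4 * (A + B * 1)) := by gcongr
      _ = 8 * (A + B) := by ring
      _ ≤ _ := by gcongr
  · intro hx
    rw [← mul_pow]
    refine pow_le_pow_left' ?_ n
    calc 2 * (4 * (A + B * x)) ≤ 2 * (4 * (A * x + B * x)) := by
          gcongr
          exact le_mul_of_one_le_right zero_le hx.le
      _ = 8 * (A + B) * x := by ring
      _ ≤ _ := by gcongr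

theorem growth (hn : 0 < n) (hν : 1 ≤ ν) : ∃ δ : ℝ≥0∞, 0 < δ ∧ ∀ (h : En n → ℝ≥0∞) (v : En n × ℝ → ℝ) (D : Set (En n × ℝ)),
    Measurable h → SSE ν h v D → Cy n ⊆ D → (∀ X ∈ Cy n, 0 ≤ v X) → volume {X ∈ Cy n | v X < 1} ≤ δ →
    hmass h (closedBall 0 1) ≤ δ → ∀ x1 : En n, ‖x1‖ ≤ 1 / 2 → 1 / 2 ≤ v (x1, 1) := by
  set A := ENNReal.ofReal (ν * (2 + 8 * n * ν) + 1) with hA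
  set B := ENNReal.ofReal (ν * 13) with hB
  set C := A + B + ENNReal.ofReal (2 + 8 * n * ν) + ENNReal.ofReal 13 with hC
  have hCt : C ≠ ⊤ := by simp [hC, hA, hB]
  have hm : ENNReal.ofReal (1 / 4) * volume (closedBall (0 : En n) (1 / 16)) ≠ 0 :=
    mul_ne_zero (by simp) (Metric.measure_closedBall_pos volume 0 (by norm_num)).ne'
  have hQ : (8 * C) ^ n * C + (8 * C) ^ n ≠ ⊤ := by
    have : (8 * C) ^ n ≠ ⊤ := ENNReal.pow_ne_top (ENNReal.mul_ne_top (by simp) hCt)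
    exact ENNReal.add_ne_top.2 ⟨ENNReal.mul_ne_top this hCt, this⟩
  obtain ⟨δ, hδ0, hδ⟩ := ENNReal.exists_nnreal_pos_mul_lt hQ hm
  refine ⟨δ, by simpa using hδ0, ?_⟩
  rintro h v D hh ⟨vt, g, H, hS⟩ hD hv hvol hmas x1 hx1
  by_contra hcon
  have h1 : v (x1, 1) < 1 / 2 := not_le.1 hcon
  have hK := KS_A hS hD hv hx1 h1
  set K := KK (wA v x1) (gA g x1) x1 with hKd
  have hcn := fun X hX => grow_contact hν hS hD hv hx1 h1 (X := X) hX
  set ℓ : En n → ℝ≥0∞ := fun x => 4 * (A + B * h x) with hℓ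
  have key := krylov hn hK (ℓ := ℓ) (η := 1) one_pos (by
    intro x
    have : (1 : ℝ≥0∞) ≤ A := by
      rw [hA, ← ENNReal.ofReal_one]
      exact ENNReal.ofReal_le_ofReal (by have : 0 ≤ ν := by linarith
                                         have : 0 ≤ ν * (2 + 8 * n * ν) := by positivity
                                         linarith)
    calc ((1 : NNReal) : ℝ≥0∞) ≤ 4 * 1 := by simp
      _ ≤ 4 * A := by gcongr
      _ ≤ _ := by rw [hℓ]; simp only; gcongr; exact le_self_add)
    ((measurable_const.add (hh.const_mul B)).const_mul 4) (fun X hX => (hcn X hX).2.2)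
  have hKc : IsClosed K := KK_closed hK
  have hsl : ∀ x, MeasurableSet {t : ℝ | (x, t) ∈ K} := fun x =>
    (hKc.preimage (by fun_prop : Continuous fun t : ℝ => (x, t))).measurableSet
  have hpt : ∀ x, (2 * ℓ x) ^ n * ∫⁻ t, ENNReal.ofReal (Wf (tA vt) K (x, t)) ≤
      (8 * C) ^ n * C * volume {t : ℝ | (x, t) ∈ K} + (8 * C) ^ n * (closedBall 0 1).indicator (fun x => h x ^ n) x := by
    intro x
    by_cases hx : x ∈ closedBall (0 : En n) 1
    · rw [indicator_of_mem hx]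
      have hAB : A + B ≤ C := by rw [hC, add_assoc]; exact le_self_add
      rcases le_or_gt (h x) 1 with h2 | h2
      · refine le_trans ?_ le_self_add
        rw [mul_assoc]
        refine mul_le_mul' ((ell_bd hAB).1 h2) ?_
        calc ∫⁻ t, ENNReal.ofReal (Wf (tA vt) K (x, t)) ≤ ∫⁻ t, {t : ℝ | (x, t) ∈ K}.indicator (fun _ => C) t := by
              refine lintegral_mono fun t => ?_
              classical
              unfold Wf
              by_cases ht : (x, t) ∈ K
              · rw [Set.piecewise_eq_of_mem _ _ _ ht, indicator_of_mem (show t ∈ {t : ℝ | (x, t) ∈ K} from ht), ENNReal.ofReal_max]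
                simp only [ENNReal.ofReal_zero, zero_le, sup_of_le_left]
                refine ((hcn _ ht).2.1).trans ?_
                calc _ ≤ ENNReal.ofReal (2 + 8 * n * ν) + ENNReal.ofReal 13 * 1 := by gcongr
                  _ ≤ C := by rw [hC, mul_one, add_assoc (A + B)]; exact le_add_self
              · rw [Set.piecewise_eq_of_notMem _ _ _ ht]; simp
          _ = _ := by rw [lintegral_indicator (hsl x), setLIntegral_const]
      · refine le_trans ?_ le_add_self
        calc _ ≤ (8 * C) ^ n * h x ^ n * 1 := mul_le_mul' ((ell_bd hAB).2 h2) (Wf_int hK x)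
          _ = _ := mul_one _
    · have e : ∀ t, Wf (tA vt) K (x, t) = 0 := by
        intro t
        classical
        unfold Wf
        rw [Set.piecewise_eq_of_notMem]
        intro hX
        exact hx hX.1.1
      simp [e]
  have hKv : volume K = ∫⁻ x, volume {t : ℝ | (x, t) ∈ K} := by
    rw [Measure.volume_eq_prod, Measure.prod_apply hKc.measurableSet]; rfl
  have hKδ : volume K ≤ δ := by
    refine le_trans (measure_mono ?_) hvol
    intro X hX
    exact ⟨hX.1, (hcn X hX).1⟩
  have hms : Measurable fun x => volume {t : ℝ | (x, t) ∈ K} := measurable_measure_prodMk_left hKc.measurableSet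
  have fin : ∫⁻ x, (2 * ℓ x) ^ n * ∫⁻ t, ENNReal.ofReal (Wf (tA vt) K (x, t)) ≤ δ * ((8 * C) ^ n * C + (8 * C) ^ n) := by
    calc _ ≤ ∫⁻ x, ((8 * C) ^ n * C * volume {t : ℝ | (x, t) ∈ K} +
            (8 * C) ^ n * (closedBall 0 1).indicator (fun x => h x ^ n) x) := lintegral_mono hpt
      _ = (8 * C) ^ n * C * volume K + (8 * C) ^ n * hmass h (closedBall 0 1) := by
          rw [lintegral_add_left (hms.const_mul _), lintegral_const_mul _ hms, lintegral_const_mul _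
            ((hh.pow_const n).indicator measurableSet_closedBall), hKv, lintegral_indicator measurableSet_closedBall]
          rfl
      _ ≤ (8 * C) ^ n * C * δ + (8 * C) ^ n * δ := by gcongr
      _ = _ := by ring
  exact absurd (key.trans fin) (not_le.2 hδ)

end


/-- growth lemma on a scaled cylinder -/
theorem growth_sc {ν : ℝ} {δ : ℝ≥0∞} (hG : ∀ (h : En n → ℝ≥0∞) (v : En n × ℝ → ℝ) (D : Set (En n × ℝ)),
    Measurable h → SSE ν h v D → Cy n ⊆ D → (∀ X ∈ Cy n, 0 ≤ v X) → volume {X ∈ Cy n | v X < 1} ≤ δ →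
    hmass h (closedBall 0 1) ≤ δ → ∀ x1 : En n, ‖x1‖ ≤ 1 / 2 → 1 / 2 ≤ v (x1, 1))
    {h : En n → ℝ≥0∞} {v : En n × ℝ → ℝ} {D : Set (En n × ℝ)} (hh : Measurable h) (hS : SSE ν h v D)
    {y : En n} {s r : ℝ} (hr : 0 < r) (hD : closedBall y r ×ˢ Icc s (s + r ^ 2) ⊆ D) (hv : ∀ X ∈ D, 0 ≤ v X)
    (hvol : volume {X ∈ closedBall y r ×ˢ Icc s (s + r ^ 2) | v X < 1} ≤ ENNReal.ofReal (r ^ (n + 2)) * δ)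
    (hms : hmass h (closedBall y r) ≤ δ) {x : En n} (hx : ‖x - y‖ ≤ r / 2) : 1 / 2 ≤ v (x, s + r ^ 2) := by
  have hsub : ∀ X ∈ Cy n, Tm y s r X ∈ closedBall y r ×ˢ Icc s (s + r ^ 2) := by
    rintro X ⟨h1, h2, h3⟩
    refine ⟨?_, ?_, ?_⟩
    · rw [mem_closedBall_zero_iff] at h1
      simp only [Tm, mem_closedBall, dist_eq_norm, add_sub_cancel_left, norm_smul, Real.norm_eq_abs, abs_of_pos hr]
      nlinarith
    · simp only [Tm]; nlinarith [mul_nonneg (sq_nonneg r) h2]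
    · simp only [Tm]; nlinarith [mul_le_mul_of_nonneg_left h3 (sq_nonneg r)]
  have hcv : MeasurableSet {X ∈ closedBall y r ×ˢ Icc s (s + r ^ 2) | v X < 1} := by
    obtain ⟨vt, g, H, hS⟩ := hS
    have e : {X ∈ closedBall y r ×ˢ Icc s (s + r ^ 2) | v X < 1} =
        (closedBall y r ×ˢ Icc s (s + r ^ 2)) ∩ (D ∩ v ⁻¹' Iio 1) := by
      ext X; constructor
      · rintro ⟨h1, h2⟩; exact ⟨h1, hD h1, h2⟩
      · rintro ⟨h1, h2, h3⟩; exact ⟨h1, h3⟩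
    rw [e]
    exact (measurableSet_closedBall.prod measurableSet_Icc).inter (hS.cv.isOpen_inter_preimage hS.op isOpen_Iio).measurableSet
  have key := hG _ _ _ (hsc_meas hh) (hS.scale y s hr one_pos) (fun X hX => hD (hsub X hX)) (fun X hX => by
      rw [one_mul]; exact hv _ (hD (hsub X hX))) (by
      have h1 : volume (Tm y s r ⁻¹' {X ∈ closedBall y r ×ˢ Icc s (s + r ^ 2) | v X < 1}) ≤ δ := by
        rw [Tm_vol y s hr hcv]
        calc _ ≤ ENNReal.ofReal ((r ^ (n + 2))⁻¹) * (ENNReal.ofReal (r ^ (n + 2)) * δ) := by gcongr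
          _ = δ := by
            rw [← mul_assoc, ← ENNReal.ofReal_mul (by positivity), inv_mul_cancel₀ (by positivity), ENNReal.ofReal_one, one_mul]
      refine le_trans (measure_mono ?_) h1
      rintro X ⟨h2, h3⟩
      rw [one_mul] at h3
      exact ⟨hsub X h2, h3⟩) (by
      have e := hmass_scale hh y hr (A := closedBall y r) measurableSet_closedBall
      rw [← e] at hms
      refine le_trans (hmass_mono ?_) hms
      intro z hz
      exact (hsub (z, 0) ⟨hz, by simp⟩).1) (r⁻¹ • (x - y)) (by
      rw [norm_smul, norm_inv, Real.norm_eq_abs, abs_of_pos hr, inv_mul_le_iff₀ hr]; linarith)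
  simpa [Tm, smul_smul, hr.ne'] using key

theorem persist_sc {ν : ℝ} {ε : ℝ≥0∞} {c : ℝ} (hP : ∀ k : ℕ, ∀ (h : En n → ℝ≥0∞) (v : En n × ℝ → ℝ) (D : Set (En n × ℝ)) (T : ℝ),
      Measurable h → SSE ν h v D → T ≤ k → closedBall 0 1 ×ˢ Icc 0 T ⊆ D → (∀ X ∈ closedBall (0 : En n) 1 ×ˢ Icc 0 T, 0 ≤ v X) →
      (∀ x ∈ closedBall (0 : En n) (1 / 2), 1 ≤ v (x, 0)) → hmass h (closedBall 0 1) ≤ ε →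
      ∀ X ∈ closedBall (0 : En n) (1 / 4) ×ˢ Icc 0 T, c ^ k ≤ v X)
    {h : En n → ℝ≥0∞} {v : En n × ℝ → ℝ} {D : Set (En n × ℝ)} (hh : Measurable h) (hS : SSE ν h v D)
    {y : En n} {s r t1 : ℝ} (hr : 0 < r) (hD : closedBall y r ×ˢ Icc s t1 ⊆ D) (hv : ∀ X ∈ D, 0 ≤ v X)
    {k : ℕ} (hk : t1 - s ≤ k * r ^ 2) (h0 : ∀ x, ‖x - y‖ ≤ r / 2 → 1 / 2 ≤ v (x, s))
    (hms : hmass h (closedBall y r) ≤ ε) : ∀ X ∈ closedBall y (r / 4) ×ˢ Icc s t1, 1 / 2 * c ^ k ≤ v X := by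
  have hsub : ∀ X ∈ closedBall (0 : En n) 1 ×ˢ Icc 0 ((t1 - s) / r ^ 2), Tm y s r X ∈ closedBall y r ×ˢ Icc s t1 := by
    rintro X ⟨h1, h2, h3⟩
    refine ⟨?_, ?_, ?_⟩
    · rw [mem_closedBall_zero_iff] at h1
      simp only [Tm, mem_closedBall, dist_eq_norm, add_sub_cancel_left, norm_smul, Real.norm_eq_abs, abs_of_pos hr]
      nlinarith
    · simp only [Tm]; nlinarith [mul_nonneg (sq_nonneg r) h2]
    · rw [le_div_iff₀ (by positivity)] at h3
      simp only [Tm]; linarith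
  have key := hP k _ _ _ ((t1 - s) / r ^ 2) (hsc_meas hh) (hS.scale y s hr two_pos)
    (by rw [div_le_iff₀ (by positivity)]; exact hk) (fun X hX => hD (hsub X hX))
    (fun X hX => mul_nonneg two_pos.le (hv _ (hD (hsub X hX)))) (by
      intro x hx
      rw [mem_closedBall_zero_iff] at hx
      have := h0 (y + r • x) (by
        rw [add_sub_cancel_left, norm_smul, Real.norm_eq_abs, abs_of_pos hr]; nlinarith)
      simp only [Tm, mul_zero, add_zero]
      linarith) (by
      have e := hmass_scale hh y hr (A := closedBall y r) measurableSet_closedBall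
      rw [← e] at hms
      refine le_trans (hmass_mono ?_) hms
      intro z hz
      rw [mem_closedBall_zero_iff] at hz
      simp only [mem_preimage, mem_closedBall, dist_eq_norm, add_sub_cancel_left, norm_smul, Real.norm_eq_abs, abs_of_pos hr]
      nlinarith)
  rintro ⟨x, t⟩ ⟨hx, ht1, ht2⟩
  simp only at hx ht1 ht2
  rw [mem_closedBall, dist_eq_norm] at hx
  have := key (r⁻¹ • (x - y), (t - s) / r ^ 2) ⟨by
    rw [mem_closedBall_zero_iff, norm_smul, norm_inv, Real.norm_eq_abs, abs_of_pos hr, inv_mul_le_iff₀ hr]; linarith,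
    div_nonneg (by linarith) (by positivity), by simp only; gcongr⟩
  have e : Tm y s r (r⁻¹ • (x - y), (t - s) / r ^ 2) = (x, t) := by
    simp only [Tm, smul_smul, mul_inv_cancel₀ hr.ne', one_smul, add_sub_cancel]
    rw [mul_div_cancel₀ _ (by positivity)]; simp
  rw [e] at this
  linarith

theorem twoB_sc {ν T c : ℝ} {S : ℝ≥0∞} (hT : 0 < T) (h2 : ∀ (h : En n → ℝ≥0∞) (v : En n × ℝ → ℝ) (D : Set (En n × ℝ)), Measurable h →
      SSE ν h v D → closedBall 0 3 ×ˢ Icc 0 T ⊆ D → (∀ X ∈ closedBall (0 : En n) 3 ×ˢ Icc 0 T, 0 ≤ v X) →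
      (∀ X ∈ closedBall (0 : En n) 1 ×ˢ Icc 0 T, 1 ≤ v X) → hmass h (closedBall 0 3) ≤ S →
      ∀ x0 : En n, ‖x0‖ ≤ 2 → c ≤ v (x0, T))
    {h : En n → ℝ≥0∞} {v : En n × ℝ → ℝ} {D : Set (En n × ℝ)} (hh : Measurable h) (hS : SSE ν h v D)
    {y : En n} {t R κ : ℝ} (hR : 0 < R) (hκ : 0 < κ) (hD : closedBall y (3 * R) ×ˢ Icc (t - T * R ^ 2) t ⊆ D) (hv : ∀ X ∈ D, 0 ≤ v X)
    (h1 : ∀ X ∈ closedBall y R ×ˢ Icc (t - T * R ^ 2) t, κ ≤ v X) (hms : hmass h univ ≤ S) {x : En n} (hx : ‖x - y‖ ≤ 2 * R) :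
    κ * c ≤ v (x, t) := by
  have hsub : ∀ q : ℝ, ∀ X ∈ closedBall (0 : En n) q ×ˢ Icc 0 T, Tm y (t - T * R ^ 2) R X ∈ closedBall y (q * R) ×ˢ Icc (t - T * R ^ 2) t := by
    rintro q X ⟨h1, h2, h3⟩
    refine ⟨?_, ?_, ?_⟩
    · rw [mem_closedBall_zero_iff] at h1
      simp only [Tm, mem_closedBall, dist_eq_norm, add_sub_cancel_left, norm_smul, Real.norm_eq_abs, abs_of_pos hR]
      nlinarith
    · simp only [Tm]; nlinarith [mul_nonneg (sq_nonneg R) h2]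
    · simp only [Tm]; nlinarith [mul_le_mul_of_nonneg_left h3 (sq_nonneg R)]
  have key := h2 _ _ _ (hsc_meas hh) (hS.scale y (t - T * R ^ 2) hR (inv_pos.2 hκ)) (fun X hX => hD (hsub 3 X hX))
    (fun X hX => mul_nonneg (inv_pos.2 hκ).le (hv _ (hD (hsub 3 X hX)))) (fun X hX => by
      have := h1 _ (by simpa using hsub 1 X hX)
      rw [le_inv_mul_iff₀ hκ, mul_one]; exact this) (by
      have e := hmass_scale hh y hR (A := univ) MeasurableSet.univ
      rw [← e] at hms
      exact le_trans (hmass_mono (by simp)) hms) (R⁻¹ • (x - y)) (by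
      rw [norm_smul, norm_inv, Real.norm_eq_abs, abs_of_pos hR, inv_mul_le_iff₀ hR]; linarith)
  have e : Tm y (t - T * R ^ 2) R (R⁻¹ • (x - y), T) = (x, t) := by
    simp only [Tm, smul_smul, mul_inv_cancel₀ hR.ne', one_smul, add_sub_cancel]
    congr 1; ring
  rw [e, le_inv_mul_iff₀ hκ] at key
  exact key

theorem chainB {ν T c : ℝ} {S : ℝ≥0∞} (hT : 0 < T) (hc : 0 < c) (h2 : ∀ (h : En n → ℝ≥0∞) (v : En n × ℝ → ℝ) (D : Set (En n × ℝ)), Measurable h →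
      SSE ν h v D → closedBall 0 3 ×ˢ Icc 0 T ⊆ D → (∀ X ∈ closedBall (0 : En n) 3 ×ˢ Icc 0 T, 0 ≤ v X) →
      (∀ X ∈ closedBall (0 : En n) 1 ×ˢ Icc 0 T, 1 ≤ v X) → hmass h (closedBall 0 3) ≤ S →
      ∀ x0 : En n, ‖x0‖ ≤ 2 → c ≤ v (x0, T))
    {h : En n → ℝ≥0∞} {v : En n × ℝ → ℝ} {D : Set (En n × ℝ)} (hh : Measurable h) (hS : SSE ν h v D)
    {y : ℕ → En n} {s t1 R κ : ℝ} (hR : 0 < R) (hκ : 0 < κ) (hy : ∀ i, ‖y (i + 1) - y i‖ ≤ R) (hv : ∀ X ∈ D, 0 ≤ v X)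
    (hms : hmass h univ ≤ S) (h0 : ∀ X ∈ closedBall (y 0) R ×ˢ Icc s t1, κ ≤ v X) (J : ℕ)
    (hD : ∀ i < J, closedBall (y i) (3 * R) ×ˢ Icc s t1 ⊆ D) :
    ∀ X ∈ closedBall (y J) R ×ˢ Icc (s + J * (T * R ^ 2)) t1, κ * c ^ J ≤ v X := by
  induction J with
  | zero => simpa using h0
  | succ J ih =>
    rintro ⟨x, t⟩ ⟨hx, ht1, ht2⟩
    simp only at hx ht1 ht2
    push_cast at ht1
    have hTR : 0 < T * R ^ 2 := by positivity
    have hJ : (0 : ℝ) ≤ J * (T * R ^ 2) := by positivity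
    have := twoB_sc hT h2 hh hS hR (κ := κ * c ^ J) (y := y J) (t := t) (by positivity) (by
      refine subset_trans (prod_mono le_rfl (Icc_subset_Icc ?_ ht2)) (hD J (Nat.lt_succ_self J))
      linarith) hv (by
      intro X hX
      exact ih (fun i hi => hD i (by omega)) X ⟨hX.1, by have := hX.2.1; linarith, hX.2.2.trans ht2⟩) hms (x := x) (by
      rw [mem_closedBall, dist_eq_norm] at hx
      have := norm_add_le (x - y (J + 1)) (y (J + 1) - y J)
      rw [sub_add_sub_cancel] at this
      linarith [hy J])
    calc _ = κ * c ^ J * c := by ring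
      _ ≤ _ := this


theorem pigeon (hn : 0 < n) {S ε : ℝ≥0∞} (hS : S ≠ ⊤) (hε : ε ≠ 0) : ∃ ρ : ℝ, 0 < ρ ∧ ρ ≤ 1 / 8 ∧
    ∀ h : En n → ℝ≥0∞, hmass h univ ≤ S → ∃ y : En n, ‖y‖ ≤ 1 / 2 ∧ hmass h (closedBall y ρ) ≤ ε := by
  obtain ⟨N, hN⟩ := ENNReal.exists_nat_mul_gt hε hS
  refine ⟨1 / (8 * (N + 1)), by positivity, ?_, ?_⟩
  · rw [div_le_div_iff₀ (by positivity) (by positivity)]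
    have : (0 : ℝ) ≤ N := by positivity
    linarith
  intro h hm
  by_contra hcon
  push Not at hcon
  have hN0 : (0 : ℝ) < N + 1 := by positivity
  set e : En n := EuclideanSpace.single ⟨0, hn⟩ 1 with he
  have hen : ‖e‖ = 1 := by simp [he]
  set y : ℕ → En n := fun i => ((i : ℝ) / (2 * (N + 1))) • e with hy
  have h1 : ∀ i ∈ Finset.range N, ε ≤ hmass h (closedBall (y i) (1 / (8 * (N + 1)))) := by
    intro i hi
    refine (hcon (y i) ?_).le
    have hi' : (i : ℝ) ≤ N := by exact_mod_cast (Finset.mem_range.1 hi).le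
    rw [hy]; simp only
    rw [norm_smul, hen, mul_one, Real.norm_eq_abs, abs_of_nonneg (by positivity), div_le_div_iff₀ (by positivity) (by positivity)]
    linarith
  have h2 : ∑ i ∈ Finset.range N, hmass h (closedBall (y i) (1 / (8 * (N + 1)))) ≤ S := by
    unfold hmass
    rw [← lintegral_biUnion_finset]
    · exact (lintegral_mono_set (subset_univ _)).trans hm
    · intro i _ j _ hij
      refine closedBall_disjoint_closedBall ?_
      rw [dist_eq_norm, hy]; simp only
      rw [← sub_smul, norm_smul, hen, mul_one, ← sub_div, Real.norm_eq_abs, abs_div, abs_of_pos (by positivity : 0 < 2 * ((N : ℝ) + 1)),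
        ← add_div, div_lt_div_iff₀ (by positivity) (by positivity)]
      have : (1 : ℝ) ≤ |(i : ℝ) - j| := by
        have : (1 : ℤ) ≤ |(i : ℤ) - j| := Int.one_le_abs (by omega)
        exact_mod_cast this
      nlinarith
    · intro i _; exact measurableSet_closedBall
  have h3 := (Finset.sum_le_sum h1).trans h2
  rw [Finset.sum_const, Finset.card_range, nsmul_eq_mul] at h3
  exact absurd h3 (not_le.2 hN)

set_option maxHeartbeats 800000 in
theorem lemM (hn : 0 < n) {ν : ℝ} (hν : 1 ≤ ν) {S : ℝ≥0∞} (hSt : S ≠ ⊤) : ∃ δ0 : ℝ≥0∞, 0 < δ0 ∧ ∀ L : ℝ, 0 ≤ L → ∃ c : ℝ, 0 < c ∧ c ≤ 1 ∧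
    ∀ (h : En n → ℝ≥0∞) (v : En n × ℝ → ℝ) (D : Set (En n × ℝ)) (x1 : En n) (t1 : ℝ), Measurable h → SSE ν h v D →
    (∀ X ∈ D, 0 ≤ v X) → hmass h univ ≤ S → ‖x1‖ ≤ L → 0 ≤ t1 → t1 ≤ L →
    (∀ s ∈ Icc (0 : ℝ) 1, ball (s • x1) 1 ×ˢ Ioc (-1) t1 ⊆ D) →
    volume {X ∈ ball (0 : En n) 1 ×ˢ Ioo (-1 : ℝ) 0 | v X < 1} ≤ δ0 → c ≤ v (x1, t1) := by
  obtain ⟨δ, hδ, hG⟩ := growth (n := n) hn hν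
  obtain ⟨ε, hε, cp, hcp, hcp1, hP⟩ := persist (n := n) hn hν
  obtain ⟨T, hT, cT, hcT, hcT1, h2⟩ := twoB (n := n) hn hν S hSt
  obtain ⟨ρ, hρ, hρ8, hpig⟩ := pigeon (n := n) hn hSt (ε := min δ ε) (lt_min hδ hε).ne'
  have hρn : 0 < ENNReal.ofReal (ρ ^ (n + 2)) := ENNReal.ofReal_pos.2 (by positivity)
  refine ⟨ENNReal.ofReal (ρ ^ (n + 2)) * δ, ENNReal.mul_pos hρn.ne' hδ.ne', ?_⟩
  intro L hL
  set k := ⌈(L + 1) / ρ ^ 2⌉₊ with hk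
  have hkr : L + 1 ≤ k * ρ ^ 2 := by
    rw [← div_le_iff₀ (by positivity)]; exact Nat.le_ceil _
  set R := min (ρ / 4) (1 / (2 * (L + 2) * T)) with hRd
  have hL2 : 0 < 2 * (L + 2) * T := by positivity
  have hR : 0 < R := lt_min (by positivity) (by positivity)
  have hRρ : R ≤ ρ / 4 := min_le_left _ _
  have hRT : R * (2 * (L + 2) * T) ≤ 1 := by
    have := min_le_right (ρ / 4) (1 / (2 * (L + 2) * T))
    rwa [← hRd, le_div_iff₀ hL2] at this
  set J := ⌈(L + 1) / R⌉₊ with hJ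
  have hJ1 : L + 1 ≤ J * R := by
    rw [← div_le_iff₀ hR]; exact Nat.le_ceil _
  have hJ2 : J * R ≤ L + 2 := by
    have h3 : (J : ℝ) < (L + 1) / R + 1 := Nat.ceil_lt_add_one (by positivity)
    have h4 : (J : ℝ) * R ≤ ((L + 1) / R + 1) * R := by gcongr
    have h5 : ((L + 1) / R + 1) * R = L + 1 + R := by field_simp
    linarith
  have hJT : J * (T * R ^ 2) ≤ 1 / 2 := by
    have : (J * R) * (T * R) ≤ (L + 2) * (T * R) := by gcongr
    nlinarith
  have hJ0 : (0 : ℝ) < J := by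
    by_contra hcc
    have : (J : ℝ) = 0 := le_antisymm (not_lt.1 hcc) (by positivity)
    rw [this] at hJ1; linarith
  refine ⟨1 / 2 * cp ^ k * cT ^ J, by positivity, ?_, ?_⟩
  · have h3 : cp ^ k ≤ 1 := pow_le_one₀ hcp.le hcp1
    have h4 : cT ^ J ≤ 1 := pow_le_one₀ hcT.le hcT1
    have h5 : cp ^ k * cT ^ J ≤ 1 * 1 := by gcongr
    linarith
  intro h v D x1 t1 hh hS hv hm hx1 ht0 ht1 hD hvol
  obtain ⟨y, hy, hym⟩ := hpig h hm
  have hρ2 : ρ ^ 2 ≤ 1 / 8 := by nlinarith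
  have hball : ∀ s ∈ Icc (0 : ℝ) 1, closedBall ((1 - s) • y + s • x1) (1 / 4) ×ˢ Icc (-(3 / 4)) t1 ⊆ D := by
    intro s hs
    refine subset_trans (prod_mono ?_ ?_) (hD s hs)
    · intro z hz
      rw [mem_closedBall, dist_eq_norm] at hz
      rw [mem_ball, dist_eq_norm]
      have e : z - s • x1 = (z - ((1 - s) • y + s • x1)) + (1 - s) • y := by abel
      have h3 : ‖(1 - s) • y‖ ≤ 1 / 2 := by
        rw [norm_smul, Real.norm_eq_abs, abs_of_nonneg (by linarith [hs.2])]
        nlinarith [hs.1, hs.2, norm_nonneg y]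
      rw [e]
      linarith [norm_add_le (z - ((1 - s) • y + s • x1)) ((1 - s) • y)]
    · intro t ht; exact ⟨by linarith [ht.1], ht.2⟩
  have hy0 := hball 0 (by simp)
  simp only [sub_zero, one_smul, zero_smul, add_zero] at hy0
  -- growth
  have hg : ∀ x : En n, ‖x - y‖ ≤ ρ / 2 → 1 / 2 ≤ v (x, -(3 / 4) + ρ ^ 2) := by
    intro x hx
    refine growth_sc hG hh hS hρ (y := y) ?_ hv ?_ (hym.trans (min_le_left _ _)) hx
    · refine subset_trans (prod_mono (closedBall_subset_closedBall (by linarith)) (Icc_subset_Icc le_rfl (by linarith))) hy0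
    · refine le_trans (measure_mono ?_) hvol
      rintro X ⟨⟨h3, h4⟩, h5⟩
      refine ⟨⟨?_, ?_⟩, h5⟩
      · rw [mem_closedBall, dist_eq_norm] at h3
        rw [mem_ball_zero_iff]
        have := norm_add_le (X.1 - y) y
        rw [sub_add_cancel] at this
        linarith
      · exact ⟨by linarith [h4.1], by linarith [h4.2]⟩
  have hp := persist_sc hP hh hS hρ (y := y) (s := -(3 / 4) + ρ ^ 2) (t1 := t1) (k := k) (by
      refine subset_trans (prod_mono (closedBall_subset_closedBall (by linarith)) (Icc_subset_Icc ?_ le_rfl)) hy0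
      linarith [sq_nonneg ρ]) hv (by nlinarith) hg (hym.trans (min_le_right _ _))
  have hch := chainB hT hcT h2 hh hS (y := fun i => (1 - min ((i : ℝ) / J) 1) • y + (min ((i : ℝ) / J) 1) • x1) (s := -(1 / 2)) (t1 := t1)
    (κ := 1 / 2 * cp ^ k) hR (by positivity) (by
      intro i
      push_cast
      have e : (1 - min (((i : ℝ) + 1) / J) 1) • y + (min (((i : ℝ) + 1) / J) 1) • x1 - ((1 - min ((i : ℝ) / J) 1) • y + (min ((i : ℝ) / J) 1) • x1)
          = (min (((i : ℝ) + 1) / J) 1 - min ((i : ℝ) / J) 1) • (x1 - y) := by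
        module
      rw [e, norm_smul, Real.norm_eq_abs]
      have h3 : |min (((i : ℝ) + 1) / J) 1 - min ((i : ℝ) / J) 1| ≤ 1 / J := by
        have h4 : ((i : ℝ) + 1) / J = i / J + 1 / J := by ring
        have h5 : (0 : ℝ) < 1 / J := by positivity
        rw [h4, abs_le]
        rcases le_total ((i : ℝ) / J + 1 / J) 1 with h6 | h6 <;> rcases le_total ((i : ℝ) / J) 1 with h7 | h7 <;>
          simp only [h6, h7, min_eq_left, min_eq_right] <;> constructor <;> linarith
      have h4 : ‖x1 - y‖ ≤ L + 1 := by linarith [norm_sub_le x1 y]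
      calc _ ≤ 1 / J * (L + 1) := by gcongr
        _ ≤ 1 / J * (J * R) := by gcongr
        _ = R := by field_simp) hv hm (by
      simp only [Nat.cast_zero, zero_div]
      rw [min_eq_left (by norm_num)]
      simp only [sub_zero, one_smul, zero_smul, add_zero]
      intro X hX
      exact hp X ⟨closedBall_subset_closedBall hRρ hX.1, by linarith [hX.2.1], hX.2.2⟩) J (by
      intro i _
      refine subset_trans (prod_mono (closedBall_subset_closedBall (by linarith)) (Icc_subset_Icc (by norm_num) le_rfl))
        (hball (min ((i : ℝ) / J) 1) ⟨le_min (by positivity) zero_le_one, min_le_right _ _⟩))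
  refine hch (x1, t1) ⟨?_, ?_, le_rfl⟩
  · simp only [div_self hJ0.ne', min_self, sub_self, zero_smul, one_smul, zero_add]
    exact mem_closedBall_self hR.le
  · simp only; linarith


theorem lemM_sc (hn : 0 < n) {ν : ℝ} (hν : 1 ≤ ν) {S : ℝ≥0∞} (hSt : S ≠ ⊤) : ∃ δ0 : ℝ≥0∞, 0 < δ0 ∧ ∀ L : ℝ, 0 ≤ L → ∃ c : ℝ, 0 < c ∧ c ≤ 1 ∧
    ∀ (h : En n → ℝ≥0∞) (v : En n × ℝ → ℝ), Measurable h → SSE ν h v (ball 0 1 ×ˢ Ioo (-1) 0) →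
    (∀ X ∈ ball (0 : En n) 1 ×ˢ Ioo (-1 : ℝ) 0, 0 ≤ v X) → hmass h univ ≤ S →
    ∀ (z x1 : En n) (top t1 ρ κ : ℝ), 0 < κ → 0 < ρ → ρ ≤ 1 / 2 → ‖z‖ ≤ 1 / 2 → ‖x1‖ ≤ 1 / 2 → -1 ≤ top - ρ ^ 2 →
    top ≤ t1 → t1 < 0 → ‖x1 - z‖ ≤ L * ρ → t1 - top ≤ L * ρ ^ 2 →
    volume {X ∈ ball z ρ ×ˢ Ioo (top - ρ ^ 2) top | v X < κ} ≤ ENNReal.ofReal (ρ ^ (n + 2)) * δ0 → κ * c ≤ v (x1, t1) := by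
  obtain ⟨δ0, hδ0, hM⟩ := lemM (n := n) hn hν hSt
  refine ⟨δ0, hδ0, fun L hL => ?_⟩
  obtain ⟨c, hc, hc1, hM⟩ := hM L hL
  refine ⟨c, hc, hc1, ?_⟩
  intro h v hh hS hv hm z x1 top t1 ρ κ hκ hρ hρ2 hz hx1 htop ht ht0 hxz htt hvol
  have hρ2p : 0 < ρ ^ 2 := by positivity
  have hcv : MeasurableSet {X ∈ ball z ρ ×ˢ Ioo (top - ρ ^ 2) top | v X < κ} := by
    obtain ⟨vt, g, H, hS⟩ := hS
    have e : {X ∈ ball z ρ ×ˢ Ioo (top - ρ ^ 2) top | v X < κ} =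
        (ball z ρ ×ˢ Ioo (top - ρ ^ 2) top) ∩ ((ball 0 1 ×ˢ Ioo (-1) 0) ∩ v ⁻¹' Iio κ) := by
      ext X; constructor
      · rintro ⟨⟨h1, h2⟩, h3⟩
        refine ⟨⟨h1, h2⟩, ⟨?_, ?_⟩, h3⟩
        · rw [mem_ball, dist_eq_norm] at h1
          rw [mem_ball_zero_iff]
          have := norm_add_le (X.1 - z) z
          rw [sub_add_cancel] at this
          linarith
        · exact ⟨by linarith [h2.1], by linarith [h2.2]⟩
      · rintro ⟨h1, h2, h3⟩; exact ⟨h1, h3⟩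
    rw [e]
    exact (measurableSet_ball.prod measurableSet_Ioo).inter (hS.cv.isOpen_inter_preimage hS.op isOpen_Iio).measurableSet
  have key := hM (hsc z ρ h) (fun X => κ⁻¹ * v (Tm z top ρ X)) _ (ρ⁻¹ • (x1 - z)) ((t1 - top) / ρ ^ 2) (hsc_meas hh)
    (hS.scale z top hρ (inv_pos.2 hκ)) (fun X hX => mul_nonneg (inv_pos.2 hκ).le (hv _ hX)) (by
      have e := hmass_scale hh z hρ (A := univ) MeasurableSet.univ
      rw [← e] at hm
      simpa using hm) (by
      rw [norm_smul, norm_inv, Real.norm_eq_abs, abs_of_pos hρ, inv_mul_le_iff₀ hρ]; linarith)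
    (div_nonneg (by linarith) hρ2p.le) (by rw [div_le_iff₀ hρ2p]; exact htt) (by
      rintro s ⟨hs0, hs1⟩ ⟨x, t⟩ ⟨hx, ht3, ht4⟩
      simp only at hx ht3 ht4
      rw [mem_ball, dist_eq_norm] at hx
      rw [le_div_iff₀ hρ2p] at ht4
      refine ⟨?_, ?_, ?_⟩
      · simp only [Tm, mem_ball_zero_iff]
        have e : z + ρ • x = ((1 - s) • z + s • x1) + ρ • (x - s • ρ⁻¹ • (x1 - z)) := by
          rw [smul_sub, smul_smul, smul_smul, show ρ * s * ρ⁻¹ = s by field_simp]; module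
        rw [e]
        have h1 : ‖(1 - s) • z + s • x1‖ ≤ 1 / 2 := by
          refine (norm_add_le _ _).trans ?_
          rw [norm_smul, norm_smul, Real.norm_eq_abs, Real.norm_eq_abs, abs_of_nonneg hs0, abs_of_nonneg (by linarith)]
          nlinarith
        have h2 : ‖ρ • (x - s • ρ⁻¹ • (x1 - z))‖ < 1 / 2 := by
          rw [norm_smul, Real.norm_eq_abs, abs_of_pos hρ]
          nlinarith
        linarith [norm_add_le ((1 - s) • z + s • x1) (ρ • (x - s • ρ⁻¹ • (x1 - z)))]
      · simp only [Tm]; nlinarith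
      · simp only [Tm]; linarith) (by
      have h1 : volume (Tm z top ρ ⁻¹' {X ∈ ball z ρ ×ˢ Ioo (top - ρ ^ 2) top | v X < κ}) ≤ δ0 := by
        rw [Tm_vol z top hρ hcv]
        calc _ ≤ ENNReal.ofReal ((ρ ^ (n + 2))⁻¹) * (ENNReal.ofReal (ρ ^ (n + 2)) * δ0) := by gcongr
          _ = δ0 := by
            rw [← mul_assoc, ← ENNReal.ofReal_mul (by positivity), inv_mul_cancel₀ (by positivity), ENNReal.ofReal_one, one_mul]
      refine le_trans (measure_mono ?_) h1
      rintro X ⟨⟨h2, h4, h5⟩, h3⟩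
      rw [inv_mul_lt_iff₀ hκ, mul_one] at h3
      rw [mem_ball_zero_iff] at h2
      refine ⟨⟨?_, ?_, ?_⟩, h3⟩
      · simp only [Tm, mem_ball, dist_eq_norm, add_sub_cancel_left, norm_smul, Real.norm_eq_abs, abs_of_pos hρ]
        nlinarith
      · simp only [Tm]; nlinarith
      · simp only [Tm]; nlinarith)
  have e : Tm z top ρ (ρ⁻¹ • (x1 - z), (t1 - top) / ρ ^ 2) = (x1, t1) := by
    simp only [Tm, smul_smul, mul_inv_cancel₀ hρ.ne', one_smul, add_sub_cancel]
    rw [mul_div_cancel₀ _ (by positivity)]; simp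
  simp only [e] at key
  rwa [le_inv_mul_iff₀ hκ] at key

theorem stack1 {ι : Type*} {m : ℝ} (hm : 0 ≤ m) (N : ℕ) : ∀ (s : Finset ι) (a b : ι → ℝ), s.card ≤ N → (∀ i ∈ s, a i < b i) →
    ENNReal.ofReal m * volume ((⋃ i ∈ s, Ico (a i) (b i)) \ (⋃ i ∈ s, Ico (b i) (b i + m * (b i - a i)))) ≤
      volume (⋃ i ∈ s, Ico (b i) (b i + m * (b i - a i))) := by
  induction N with
  | zero =>
    intro s a b hs _
    have : s = ∅ := Finset.card_eq_zero.1 (Nat.le_zero.1 hs)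
    subst this; simp
  | succ N ih =>
    intro s a b hs hab
    rcases s.eq_empty_or_nonempty with rfl | hne
    · simp
    obtain ⟨i, hi, hmin⟩ := s.exists_min_image a hne
    set T := b i + m * (b i - a i) with hT
    have hbT : b i ≤ T := by have := hab i hi; nlinarith
    classical
    set s' := s.filter (fun j => T < b j) with hs'
    set a' : ι → ℝ := fun j => max (a j) T with ha'
    have hcard : s'.card ≤ N := by
      have : s'.card < s.card := Finset.card_lt_card ⟨Finset.filter_subset _ _, fun hh => by
        have := (Finset.mem_filter.1 (hh hi)).2
        linarith⟩
      omega
    have ih' := ih s' a' b hcard (by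
      intro j hj
      obtain ⟨h1, h2⟩ := Finset.mem_filter.1 hj
      exact max_lt (hab j h1) h2)
    set V := ⋃ j ∈ s, Ico (a j) (b j) with hV
    set W := ⋃ j ∈ s, Ico (b j) (b j + m * (b j - a j)) with hW
    set V' := ⋃ j ∈ s', Ico (a' j) (b j) with hV'
    set W' := ⋃ j ∈ s', Ico (b j) (b j + m * (b j - a' j)) with hW'
    have hWW : W' ⊆ W := by
      intro x hx
      simp only [hW', mem_iUnion] at hx
      obtain ⟨j, hj, h1, h2⟩ := hx
      obtain ⟨h3, h4⟩ := Finset.mem_filter.1 hj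
      simp only [hW, mem_iUnion]
      refine ⟨j, h3, h1, h2.trans_le ?_⟩
      have : a j ≤ a' j := le_max_left _ _
      nlinarith
    have hWT : W' ⊆ Ici T := by
      intro x hx
      simp only [hW', mem_iUnion] at hx
      obtain ⟨j, hj, h1, h2⟩ := hx
      obtain ⟨h3, h4⟩ := Finset.mem_filter.1 hj
      exact h4.le.trans h1
    have hiW : Ico (b i) T ⊆ W := by
      intro x hx
      simp only [hW, mem_iUnion]
      exact ⟨i, hi, hx⟩
    have hN : V \ W ⊆ Ico (a i) (b i) ∪ (V' \ W') := by
      rintro x ⟨hx, hxW⟩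
      simp only [hV, mem_iUnion] at hx
      obtain ⟨j, hj, h1, h2⟩ := hx
      by_cases h3 : x < b i
      · left; exact ⟨(hmin j hj).trans h1, h3⟩
      · right
        have h4 : T ≤ x := by
          by_contra h5
          exact hxW (hiW ⟨not_lt.1 h3, not_le.1 h5⟩)
        refine ⟨?_, fun h5 => hxW (hWW h5)⟩
        simp only [hV', mem_iUnion]
        exact ⟨j, Finset.mem_filter.2 ⟨hj, h4.trans_lt h2⟩, max_le h1 h4, h2⟩
    have hmW' : MeasurableSet W' := Finset.measurableSet_biUnion _ fun _ _ => measurableSet_Ico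
    calc ENNReal.ofReal m * volume (V \ W) ≤ ENNReal.ofReal m * (volume (Ico (a i) (b i)) + volume (V' \ W')) := by
          gcongr
          exact (measure_mono hN).trans (measure_union_le _ _)
      _ = ENNReal.ofReal m * volume (Ico (a i) (b i)) + ENNReal.ofReal m * volume (V' \ W') := mul_add _ _ _
      _ ≤ volume (Ico (b i) T) + volume W' := by
          gcongr
          rw [Real.volume_Ico, Real.volume_Ico, ← ENNReal.ofReal_mul hm]
          apply le_of_eq; congr 1; rw [hT]; ring
      _ = volume (Ico (b i) T ∪ W') := by
          rw [measure_union _ hmW']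
          rw [Set.disjoint_left]
          intro x hx hx'
          exact absurd (hWT hx') (not_le.2 hx.2)
      _ ≤ volume W := measure_mono (union_subset hiW hWW)

theorem stack1' {ι : Type*} {m : ℝ} (hm : 0 ≤ m) (s : Finset ι) (a b : ι → ℝ) (hab : ∀ i ∈ s, a i < b i) :
    ENNReal.ofReal m * volume (⋃ i ∈ s, Ico (a i) (b i)) ≤
      ENNReal.ofReal (m + 1) * volume (⋃ i ∈ s, Ico (b i) (b i + m * (b i - a i))) := by
  have h1 := stack1 hm s.card s a b le_rfl hab
  have h2 : volume (⋃ i ∈ s, Ico (a i) (b i)) ≤ volume ((⋃ i ∈ s, Ico (a i) (b i)) \ (⋃ i ∈ s, Ico (b i) (b i + m * (b i - a i)))) +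
      volume (⋃ i ∈ s, Ico (b i) (b i + m * (b i - a i))) := by
    refine le_trans (measure_mono ?_) (measure_union_le _ _)
    intro x hx
    by_cases hxx : x ∈ ⋃ i ∈ s, Ico (b i) (b i + m * (b i - a i))
    · right; exact hxx
    · left; exact ⟨hx, hxx⟩
  rw [ENNReal.ofReal_add hm zero_le_one, add_mul, ENNReal.ofReal_one, one_mul]
  calc _ ≤ ENNReal.ofReal m * (volume ((⋃ i ∈ s, Ico (a i) (b i)) \ (⋃ i ∈ s, Ico (b i) (b i + m * (b i - a i)))) +
      volume (⋃ i ∈ s, Ico (b i) (b i + m * (b i - a i)))) := by gcongr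
    _ ≤ _ := by rw [mul_add, add_comm]; gcongr

theorem stackN {ι : Type*} {m : ℝ} (hm : 0 ≤ m) (s : Finset ι) (B : ι → Set (En n)) (hB : ∀ i, MeasurableSet (B i)) (a b : ι → ℝ)
    (hab : ∀ i ∈ s, a i < b i) :
    ENNReal.ofReal m * volume (⋃ i ∈ s, B i ×ˢ Ico (a i) (b i)) ≤
      ENNReal.ofReal (m + 1) * volume (⋃ i ∈ s, B i ×ˢ Ico (b i) (b i + m * (b i - a i))) := by
  classical
  have hsl : ∀ (p q : ι → ℝ) (x : En n), (Prod.mk x ⁻¹' (⋃ i ∈ s, B i ×ˢ Ico (p i) (q i))) = ⋃ i ∈ s.filter (fun i => x ∈ B i), Ico (p i) (q i) := by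
    intro p q x
    ext t
    simp only [mem_preimage, mem_iUnion, mem_prod, Finset.mem_filter, exists_prop, and_assoc]
  have hms : ∀ (p q : ι → ℝ), MeasurableSet (⋃ i ∈ s, B i ×ˢ Ico (p i) (q i)) := fun p q =>
    Finset.measurableSet_biUnion _ fun i _ => (hB i).prod measurableSet_Ico
  rw [Measure.volume_eq_prod, Measure.prod_apply (hms _ _), Measure.prod_apply (hms _ _), ← lintegral_const_mul _
    (measurable_measure_prodMk_left (hms _ _)), ← lintegral_const_mul _ (measurable_measure_prodMk_left (hms _ _))]
  refine lintegral_mono fun x => ?_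
  simp only [hsl]
  exact stack1' hm _ a b fun i hi => hab i (Finset.mem_filter.1 hi).1


theorem vitcov {ι : Type*} (s : Finset ι) (z : ι → En n) (ρ a : ι → ℝ) {κ : ℝ} (hκ : 0 < κ) (hκ2 : κ ≤ 2) (hρ : ∀ i ∈ s, 0 < ρ i)
    {E : Set (En n × ℝ)} (hE : MeasurableSet E) {δ : ℝ≥0∞}
    (hd : ∀ i ∈ s, ENNReal.ofReal (ρ i ^ (n + 2)) * δ ≤ volume ((ball (z i) (ρ i) ×ˢ Ioo (a i) (a i + κ * ρ i ^ 2)) \ E)) :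
    δ * volume (⋃ i ∈ s, ball (z i) (ρ i) ×ˢ Ioo (a i) (a i + κ * ρ i ^ 2)) ≤
      (volume (ball (0 : En n) 5) * ENNReal.ofReal 18) * volume ((⋃ i ∈ s, ball (z i) (ρ i) ×ˢ Ioo (a i) (a i + κ * ρ i ^ 2)) \ E) := by
  classical
  set C : ι → Set (En n × ℝ) := fun i => ball (z i) (ρ i) ×ˢ Ioo (a i) (a i + κ * ρ i ^ 2) with hC
  set K := volume (ball (0 : En n) 5) * ENNReal.ofReal 18 with hK
  obtain ⟨R, hR⟩ := (s.finite_toSet.image ρ).bddAbove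
  obtain ⟨u, hu, hdis, hcov⟩ := Vitali.exists_disjoint_subfamily_covering_enlargement C (s : Set ι) ρ 2 one_lt_two
    (fun i hi => (hρ i hi).le) R (fun i hi => hR ⟨i, hi, rfl⟩) (fun i hi => by
      have h1 := hρ i hi
      have h2 : 0 < κ * ρ i ^ 2 := by positivity
      exact ⟨(z i, a i + κ * ρ i ^ 2 / 2), mem_ball_self h1, by constructor <;> simp only <;> linarith⟩)
  have hfin := s.finite_toSet.subset hu
  set u' := hfin.toFinset with hu'
  have hmem : ∀ i, i ∈ u' ↔ i ∈ u := fun i => hfin.mem_toFinset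
  have hus : ∀ i ∈ u', i ∈ s := fun i hi => hu ((hmem i).1 hi)
  set G : ι → Set (En n × ℝ) := fun i => ball (z i) (5 * ρ i) ×ˢ Ioo (a i - 4 * (κ * ρ i ^ 2)) (a i + 5 * (κ * ρ i ^ 2)) with hG
  have hGv : ∀ i ∈ u', volume (G i) ≤ ENNReal.ofReal (ρ i ^ (n + 2)) * K := by
    intro i hi
    have h1 := hρ i (hus i hi)
    rw [hG]; simp only
    rw [Measure.volume_eq_prod, Measure.prod_prod, Measure.addHaar_ball_center, mul_comm 5 (ρ i), vol_ball_scale n h1, Real.volume_Ioo]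
    calc _ ≤ ENNReal.ofReal (ρ i ^ n) * volume (ball (0 : En n) 5) * ENNReal.ofReal (ρ i ^ 2 * 18) := by
          gcongr; nlinarith [sq_nonneg (ρ i)]
      _ = _ := by
          rw [ENNReal.ofReal_mul (by positivity), pow_add, ENNReal.ofReal_mul (by positivity), hK]; ring
  have hUG : (⋃ i ∈ s, C i) ⊆ ⋃ i ∈ u', G i := by
    intro Y hY
    simp only [mem_iUnion] at hY ⊢
    obtain ⟨i, hi, hYx, hYt1, hYt2⟩ := hY
    obtain ⟨j, hj, ⟨X, ⟨hXi, hXi1, hXi2⟩, ⟨hXj, hXj1, hXj2⟩⟩, hij⟩ := hcov i hi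
    refine ⟨j, (hmem j).2 hj, ?_, ?_⟩
    · rw [mem_ball] at *
      have h1 := dist_triangle4 Y.1 (z i) X.1 (z j)
      rw [dist_comm (z i) X.1] at h1
      linarith
    · have h1 : ρ i ^ 2 ≤ (2 * ρ j) ^ 2 := by
        have := (hρ i hi).le
        gcongr
      have h2 : κ * ρ i ^ 2 ≤ 4 * (κ * ρ j ^ 2) := by nlinarith
      constructor <;> linarith
  calc δ * volume (⋃ i ∈ s, C i) ≤ δ * ∑ i ∈ u', volume (G i) := by
        gcongr
        exact (measure_mono hUG).trans (measure_biUnion_finset_le _ _)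
    _ ≤ δ * ∑ i ∈ u', ENNReal.ofReal (ρ i ^ (n + 2)) * K := by
        gcongr with i hi
        exact hGv i hi
    _ = K * ∑ i ∈ u', ENNReal.ofReal (ρ i ^ (n + 2)) * δ := by
        rw [← Finset.sum_mul, ← Finset.sum_mul]; ring
    _ ≤ K * ∑ i ∈ u', volume (C i \ E) := by
        gcongr with i hi
        exact hd i (hus i hi)
    _ = K * volume (⋃ i ∈ u', C i \ E) := by
        congr 1
        rw [measure_biUnion_finset]
        · intro i hi j hj hij
          exact (hdis ((hmem i).1 hi) ((hmem j).1 hj) hij).mono diff_subset diff_subset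
        · intro i _
          exact (measurableSet_ball.prod measurableSet_Ioo).diff hE
    _ ≤ K * volume ((⋃ i ∈ s, C i) \ E) := by
        gcongr
        intro Y hY
        simp only [mem_iUnion] at hY
        obtain ⟨i, hi, h1, h2⟩ := hY
        refine ⟨?_, h2⟩
        simp only [mem_iUnion]
        exact ⟨i, hus i hi, h1⟩

def Qt (n : ℕ) (τ : ℝ) : Set (En n × ℝ) := ball 0 (1 / 2) ×ˢ Ioo (-1) τ

def Qh (τ : ℝ) (X : En n × ℝ) (θ : ℝ) : Set (En n × ℝ) :=
  ball ((1 - θ) • X.1) (θ / 2) ×ˢ Ioo (X.2 - θ ^ 2 * (X.2 + 1)) (X.2 - θ ^ 2 * (X.2 + 1) + 4 * (1 + τ) * (θ / 2) ^ 2)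

theorem Qh_ctr {τ θ : ℝ} {X : En n × ℝ} (hX : X ∈ Qt n τ) (hθ1 : θ ≤ 1) : ‖(1 - θ) • X.1‖ ≤ (1 - θ) / 2 := by
  have := hX.1
  rw [mem_ball_zero_iff] at this
  rw [norm_smul, Real.norm_eq_abs, abs_of_nonneg (by linarith)]
  nlinarith

theorem Qh_ball {τ θ : ℝ} {X : En n × ℝ} (hX : X ∈ Qt n τ) (hθ1 : θ ≤ 1) :
    ball ((1 - θ) • X.1) (θ / 2) ⊆ ball 0 (1 / 2) := by
  intro z hz
  have h1 := Qh_ctr hX hθ1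
  rw [mem_ball, dist_eq_norm] at hz
  rw [mem_ball_zero_iff]
  have := norm_add_le (z - (1 - θ) • X.1) ((1 - θ) • X.1)
  rw [sub_add_cancel] at this
  linarith

theorem Qh_sub {τ θ : ℝ} {X : En n × ℝ} (hX : X ∈ Qt n τ) (hθ : 0 < θ) (hθ1 : θ ≤ 1) : Qh τ X θ ⊆ Qt n τ := by
  have h2 : θ ^ 2 ≤ 1 := by nlinarith
  obtain ⟨h3, h4⟩ := hX.2
  rintro Y ⟨hY, hY1, hY2⟩
  refine ⟨Qh_ball hX hθ1 hY, ?_, ?_⟩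
  · nlinarith
  · nlinarith

theorem Qh_open (τ : ℝ) (X : En n × ℝ) (θ : ℝ) : IsOpen (Qh τ X θ) := isOpen_ball.prod isOpen_Ioo

theorem Qh_self {τ θ : ℝ} {X : En n × ℝ} (hX : X ∈ Qt n τ) (hθ : 0 < θ) : X ∈ Qh τ X θ := by
  obtain ⟨h3, h4⟩ := hX.2
  have h1 := hX.1
  rw [mem_ball_zero_iff] at h1
  have h2 : 0 < θ ^ 2 := by positivity
  refine ⟨?_, ?_, ?_⟩
  · rw [mem_ball, dist_eq_norm, show X.1 - (1 - θ) • X.1 = θ • X.1 by module, norm_smul, Real.norm_eq_abs, abs_of_pos hθ]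
    nlinarith
  · nlinarith
  · nlinarith

theorem Qh_small {τ θ : ℝ} {X : En n × ℝ} (hτ : τ ≤ 0) (hX : X ∈ Qt n τ) (hθ : 0 < θ) (hθ1 : θ ≤ 1) : Qh τ X θ ⊆ ball X (2 * θ) := by
  obtain ⟨h3, h4⟩ := hX.2
  have h1 := hX.1
  rw [mem_ball_zero_iff] at h1
  have h2 : 0 < θ ^ 2 := by positivity
  have h5 : θ ^ 2 ≤ θ := by nlinarith
  rintro Y ⟨hY, hY1, hY2⟩
  rw [mem_ball, Prod.dist_eq, max_lt_iff]
  constructor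
  · rw [mem_ball] at hY
    have h6 : dist ((1 - θ) • X.1) X.1 ≤ θ := by
      rw [dist_eq_norm, show (1 - θ) • X.1 - X.1 = -(θ • X.1) by module, norm_neg, norm_smul, Real.norm_eq_abs, abs_of_pos hθ]
      nlinarith
    linarith [dist_triangle Y.1 ((1 - θ) • X.1) X.1]
  · rw [Real.dist_eq, abs_lt]
    constructor <;> nlinarith

theorem Qt_fin (n : ℕ) (τ : ℝ) : volume (Qt n τ) < ⊤ := by
  unfold Qt
  rw [Measure.volume_eq_prod, Measure.prod_prod]
  exact ENNReal.mul_lt_top measure_ball_lt_top (by simp)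

theorem Qt_open (n : ℕ) (τ : ℝ) : IsOpen (Qt n τ) := isOpen_ball.prod isOpen_Ioo

theorem Qh_arith {c1 k u d f m : ℝ} (hc1 : 0 < c1) (hc2 : c1 ≤ 1) (hm : m = 2 / c1) (hk : k ≤ u - d) (hd : c1 * u ≤ d)
    (hu : 0 ≤ u) (hf : m * u ≤ (m + 1) * f) : (1 + c1 / 2) * k ≤ f := by
  have h1 : 2 * u ≤ (2 + c1) * f := by
    have e1 : c1 * (m * u) = 2 * u := by rw [hm]; field_simp
    have e2 : c1 * ((m + 1) * f) = (2 + c1) * f := by rw [hm]; field_simp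
    rw [← e1, ← e2]
    exact mul_le_mul_of_nonneg_left hf hc1.le
  have h2 : k ≤ (1 - c1) * u := by linarith
  have h3 : (1 + c1 / 2) * k ≤ (1 + c1 / 2) * ((1 - c1) * u) := mul_le_mul_of_nonneg_left h2 (by linarith)
  have h4 : 0 ≤ (2 + c1) * f := by linarith
  have h5 : (1 + c1 / 2) * ((1 - c1) * u) ≤ (1 + c1 / 2) * (1 - c1) * (1 + c1 / 2) * f := by
    have := mul_le_mul_of_nonneg_left h1 (show 0 ≤ (1 + c1 / 2) * (1 - c1) by
      apply mul_nonneg <;> linarith)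
    nlinarith
  have hf0 : 0 ≤ f := by
    by_contra hh
    push Not at hh
    nlinarith
  have h6 : (1 + c1 / 2) * (1 - c1) * (1 + c1 / 2) ≤ 1 := by nlinarith [sq_nonneg c1, pow_pos hc1 3]
  nlinarith [mul_le_mul_of_nonneg_right h6 hf0]

theorem step_cov {τ ε c1 m c : ℝ} {δ : ℝ≥0∞} {v : En n × ℝ → ℝ} {θ : En n × ℝ → ℝ} {E : Set (En n × ℝ)}
    (hτ1 : -3 / 4 ≤ τ) (hτ2 : τ + ε ≤ -1 / 2) (hε : 0 < ε) (hc1 : 0 < c1) (hc2 : c1 ≤ 1)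
    (hδt : δ ≠ ⊤) (hcδ : c1 * (volume (ball (0 : En n) 5) * ENNReal.ofReal 18).toReal ≤ δ.toReal) (hm : m = 2 / c1) (hE : IsOpen E) (hEQ : E ⊆ Qt n τ)
    (hθ : ∀ X ∈ E, 0 < θ X) (hθ1 : ∀ X ∈ E, 2 * θ X ≤ 1)
    (hbad : ∀ X ∈ E, ENNReal.ofReal ((2 * θ X / 2) ^ (n + 2)) * δ ≤ volume (Qh τ X (2 * θ X) \ E))
    (hF : ∀ X ∈ E, ∀ x1 : En n, ∀ t1 : ℝ, x1 ∈ ball ((1 - 2 * θ X) • X.1) (2 * θ X / 2) →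
      X.2 - (2 * θ X) ^ 2 * (X.2 + 1) + 4 * (1 + τ) * (2 * θ X / 2) ^ 2 ≤ t1 →
      t1 < X.2 - (2 * θ X) ^ 2 * (X.2 + 1) + 4 * (1 + τ) * (2 * θ X / 2) ^ 2 + m * (4 * (1 + τ) * (2 * θ X / 2) ^ 2) →
      t1 < τ + ε ∧ c ≤ v (x1, t1)) :
    ENNReal.ofReal (1 + c1 / 2) * volume E ≤ volume {X ∈ Qt n (τ + ε) | c ≤ v X} := by
  classical
  rw [hE.measure_eq_iSup_isCompact]
  simp only [ENNReal.mul_iSup]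
  refine iSup_le fun K => iSup_le fun hKE => iSup_le fun hK => ?_
  obtain ⟨t, ht, hcov⟩ := hK.elim_nhds_subcover (fun X => if X ∈ E then Qh τ X (2 * θ X) else univ) (fun X hX => by
    have hX' := hKE hX
    simp only [hX', if_true]
    exact (Qh_open _ _ _).mem_nhds (Qh_self (hEQ hX') (by linarith [hθ X hX'])))
  have htE : ∀ X ∈ t, X ∈ E := fun X hX => hKE (ht X hX)
  set z : En n × ℝ → En n := fun X => (1 - 2 * θ X) • X.1 with hz
  set ρ : En n × ℝ → ℝ := fun X => 2 * θ X / 2 with hρ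
  set a : En n × ℝ → ℝ := fun X => X.2 - (2 * θ X) ^ 2 * (X.2 + 1) with ha
  set κ : ℝ := 4 * (1 + τ) with hκ
  have hκ0 : 0 < κ := by rw [hκ]; linarith
  have hρ0 : ∀ X ∈ t, 0 < ρ X := fun X hX => by have := hθ X (htE X hX); simp only [hρ]; linarith
  have hV := vitcov t z ρ a (κ := κ) hκ0 (by rw [hκ]; linarith) hρ0 hE.measurableSet (δ := δ)
    (fun X hX => hbad X (htE X hX))
  set U := ⋃ i ∈ t, ball (z i) (ρ i) ×ˢ Ioo (a i) (a i + κ * ρ i ^ 2) with hU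
  have hm0 : 0 < m := by rw [hm]; positivity
  have hSt := stackN hm0.le t (fun X => ball (z X) (ρ X)) (fun X => measurableSet_ball) a (fun X => a X + κ * ρ X ^ 2)
    (fun X hX => by have := hρ0 X hX; have : 0 < κ * ρ X ^ 2 := by positivity
                    linarith)
  set F := ⋃ i ∈ t, ball (z i) (ρ i) ×ˢ Ico (a i + κ * ρ i ^ 2) (a i + κ * ρ i ^ 2 + m * (a i + κ * ρ i ^ 2 - a i)) with hFd
  set G := {X ∈ Qt n (τ + ε) | c ≤ v X} with hG
  have hUQ : U ⊆ Qt n τ := by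
    refine iUnion₂_subset fun X hX => ?_
    exact Qh_sub (hEQ (htE X hX)) (by linarith [hθ X (htE X hX)]) (hθ1 X (htE X hX))
  have hKU : K ⊆ U := by
    intro X hX
    have := hcov hX
    obtain ⟨i, hi, h1⟩ := mem_iUnion₂.mp this
    rw [if_pos (htE i hi)] at h1
    exact mem_iUnion₂.mpr ⟨i, hi, h1⟩
  have hFG : F ⊆ G := by
    refine iUnion₂_subset fun X hX => ?_
    rintro ⟨x1, t1⟩ ⟨h1, h2, h3⟩
    have hXE := htE X hX
    have h3' : t1 < a X + κ * ρ X ^ 2 + m * (κ * ρ X ^ 2) := by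
      have e : a X + κ * ρ X ^ 2 - a X = κ * ρ X ^ 2 := by ring
      rw [e] at h3
      exact h3
    have h4 := hF X hXE x1 t1 h1 h2 h3'
    refine ⟨⟨Qh_ball (hEQ hXE) (hθ1 X hXE) h1, ?_, h4.1⟩, h4.2⟩
    have h5 : 0 < κ * ρ X ^ 2 := by have := hρ0 X hX; positivity
    have h6 : -1 ≤ a X := by
      have e1 := (hEQ hXE).2.1
      have e2 := hθ X hXE
      have e3 := hθ1 X hXE
      have e4 : (2 * θ X) ^ 2 ≤ 1 := by nlinarith
      simp only [ha]; nlinarith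
    have h7 : a X + κ * ρ X ^ 2 ≤ t1 := h2
    show -1 < t1
    linarith
  have hGfin : volume G ≠ ⊤ := ((measure_mono (show G ⊆ Qt n (τ + ε) from fun X h => h.1)).trans_lt (Qt_fin n (τ + ε))).ne
  have hUfin : volume U ≠ ⊤ := ((measure_mono hUQ).trans_lt (Qt_fin n τ)).ne
  have hUEfin : volume (U \ E) ≠ ⊤ := ((measure_mono (diff_subset)).trans_lt hUfin.lt_top).ne
  have hKfin : volume K ≠ ⊤ := ((measure_mono hKU).trans_lt hUfin.lt_top).ne
  have hK5 : volume (ball (0 : En n) 5) * ENNReal.ofReal 18 ≠ ⊤ := ENNReal.mul_ne_top measure_ball_lt_top.ne ENNReal.ofReal_ne_top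
  have hK5p : 0 < (volume (ball (0 : En n) 5) * ENNReal.ofReal 18).toReal := by
    refine ENNReal.toReal_pos (mul_ne_zero (measure_ball_pos _ _ (by norm_num)).ne' (by simp)) hK5
  set K5 := volume (ball (0 : En n) 5) * ENNReal.ofReal 18 with hK5d
  have hV' : δ.toReal * (volume U).toReal ≤ K5.toReal * (volume (U \ E)).toReal := by
    rw [← ENNReal.toReal_mul, ← ENNReal.toReal_mul]
    exact ENNReal.toReal_mono (ENNReal.mul_ne_top hK5 hUEfin) hV
  have hd : c1 * (volume U).toReal ≤ (volume (U \ E)).toReal := by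
    have h1 := mul_le_mul_of_nonneg_right hcδ (ENNReal.toReal_nonneg (a := volume U))
    have h2 : K5.toReal * (c1 * (volume U).toReal) ≤ K5.toReal * (volume (U \ E)).toReal := by linarith
    exact le_of_mul_le_mul_left h2 hK5p
  have hk : (volume K).toReal ≤ (volume U).toReal - (volume (U \ E)).toReal := by
    have h1 : volume K + volume (U \ E) ≤ volume U := by
      rw [← measure_inter_add_diff U hE.measurableSet]
      gcongr
      exact subset_inter hKU hKE
    have h2 := ENNReal.toReal_mono hUfin h1
    rw [ENNReal.toReal_add hKfin hUEfin] at h2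
    linarith
  have hf : m * (volume U).toReal ≤ (m + 1) * (volume G).toReal := by
    have h1 : ENNReal.ofReal m * volume U ≤ ENNReal.ofReal (m + 1) * volume G := by
      refine le_trans ?_ (hSt.trans ?_)
      · gcongr
        exact iUnion₂_mono fun i hi => prod_mono_right Ioo_subset_Ico_self
      · gcongr
    have h2 := ENNReal.toReal_mono (ENNReal.mul_ne_top ENNReal.ofReal_ne_top hGfin) h1
    rwa [ENNReal.toReal_mul, ENNReal.toReal_mul, ENNReal.toReal_ofReal hm0.le, ENNReal.toReal_ofReal (by linarith)] at h2
  have hfin := Qh_arith hc1 hc2 hm hk hd ENNReal.toReal_nonneg hf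
  rw [← ENNReal.toReal_le_toReal (ENNReal.mul_ne_top ENNReal.ofReal_ne_top hKfin) hGfin, ENNReal.toReal_mul,
    ENNReal.toReal_ofReal (by linarith)]
  exact hfin

set_option maxHeartbeats 2000000 in
theorem step (hn : 0 < n) {ν : ℝ} (hν : 1 ≤ ν) {S : ℝ≥0∞} (hSt : S ≠ ⊤) : ∃ c2 : ℝ, 0 < c2 ∧ ∀ ε : ℝ, 0 < ε → ∃ c : ℝ, 0 < c ∧ c ≤ 1 ∧
    ∀ (h : En n → ℝ≥0∞) (v : En n × ℝ → ℝ), Measurable h → SSE ν h v (ball 0 1 ×ˢ Ioo (-1) 0) →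
    (∀ X ∈ ball (0 : En n) 1 ×ˢ Ioo (-1 : ℝ) 0, 0 ≤ v X) → hmass h univ ≤ S →
    ∀ τ : ℝ, -3 / 4 ≤ τ → τ + ε ≤ -1 / 2 →
    (∀ X ∈ ball (0 : En n) (1 / 2) ×ˢ Ioo (-1 / 4 : ℝ) 0, c ≤ v X) ∨
      ENNReal.ofReal (1 + c2) * volume {X ∈ Qt n τ | 1 ≤ v X} ≤ volume {X ∈ Qt n (τ + ε) | c ≤ v X} := by
  obtain ⟨δ0, hδ0, hM⟩ := lemM_sc (n := n) hn hν hSt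
  set δ : ℝ≥0∞ := min δ0 1 with hδ
  have hδp : 0 < δ := lt_min hδ0 one_pos
  have hδt : δ ≠ ⊤ := ((min_le_right _ _).trans_lt ENNReal.one_lt_top).ne
  have hδr : 0 < δ.toReal := ENNReal.toReal_pos hδp.ne' hδt
  have hK5 : volume (ball (0 : En n) 5) * ENNReal.ofReal 18 ≠ ⊤ := ENNReal.mul_ne_top measure_ball_lt_top.ne ENNReal.ofReal_ne_top
  have hK5p : 0 < (volume (ball (0 : En n) 5) * ENNReal.ofReal 18).toReal := by
    refine ENNReal.toReal_pos (mul_ne_zero (measure_ball_pos _ _ (by norm_num)).ne' (by simp)) hK5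
  set K5 := (volume (ball (0 : En n) 5) * ENNReal.ofReal 18).toReal with hK5d
  set c1 : ℝ := min (δ.toReal / K5) 1 with hc1d
  have hc1 : 0 < c1 := lt_min (div_pos hδr hK5p) one_pos
  have hc11 : c1 ≤ 1 := min_le_right _ _
  have hcδ : c1 * K5 ≤ δ.toReal := by
    have : c1 ≤ δ.toReal / K5 := min_le_left _ _
    rwa [le_div_iff₀ hK5p] at this
  refine ⟨c1 / 2, by positivity, fun ε hε => ?_⟩
  obtain ⟨m, hm⟩ : ∃ m, m = 2 / c1 := ⟨_, rfl⟩
  have hm0 : 0 < m := by rw [hm]; positivity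
  obtain ⟨θ0, hθ0d⟩ : ∃ θ0, θ0 = min 1 (ε / (2 * m)) := ⟨_, rfl⟩
  have hθ0 : 0 < θ0 := by rw [hθ0d]; exact lt_min one_pos (by positivity)
  have hθ01 : θ0 ≤ 1 := by rw [hθ0d]; exact min_le_left _ _
  have hθ0m : 2 * m * θ0 ≤ ε := by
    have : θ0 ≤ ε / (2 * m) := by rw [hθ0d]; exact min_le_right _ _
    rw [le_div_iff₀ (by positivity)] at this
    linarith
  obtain ⟨L, hL⟩ : ∃ L, L = 4 / θ0 ^ 2 + 6 + 8 * m := ⟨_, rfl⟩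
  have hL4 : 4 ≤ L * θ0 ^ 2 := by
    have : L * θ0 ^ 2 = 4 + (6 + 8 * m) * θ0 ^ 2 := by rw [hL]; field_simp; ring
    rw [this]
    have : 0 ≤ (6 + 8 * m) * θ0 ^ 2 := by positivity
    linarith
  have hL6 : 6 + 8 * m ≤ L := by
    have : 0 ≤ 4 / θ0 ^ 2 := by positivity
    linarith
  have hL0 : 0 ≤ L := by linarith
  obtain ⟨c, hc, hcl, hM⟩ := hM L hL0
  refine ⟨1 / 2 * c, by positivity, by linarith, fun h v hh hS hv hmS τ hτ1 hτ2 => ?_⟩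
  have hM := hM h v hh hS hv hmS
  have hQD : Qt n τ ⊆ ball (0 : En n) 1 ×ˢ Ioo (-1 : ℝ) 0 := by
    rintro X ⟨h1, h2, h3⟩
    exact ⟨ball_subset_ball (by norm_num) h1, h2, by linarith⟩
  set E : Set (En n × ℝ) := Qt n τ ∩ v ⁻¹' Ioi (1 / 2) with hEd
  have hE : IsOpen E := by
    obtain ⟨vt, g, H, hS⟩ := hS
    exact (hS.cv.mono hQD).isOpen_inter_preimage (Qt_open n τ) isOpen_Ioi
  have hEQ : E ⊆ Qt n τ := inter_subset_left
  -- use of lemM at a good cylinder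
  have key : ∀ X ∈ E, ∀ θ : ℝ, 0 < θ → θ ≤ 1 →
      volume (Qh τ X θ \ E) ≤ ENNReal.ofReal ((θ / 2) ^ (n + 2)) * δ → ∀ x1 : En n, ∀ t1 : ℝ, ‖x1‖ ≤ 1 / 2 →
      X.2 - θ ^ 2 * (X.2 + 1) + 4 * (1 + τ) * (θ / 2) ^ 2 ≤ t1 → t1 < 0 →
      ‖x1 - (1 - θ) • X.1‖ ≤ L * (θ / 2) → t1 - (X.2 - θ ^ 2 * (X.2 + 1) + 4 * (1 + τ) * (θ / 2) ^ 2) ≤ L * (θ / 2) ^ 2 →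
      1 / 2 * c ≤ v (x1, t1) := by
    intro X hX θ hθ hθ1 hg x1 t1 hx1 ht1 ht0 hd1 hd2
    have hXQ := hEQ hX
    have h2 : θ ^ 2 ≤ 1 := by nlinarith
    have hκ : 1 ≤ 4 * (1 + τ) := by linarith
    have hX2 := hXQ.2.1
    have h3 : (θ / 2) ^ 2 ≤ 4 * (1 + τ) * (θ / 2) ^ 2 := le_mul_of_one_le_left (by positivity) hκ
    refine hM ((1 - θ) • X.1) x1 _ t1 (θ / 2) (1 / 2) (by norm_num) (by linarith) (by linarith)
      ((Qh_ctr hXQ hθ1).trans (by linarith)) hx1 ?_ ht1 ht0 hd1 hd2 ?_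
    · nlinarith
    · refine (measure_mono ?_).trans (hg.trans (by gcongr; exact min_le_left _ _))
      rintro Z ⟨⟨h4, h5, h6⟩, h7⟩
      have h7' : v Z < 1 / 2 := h7
      refine ⟨⟨h4, by linarith, h6⟩, fun h8 => ?_⟩
      have : 1 / 2 < v Z := h8.2
      linarith
  by_cases hbig : ∃ X ∈ E, ∃ θ : ℝ, θ0 ≤ θ ∧ θ ≤ 1 ∧ volume (Qh τ X θ \ E) ≤ ENNReal.ofReal ((θ / 2) ^ (n + 2)) * δ
  · left
    obtain ⟨X, hX, θ, hθa, hθb, hg⟩ := hbig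
    rintro ⟨x1, t1⟩ ⟨hx1, ht1, ht1'⟩
    have hXQ := hEQ hX
    have hθ : 0 < θ := hθ0.trans_le hθa
    have hx1' : ‖x1‖ < 1 / 2 := by simpa using hx1
    have ha : -1 / 4 < t1 := ht1
    have h2 : θ ^ 2 ≤ 1 := by nlinarith
    have hX2 := hXQ.2.1
    have hX3 := hXQ.2.2
    have e0 : X.2 - θ ^ 2 * (X.2 + 1) + 4 * (1 + τ) * (θ / 2) ^ 2 = X.2 + θ ^ 2 * (τ - X.2) := by ring
    have e1 : 0 ≤ θ ^ 2 * (τ - X.2) := mul_nonneg (sq_nonneg _) (by linarith)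
    have e2 : θ ^ 2 * (τ - X.2) ≤ τ - X.2 := by nlinarith
    have e3 : θ0 ^ 2 ≤ θ ^ 2 := by gcongr
    have e4 : 4 ≤ L * θ ^ 2 := hL4.trans (by gcongr)
    have e5 : 4 ≤ L * θ := e4.trans (by gcongr; nlinarith)
    refine key X hX θ hθ hθb hg x1 t1 hx1'.le ?_ ht1' ?_ ?_
    · rw [e0]; linarith
    · have := norm_sub_le x1 ((1 - θ) • X.1)
      have := Qh_ctr hXQ hθb
      linarith
    · rw [e0]
      have : t1 < 0 := ht1'
      nlinarith
  · right
    have hbig' : ∀ X ∈ E, ∀ θ : ℝ, θ0 ≤ θ → θ ≤ 1 → ¬ (volume (Qh τ X θ \ E) ≤ ENNReal.ofReal ((θ / 2) ^ (n + 2)) * δ) :=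
      fun X hX θ h1 h2 h3 => hbig ⟨X, hX, θ, h1, h2, h3⟩
    have hex : ∀ X ∈ E, ∃ θ : ℝ, 0 < θ ∧ θ < θ0 ∧ 2 * θ ≤ 1 ∧
        volume (Qh τ X θ \ E) ≤ ENNReal.ofReal ((θ / 2) ^ (n + 2)) * δ ∧
        ENNReal.ofReal ((2 * θ / 2) ^ (n + 2)) * δ ≤ volume (Qh τ X (2 * θ) \ E) := by
      intro X hX
      have hex : ∃ k : ℕ, volume (Qh τ X ((1 / 2 : ℝ) ^ k) \ E) ≤ ENNReal.ofReal (((1 / 2 : ℝ) ^ k / 2) ^ (n + 2)) * δ := by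
        obtain ⟨η, hη, hηE⟩ := Metric.isOpen_iff.mp hE X hX
        obtain ⟨k, hk⟩ := exists_pow_lt_of_lt_one (show 0 < η / 2 by linarith) (show (1 / 2 : ℝ) < 1 by norm_num)
        refine ⟨k, ?_⟩
        have h1 : Qh τ X ((1 / 2 : ℝ) ^ k) ⊆ E :=
          (Qh_small (by linarith) (hEQ hX) (by positivity) (pow_le_one₀ (by norm_num) (by norm_num))).trans
            ((ball_subset_ball (by linarith)).trans hηE)
        rw [sdiff_eq_empty.mpr h1]
        simp
      classical
      have hk1 := Nat.find_spec hex
      have hk2 : ∀ j < Nat.find hex, _ := fun j hj => Nat.find_min hex hj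
      set k := Nat.find hex with hk
      have hlt : (1 / 2 : ℝ) ^ k < θ0 := by
        by_contra hcon
        exact hbig' X hX _ (not_lt.mp hcon) (pow_le_one₀ (by norm_num) (by norm_num)) hk1
      have hkp : k ≠ 0 := by
        intro h0
        rw [h0, pow_zero] at hlt
        linarith
      obtain ⟨j, hj⟩ := Nat.exists_eq_succ_of_ne_zero hkp
      have e : 2 * (1 / 2 : ℝ) ^ k = (1 / 2) ^ j := by rw [hj, pow_succ]; ring
      refine ⟨(1 / 2) ^ k, by positivity, hlt, ?_, hk1, ?_⟩
      · rw [e]; exact pow_le_one₀ (by norm_num) (by norm_num)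
      · rw [e]
        exact (not_le.mp (hk2 j (by omega))).le
    choose! θ hθa hθb hθc hgood hbad using hex
    refine le_trans ?_ (step_cov (c := 1 / 2 * c) (v := v) hτ1 hτ2 hε hc1 hc11 hδt hcδ hm hE hEQ hθa hθc hbad ?_)
    · gcongr
      rintro X ⟨h1, h2⟩
      have h2' : 1 ≤ v X := h2
      exact ⟨h1, show 1 / 2 < v X by linarith⟩
    · intro X hX x1 t1 hx1 ht1 ht1'
      have hXQ := hEQ hX
      have hX2 := hXQ.2.1
      have hX3 := hXQ.2.2
      have hθ := hθa X hX
      have hθl := hθb X hX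
      have hθh := hθc X hX
      have hxX := hXQ.1
      rw [mem_ball_zero_iff] at hxX
      have hx1n := Qh_ball hXQ hθh hx1
      rw [mem_ball_zero_iff] at hx1n
      have hg := hgood X hX
      generalize θ X = φ at *
      have e0 : X.2 - (2 * φ) ^ 2 * (X.2 + 1) + 4 * (1 + τ) * (2 * φ / 2) ^ 2 = X.2 + 4 * φ ^ 2 * (τ - X.2) := by ring
      have e1 : X.2 - φ ^ 2 * (X.2 + 1) + 4 * (1 + τ) * (φ / 2) ^ 2 = X.2 + φ ^ 2 * (τ - X.2) := by ring
      rw [e0] at ht1 ht1'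
      have e2 : 0 ≤ φ ^ 2 * (τ - X.2) := mul_nonneg (sq_nonneg _) (by linarith)
      have e3 : 4 * φ ^ 2 ≤ 1 := by nlinarith
      have e4 : m * (4 * (1 + τ) * (2 * φ / 2) ^ 2) ≤ 2 * m * φ ^ 2 := by
        have : 4 * (1 + τ) ≤ 2 := by linarith
        have h5 : 0 ≤ m * φ ^ 2 := by positivity
        nlinarith
      have e5 : 2 * m * φ ^ 2 ≤ ε := by
        have h5 : φ ^ 2 ≤ θ0 := by nlinarith
        have : 2 * m * φ ^ 2 ≤ 2 * m * θ0 := by gcongr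
        linarith
      have e6 : 4 * φ ^ 2 * (τ - X.2) ≤ τ - X.2 := by nlinarith
      have ht : t1 < τ + ε := by linarith
      refine ⟨ht, key X hX φ hθ (by linarith) hg x1 t1 hx1n.le ?_ (by linarith) ?_ ?_⟩
      · rw [e1]; linarith
      · rw [mem_ball, dist_eq_norm] at hx1
        have h6 : x1 - (1 - φ) • X.1 = (x1 - (1 - 2 * φ) • X.1) - φ • X.1 := by module
        rw [h6]
        have h7 := norm_sub_le (x1 - (1 - 2 * φ) • X.1) (φ • X.1)
        rw [norm_smul, Real.norm_eq_abs, abs_of_pos hθ] at h7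
        have h8 : φ * ‖X.1‖ ≤ φ * (1 / 2) := by gcongr
        have h9 : 6 * (φ / 2) ≤ L * (φ / 2) := by gcongr; linarith
        linarith
      · rw [e1]
        have h8 : φ ^ 2 * (τ - X.2) ≤ φ ^ 2 * (1 / 2) := by gcongr; linarith
        have h9 : (6 + 8 * m) * (φ / 2) ^ 2 ≤ L * (φ / 2) ^ 2 := by gcongr
        nlinarith

theorem SSE.smul {ν : ℝ} {h : En n → ℝ≥0∞} {v : En n × ℝ → ℝ} {D : Set (En n × ℝ)} (hS : SSE ν h v D) {κ : ℝ} (hκ : 0 < κ) :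
    SSE ν h (fun X => κ * v X) D := by
  have h1 := hS.scale 0 0 one_pos hκ
  have e1 : hsc 0 1 h = h := by funext x; simp [hsc]
  have e2 : ∀ X : En n × ℝ, Tm 0 0 1 X = X := by intro X; simp [Tm]
  have e3 : Tm 0 0 1 ⁻¹' D = D := by ext X; simp [e2]
  simp only [e1, e2, e3] at h1
  exact h1

theorem iter (hn : 0 < n) {ν : ℝ} (hν : 1 ≤ ν) {S : ℝ≥0∞} (hSt : S ≠ ⊤) {σ : ℝ≥0∞} (hσ : 0 < σ) : ∃ c : ℝ, 0 < c ∧ c ≤ 1 ∧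
    ∀ (h : En n → ℝ≥0∞) (v : En n × ℝ → ℝ), Measurable h → SSE ν h v (ball 0 1 ×ˢ Ioo (-1) 0) →
    (∀ X ∈ ball (0 : En n) 1 ×ˢ Ioo (-1 : ℝ) 0, 0 ≤ v X) → hmass h univ ≤ S →
    σ ≤ volume {X ∈ Qt n (-3 / 4) | 1 ≤ v X} →
    ∀ X ∈ ball (0 : En n) (1 / 2) ×ˢ Ioo (-1 / 4 : ℝ) 0, c ≤ v X := by
  obtain ⟨c2, hc2, hst⟩ := step (n := n) hn hν hSt
  obtain ⟨J, hJ1, hJ⟩ : ∃ J : ℕ, 1 ≤ J ∧ volume (Qt n (-1 / 2)) < ENNReal.ofReal (1 + c2) ^ J * σ := by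
    have h1 : Filter.Tendsto (fun J : ℕ => ENNReal.ofReal (1 + c2) ^ J) Filter.atTop (nhds ⊤) := by
      refine ENNReal.tendsto_pow_atTop_nhds_top_iff.mpr ?_
      rw [← ENNReal.ofReal_one]
      exact (ENNReal.ofReal_lt_ofReal_iff (by linarith)).mpr (by linarith)
    have h2 : Filter.Tendsto (fun J : ℕ => ENNReal.ofReal (1 + c2) ^ J * σ) Filter.atTop (nhds (⊤ * σ)) :=
      ENNReal.Tendsto.mul_const h1 (Or.inl ENNReal.top_ne_zero)
    rw [ENNReal.top_mul hσ.ne'] at h2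
    obtain ⟨J, h3, h4⟩ := ((h2.eventually (lt_mem_nhds (Qt_fin n (-1 / 2)))).and (Filter.eventually_ge_atTop 1)).exists
    exact ⟨J, h4, h3⟩
  have hJp : (0 : ℝ) < J := by exact_mod_cast hJ1
  obtain ⟨c, hc, hcl, hst⟩ := hst (1 / (4 * J)) (by positivity)
  refine ⟨c ^ J, by positivity, pow_le_one₀ hc.le hcl, fun h v hh hS hv hmS hσv => ?_⟩
  have hind : ∀ i : ℕ, i ≤ J → (∀ X ∈ ball (0 : En n) (1 / 2) ×ˢ Ioo (-1 / 4 : ℝ) 0, c ^ i ≤ v X) ∨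
      ENNReal.ofReal (1 + c2) ^ i * σ ≤ volume {X ∈ Qt n (-3 / 4 + i * (1 / (4 * J))) | c ^ i ≤ v X} := by
    intro i
    induction i with
    | zero => intro _; right; simpa using hσv
    | succ i ih =>
      intro hi
      have hiJ : ((i : ℝ) + 1) ≤ J := by exact_mod_cast hi
      have hci : 0 < c ^ i := by positivity
      rcases ih (by omega) with h1 | h1
      · left
        intro X hX
        refine le_trans ?_ (h1 X hX)
        exact pow_le_pow_of_le_one hc.le hcl (by omega)
      · have hτ2 : -3 / 4 + (i : ℝ) * (1 / (4 * J)) + 1 / (4 * J) ≤ -1 / 2 := by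
          have : ((i : ℝ) + 1) * (1 / (4 * J)) ≤ J * (1 / (4 * J)) := by gcongr
          have e : (J : ℝ) * (1 / (4 * J)) = 1 / 4 := by field_simp
          linarith
        have h2 := hst h (fun X => (c ^ i)⁻¹ * v X) hh (hS.smul (inv_pos.mpr hci))
          (fun X hX => mul_nonneg (inv_pos.mpr hci).le (hv X hX)) hmS (-3 / 4 + i * (1 / (4 * J)))
          (by have : (0 : ℝ) ≤ i * (1 / (4 * J)) := by positivity
              linarith) hτ2
        have e1 : ∀ X, (1 ≤ (c ^ i)⁻¹ * v X) ↔ c ^ i ≤ v X := fun X => by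
          rw [inv_mul_eq_div, le_div_iff₀ hci, one_mul]
        have e2 : ∀ X, (c ≤ (c ^ i)⁻¹ * v X) ↔ c ^ (i + 1) ≤ v X := fun X => by
          rw [inv_mul_eq_div, le_div_iff₀ hci, pow_succ, mul_comm]
        simp only [e1, e2] at h2
        rcases h2 with h2 | h2
        · left; exact h2
        · right
          have e3 : -3 / 4 + ((i + 1 : ℕ) : ℝ) * (1 / (4 * J)) = -3 / 4 + i * (1 / (4 * J)) + 1 / (4 * J) := by
            push_cast; ring
          rw [e3, pow_succ, mul_comm (ENNReal.ofReal (1 + c2) ^ i), mul_assoc]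
          exact le_trans (by gcongr) h2
  rcases hind J le_rfl with h1 | h1
  · exact h1
  · exfalso
    have e : -3 / 4 + (J : ℝ) * (1 / (4 * J)) = -1 / 2 := by field_simp; norm_num
    rw [e] at h1
    exact absurd (h1.trans (measure_mono (fun X hX => hX.1))) (not_le.mpr hJ)

theorem lin_exp {F : Type*} [NormedAddCommGroup F] [NormedSpace ℝ F] (f : En n →L[ℝ] F) (w : En n) :
    f w = ∑ i, w i • f (EuclideanSpace.single i 1) := by
  conv_lhs => rw [← (EuclideanSpace.basisFun (Fin n) ℝ).sum_repr w]
  simp [map_sum]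

theorem Dxx_symm {v : En n × ℝ → ℝ} {Q : Set (En n × ℝ)} (hQ : IsOpen Q) (hC : IsC21 v Q) {X : En n × ℝ} (hX : X ∈ Q)
    (i j : Fin n) : Dxx v i j X = Dxx v j i X := by
  have hev : ∀ᶠ y in nhds X.1, (y, X.2) ∈ Q := by
    have hc : Continuous fun y : En n => (y, X.2) := by fun_prop
    exact hc.continuousAt.eventually (hQ.mem_nhds hX)
  have h1 : ∀ᶠ y in nhds X.1, HasFDerivAt (fun x => v (x, X.2))
      (∑ k, (Dx v k (y, X.2)) • (EuclideanSpace.proj k : En n →L[ℝ] ℝ)) y := by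
    filter_upwards [hev] with y hy
    have h2 := (hC.diff_x _ hy).hasFDerivAt
    convert h2 using 1
    ext w
    rw [lin_exp (fderiv ℝ (fun x => v (x, X.2)) y) w]
    simp [Dx, mul_comm]
  have h2 : HasFDerivAt (fun y => ∑ k, (Dx v k (y, X.2)) • (EuclideanSpace.proj k : En n →L[ℝ] ℝ))
      (∑ k, (fderiv ℝ (fun x => Dx v k (x, X.2)) X.1).smulRight (EuclideanSpace.proj k : En n →L[ℝ] ℝ)) X.1 := by
    refine HasFDerivAt.fun_sum fun k _ => ?_
    exact HasFDerivAt.smul_const (hC.diff_xx k X hX).hasFDerivAt (EuclideanSpace.proj k : En n →L[ℝ] ℝ)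
  have h3 := second_derivative_symmetric_of_eventually h1 h2 (EuclideanSpace.single i 1) (EuclideanSpace.single j 1)
  simpa [ContinuousLinearMap.sum_apply, EuclideanSpace.single_apply, Dxx, Dx] using h3

theorem Ell_entry {ν : ℝ} (hν : 1 ≤ ν) {a : Matrix (Fin n) (Fin n) ℝ} (ha : a ∈ Ell n ν) (i j : Fin n) : |a i j| ≤ ν := by
  have h1 : a i j ^ 2 ≤ ν ^ 2 := by
    refine le_trans ?_ ha.2
    refine le_trans ?_ (Finset.single_le_sum (f := fun i => ∑ j, a i j ^ 2) (fun i _ => Finset.sum_nonneg fun j _ => sq_nonneg _) (Finset.mem_univ i))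
    exact Finset.single_le_sum (f := fun j => a i j ^ 2) (fun j _ => sq_nonneg _) (Finset.mem_univ j)
  exact abs_le_of_sq_le_sq h1 (by linarith)

theorem tr2_diff {ν : ℝ} (hν : 1 ≤ ν) {a : Matrix (Fin n) (Fin n) ℝ} (ha : a ∈ Ell n ν) (M N : Matrix (Fin n) (Fin n) ℝ) :
    tr2 a N - ν * ∑ i, ∑ j, |M i j - N i j| ≤ tr2 a M := by
  have h1 : tr2 a N - tr2 a M ≤ ν * ∑ i, ∑ j, |M i j - N i j| := by
    simp only [tr2, ← Finset.sum_sub_distrib, Finset.mul_sum]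
    refine Finset.sum_le_sum fun i _ => Finset.sum_le_sum fun j _ => ?_
    rw [← mul_sub]
    refine (le_abs_self _).trans ?_
    rw [abs_mul, abs_sub_comm]
    gcongr
    exact Ell_entry hν ha i j
  linarith

theorem to_SSE {ν : ℝ} (hν : 1 ≤ ν) {v : En n × ℝ → ℝ} {a : En n × ℝ → Matrix (Fin n) (Fin n) ℝ} {b : En n × ℝ → En n}
    {Q : Set (En n × ℝ)} (hQ : IsOpen Q) (hC : IsC21 v Q) (ha : UnifParabolic ν a Q)
    (hL : ∀ X ∈ Q, -Dt v X + Lop a b v X ≤ 0) :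
    ∃ h : En n → ℝ≥0∞, Measurable h ∧ SSE ν h v Q ∧ hmass h univ ≤ LxnLtinfPow b Q := by
  set g : En n × ℝ → En n := fun X => WithLp.toLp 2 (fun i => Dx v i X) with hg
  set H : En n × ℝ → Matrix (Fin n) (Fin n) ℝ := fun X => Matrix.of (fun i j => Dxx v i j X) with hH
  have hgc : ContinuousOn g Q := by
    have : ContinuousOn (fun X => (fun i => Dx v i X)) Q := continuousOn_pi.mpr fun i => hC.cont_x i
    exact (PiLp.continuous_toLp 2 _).comp_continuousOn this
  have hHs : ∀ X ∈ Q, (H X).IsSymm := fun X hX => by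
    ext i j
    exact Dxx_symm hQ hC hX j i
  set O : ℝ → Set (En n × ℝ) := fun c => {X | X ∈ Q ∧ ∃ k : ℝ, (∀ A ∈ Ell n ν, k ≤ tr2 A (H X)) ∧ Dt v X + c * ‖g X‖ < k} with hO
  have hOo : ∀ c, IsOpen (O c) := by
    intro c
    rw [isOpen_iff_mem_nhds]
    rintro X0 ⟨hX0, k, hk, hlt⟩
    obtain ⟨η, hη⟩ : ∃ η, η = (k - (Dt v X0 + c * ‖g X0‖)) / 2 := ⟨_, rfl⟩
    have hηp : 0 < η := by rw [hη]; linarith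
    have hQn := hQ.mem_nhds hX0
    have h1 : ContinuousAt (fun X => Dt v X + c * ‖g X‖) X0 :=
      (hC.cont_t.continuousAt hQn).add (continuousAt_const.mul (hgc.continuousAt hQn).norm)
    have h2 : ContinuousAt (fun X => ν * ∑ i, ∑ j, |H X i j - H X0 i j|) X0 := by
      refine continuousAt_const.mul ?_
      refine tendsto_finsetSum _ fun i _ => tendsto_finsetSum _ fun j _ => ?_
      exact (((hC.cont_xx i j).continuousAt hQn).sub continuousAt_const).abs
    have h3 := h1.eventually (gt_mem_nhds (show Dt v X0 + c * ‖g X0‖ < k - η by rw [hη]; linarith))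
    have h4 := h2.eventually (gt_mem_nhds (show ν * ∑ i, ∑ j, |H X0 i j - H X0 i j| < η by simpa using hηp))
    filter_upwards [h3, h4, hQn] with X h3 h4 h5
    refine ⟨h5, k - η, fun A hA => ?_, h3⟩
    have := tr2_diff hν hA (H X) (H X0)
    have := hk A hA
    linarith
  set h : En n → ℝ≥0∞ := fun x => ⨆ c : ℝ, ⨆ _ : ∃ t, (x, t) ∈ O c, ENNReal.ofReal c with hh
  have hmeas : Measurable h := by
    refine LowerSemicontinuous.measurable (lowerSemicontinuous_iSup fun c => ?_)
    have ho : IsOpen {x : En n | ∃ t, (x, t) ∈ O c} := by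
      have : {x : En n | ∃ t, (x, t) ∈ O c} = Prod.fst '' (O c) := by
        ext x; simp
      rw [this]
      exact isOpenMap_fst _ (hOo c)
    classical
    have e : (fun x : En n => ⨆ _ : ∃ t, (x, t) ∈ O c, ENNReal.ofReal c) = {x : En n | ∃ t, (x, t) ∈ O c}.indicator (fun _ => ENNReal.ofReal c) := by
      funext x
      by_cases hx : ∃ t, (x, t) ∈ O c
      · rw [indicator_of_mem (by exact hx)]; simp only [hx, iSup_pos]
      · rw [indicator_of_notMem (by exact hx)]; simp only [hx, iSup_false]; rfl
    rw [e]
    exact ho.lowerSemicontinuous_indicator bot_le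
  refine ⟨h, hmeas, ⟨Dt v, g, H, hQ, hC.cont, hC.cont_t, hgc, ?_, ?_, ?_, hHs, ?_⟩, ?_⟩
  · exact fun X hX => (hC.diff_t X hX).hasDerivAt
  · intro X hX
    have h2 := (hC.diff_x X hX).hasFDerivAt
    have e : innerSL ℝ (g X) = fderiv ℝ (fun x => v (x, X.2)) X.1 := ?_
    · rw [e]; exact h2
    refine ContinuousLinearMap.ext fun w => ?_
    rw [lin_exp (fderiv ℝ (fun x => v (x, X.2)) X.1) w]
    simp [hg, PiLp.inner_apply, Dx]
  · intro X hX
    rw [← hasFDerivWithinAt_univ, hasFDerivWithinAt_euclidean]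
    intro i
    rw [hasFDerivWithinAt_univ]
    have h2 := (hC.diff_xx i X hX).hasFDerivAt
    have e : (PiLp.proj 2 (fun _ : Fin n => ℝ) i : En n →L[ℝ] ℝ).comp (mcl (H X)) = fderiv ℝ (fun x => Dx v i (x, X.2)) X.1 := ?_
    · rw [← e] at h2; exact h2
    refine ContinuousLinearMap.ext fun w => ?_
    rw [lin_exp (fderiv ℝ (fun x => Dx v i (x, X.2)) X.1) w]
    simp only [ContinuousLinearMap.comp_apply, PiLp.proj_apply, mcl_apply]
    refine Finset.sum_congr rfl fun j _ => ?_
    have := Dxx_symm hQ hC hX i j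
    simp only [hH, Matrix.of_apply, this, smul_eq_mul]
    exact mul_comm _ _
  · intro X hX c hc hxc k hk
    by_contra hcon
    push Not at hcon
    obtain ⟨c', hc', hc2⟩ : ∃ c', c < c' ∧ Dt v X + c' * ‖g X‖ < k := by
      obtain ⟨η, hη, h2⟩ : ∃ η : ℝ, 0 < η ∧ η * ‖g X‖ < k - (Dt v X + c * ‖g X‖) := by
        refine ⟨(k - (Dt v X + c * ‖g X‖)) / (‖g X‖ + 1), div_pos (by linarith) (by positivity), ?_⟩
        rw [div_mul_eq_mul_div, div_lt_iff₀ (by positivity)]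
        nlinarith [norm_nonneg (g X)]
      exact ⟨c + η, by linarith, by nlinarith⟩
    have h3 : ENNReal.ofReal c' ≤ h X.1 := by
      refine le_iSup_of_le c' (le_iSup_of_le ⟨X.2, hX, k, hk, hc2⟩ le_rfl)
    have h4 := h3.trans hxc
    rw [ENNReal.ofReal_le_ofReal_iff hc] at h4
    linarith
  · unfold hmass LxnLtinfPow
    rw [Measure.restrict_univ]
    refine lintegral_mono fun x => ?_
    refine pow_le_pow_left' ?_ n
    refine iSup_le fun c => iSup_le fun ⟨t0, ht0⟩ => ?_
    by_contra hcon
    push Not at hcon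
    have hae := ae_lt_of_essSup_lt hcon
    have ho : IsOpen {t : ℝ | (x, t) ∈ O c} := (hOo c).preimage (by fun_prop : Continuous fun t : ℝ => (x, t))
    have hpos : 0 < volume {t : ℝ | (x, t) ∈ O c} := ho.measure_pos volume ⟨t0, ht0⟩
    have hsub : {t : ℝ | (x, t) ∈ O c} ⊆ {t | (x, t) ∈ Q} := fun t ht => ht.1
    have h1 := ae_restrict_of_ae_restrict_of_subset hsub hae
    have h2 : ∀ᵐ t ∂volume.restrict {t : ℝ | (x, t) ∈ O c}, False := by
      filter_upwards [h1, ae_restrict_mem ho.measurableSet] with t h3 h4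
      obtain ⟨h5, k, h6, h7⟩ := h4
      have h8 := hL _ h5
      have h9 := h6 _ (ha _ h5)
      have h10 : tr2 (a (x, t)) (H (x, t)) = ∑ i, ∑ j, a (x, t) i j * Dxx v i j (x, t) := rfl
      have h11 : ∑ i, b (x, t) i * Dx v i (x, t) = ⟪g (x, t), b (x, t)⟫ := by
        simp [PiLp.inner_apply, hg]
      have h12 := neg_le_of_abs_le (abs_real_inner_le_norm (g (x, t)) (b (x, t)))
      have h13 : ‖b (x, t)‖ < c := by
        have h15 : ENNReal.ofReal ‖b (x, t)‖ < ENNReal.ofReal c := by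
          rw [ofReal_norm_eq_enorm]; exact h3
        exact (ENNReal.ofReal_lt_ofReal_iff_of_nonneg (norm_nonneg _)).mp h15
      have h14 : c * ‖g (x, t)‖ < ‖b (x, t)‖ * ‖g (x, t)‖ := by
        unfold Lop at h8
        rw [h11, ← h10] at h8
        linarith
      nlinarith [norm_nonneg (g (x, t))]
    have h16 := Filter.eventually_false_iff_eq_bot.mp h2
    rw [ae_eq_bot, Measure.restrict_eq_zero] at h16
    exact hpos.ne' h16

theorem Tm_mem {z : En n} {s r ρ p q : ℝ} (hr : 0 < r) (X : En n × ℝ) :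
    Tm z s r X ∈ ball z (r * ρ) ×ˢ Ioo (s + r ^ 2 * p) (s + r ^ 2 * q) ↔ X ∈ ball (0 : En n) ρ ×ˢ Ioo p q := by
  have h2 : 0 < r ^ 2 := by positivity
  simp only [Tm, mem_prod, mem_ball, mem_Ioo, dist_eq_norm, add_sub_cancel_left, sub_zero, norm_smul, Real.norm_eq_abs,
    abs_of_pos hr, add_lt_add_iff_left, mul_lt_mul_iff_right₀ hr, mul_lt_mul_iff_right₀ h2]

theorem Tm_surj {z : En n} {s r : ℝ} (hr : 0 < r) (X : En n × ℝ) : ∃ Z, Tm z s r Z = X := by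
  refine ⟨(r⁻¹ • (X.1 - z), (r ^ 2)⁻¹ * (X.2 - s)), ?_⟩
  ext1
  · simp [Tm, smul_smul, mul_inv_cancel₀ hr.ne']
  · simp only [Tm]
    field_simp
    ring

theorem IsC21.mono {v : En n × ℝ → ℝ} {Q Q' : Set (En n × ℝ)} (h : IsC21 v Q) (hQ : Q' ⊆ Q) : IsC21 v Q' where
  cont := h.cont.mono hQ
  diff_t X hX := h.diff_t X (hQ hX)
  diff_x X hX := h.diff_x X (hQ hX)
  diff_xx j X hX := h.diff_xx j X (hQ hX)
  cont_t := h.cont_t.mono hQ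
  cont_x i := (h.cont_x i).mono hQ
  cont_xx i j := (h.cont_xx i j).mono hQ

/-- **Quantitative lower bound from density of large values** (Corollary 5.5). -/
theorem lower_bound_from_density
    (n : ℕ) (hn : 0 < n) (ν S μ : ℝ) (hν : 1 ≤ ν) (hμ : μ < 1) :
    ∃ β : ℝ, 0 < β ∧ β < 1 ∧
      ∀ (Y : En n × ℝ) (r : ℝ) (v : En n × ℝ → ℝ)
        (a : En n × ℝ → Matrix (Fin n) (Fin n) ℝ) (b : En n × ℝ → En n),
        0 < r →
        IsC21 v (closure (pcyl Y r)) →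
        UnifParabolic ν a (pcyl Y r) →
        LxnLtinfPow b (pcyl Y r) ≤ ENNReal.ofReal S →
        (∀ X ∈ pcyl Y r, 0 ≤ v X) →
        (∀ X ∈ pcyl Y r, -Dt v X + Lop a b v X ≤ 0) →
        ENNReal.ofReal (1 - μ) * volume (pcyl (Y.1, Y.2 - 3 / 4 * r ^ 2) (r / 2)) <
          volume {X ∈ pcyl (Y.1, Y.2 - 3 / 4 * r ^ 2) (r / 2) | 1 ≤ v X} →
        ∀ X ∈ pcyl Y (r / 2), 1 - β ≤ v X := by
  have hσ : 0 < ENNReal.ofReal (1 - μ) * volume (Qt n (-3 / 4)) := by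
    refine ENNReal.mul_pos (by simpa using hμ) ?_
    refine ((Qt_open n (-3 / 4)).measure_pos volume ⟨(0, -7 / 8), ?_, ?_⟩).ne'
    · simp
    · constructor <;> norm_num
  obtain ⟨c, hc, hc1, hit⟩ := iter (n := n) hn hν (S := ENNReal.ofReal S) ENNReal.ofReal_ne_top hσ
  refine ⟨1 - c / 2, by linarith, by linarith, fun Y r v a b hr hC ha hb hv hL hdens => ?_⟩
  have hQo : ∀ (Z : En n × ℝ) (ρ : ℝ), IsOpen (pcyl Z ρ) := fun Z ρ => isOpen_ball.prod isOpen_Ioo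
  have e1 : ∀ X, Tm Y.1 Y.2 r X ∈ pcyl Y r ↔ X ∈ ball (0 : En n) 1 ×ˢ Ioo (-1 : ℝ) 0 := fun X => by
    rw [← Tm_mem (z := Y.1) (s := Y.2) hr X]
    unfold pcyl box
    rw [show r * 1 = r by ring, show Y.2 + r ^ 2 * -1 = Y.2 - r ^ 2 by ring, show Y.2 + r ^ 2 * 0 = Y.2 by ring]
  have e2 : ∀ X, Tm Y.1 Y.2 r X ∈ pcyl (Y.1, Y.2 - 3 / 4 * r ^ 2) (r / 2) ↔ X ∈ Qt n (-3 / 4) := fun X => by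
    unfold Qt
    rw [← Tm_mem (z := Y.1) (s := Y.2) hr X]
    unfold pcyl box
    rw [show r * (1 / 2) = r / 2 by ring, show Y.2 + r ^ 2 * -1 = Y.2 - 3 / 4 * r ^ 2 - (r / 2) ^ 2 by ring,
      show Y.2 + r ^ 2 * (-3 / 4) = Y.2 - 3 / 4 * r ^ 2 by ring]
  have e3 : ∀ X, Tm Y.1 Y.2 r X ∈ pcyl Y (r / 2) ↔ X ∈ ball (0 : En n) (1 / 2) ×ˢ Ioo (-1 / 4 : ℝ) 0 := fun X => by
    rw [← Tm_mem (z := Y.1) (s := Y.2) hr X]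
    unfold pcyl box
    rw [show r * (1 / 2) = r / 2 by ring, show Y.2 + r ^ 2 * (-1 / 4) = Y.2 - (r / 2) ^ 2 by ring,
      show Y.2 + r ^ 2 * 0 = Y.2 by ring]
  have hC' := hC.mono subset_closure
  obtain ⟨h, hh, hS, hmS⟩ := to_SSE hν (hQo Y r) hC' ha hL
  have hS' := (hS.scale Y.1 Y.2 hr one_pos).mono (D' := ball (0 : En n) 1 ×ˢ Ioo (-1 : ℝ) 0)
    (isOpen_ball.prod isOpen_Ioo) (fun X hX => (e1 X).mpr hX)
  have hm' : hmass (hsc Y.1 r h) univ ≤ ENNReal.ofReal S := by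
    have := hmass_scale hh Y.1 hr MeasurableSet.univ
    rw [preimage_univ] at this
    rw [this]
    exact hmS.trans hb
  set P := pcyl (Y.1, Y.2 - 3 / 4 * r ^ 2) (r / 2) with hP
  have hPo : IsOpen P := hQo _ _
  have hPQ : P ⊆ pcyl Y r := by
    intro X hX
    obtain ⟨Z, rfl⟩ := Tm_surj (z := Y.1) (s := Y.2) hr X
    have hZ := (e2 Z).mp hX
    refine (e1 Z).mpr ⟨ball_subset_ball (by norm_num) hZ.1, hZ.2.1, ?_⟩
    have := hZ.2.2
    linarith
  have hAm : MeasurableSet {X ∈ P | 1 ≤ v X} := by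
    have e : {X ∈ P | 1 ≤ v X} = P \ (P ∩ v ⁻¹' Iio 1) := by
      ext X
      constructor
      · rintro ⟨h1, h2⟩
        exact ⟨h1, fun h3 => absurd h2 (not_le.mpr h3.2)⟩
      · rintro ⟨h1, h2⟩
        exact ⟨h1, not_lt.mp fun h3 => h2 ⟨h1, h3⟩⟩
    rw [e]
    exact hPo.measurableSet.diff ((hC'.cont.mono hPQ).isOpen_inter_preimage hPo isOpen_Iio).measurableSet
  have hfin := hit (hsc Y.1 r h) (fun X => 1 * v (Tm Y.1 Y.2 r X)) (hsc_meas hh) hS'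
    (fun X hX => by rw [one_mul]; exact hv _ ((e1 X).mpr hX)) hm' ?_
  · intro X hX
    obtain ⟨Z, rfl⟩ := Tm_surj (z := Y.1) (s := Y.2) hr X
    have := hfin Z ((e3 Z).mp hX)
    linarith
  · have f1 : {X ∈ Qt n (-3 / 4) | 1 ≤ 1 * v (Tm Y.1 Y.2 r X)} = Tm Y.1 Y.2 r ⁻¹' {X ∈ P | 1 ≤ v X} := by
      ext X
      refine and_congr (e2 X).symm ?_
      rw [one_mul]
    have f2 : Qt n (-3 / 4) = Tm Y.1 Y.2 r ⁻¹' P := by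
      ext X
      exact (e2 X).symm
    rw [f1, Tm_vol _ _ hr hAm]
    nth_rewrite 1 [f2]
    rw [Tm_vol _ _ hr hPo.measurableSet, mul_left_comm]
    gcongr
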